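/- Let X be a finite connected 2-dimensional simplicial complex such that every subcomplex Y of X with f^1Y ≥ 1 satisfies f^0Y / f^1Y > 1/3, and let x be a vertex of X. Then the fundamental group π₁(|X|, x) of the geometric realization of X is isomorphic to the free product of a finitely generated free group and finitely many copies of ℤ/2ℤ. -/

import Mathlib

open scoped BigOperators

/-- A finite 2-dimensional abstract simplicial complex on vertex set `Fin N`
(vertex `i ∈ {1,…,N}` corresponds to the element of `Fin N` with value `i-1`). -/
structure SimplicialComplex2 (N : ℕ) where
  faces : Finset (Finset (Fin N))
  nonempty_of_mem : ∀ σ ∈ faces, σ.Nonempty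
  card_le_three : ∀ σ ∈ faces, σ.card ≤ 3
  down_closed : ∀ σ ∈ faces, ∀ τ ⊆ σ, τ.Nonempty → τ ∈ faces

namespace SimplicialComplex2

variable {N : ℕ}

/-- `f i X` is the number of `i`-dimensional faces of `X`. -/
def f (i : ℕ) (X : SimplicialComplex2 N) : ℕ :=
  (X.faces.filter fun σ => σ.card = i + 1).card

/-- The Euler characteristic `χX = f⁰X − f¹X + f²X`. -/
def euler (X : SimplicialComplex2 N) : ℤ :=
  (f 0 X : ℤ) - f 1 X + f 2 X

/-- `Y` is a subcomplex of `X`. -/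
def IsSubcomplex (Y X : SimplicialComplex2 N) : Prop :=
  Y.faces ⊆ X.faces

/-- The `i`-th standard basis vector of `ℝ^N`. -/
def basisVec (i : Fin N) : Fin N → ℝ := Pi.single i 1

/-- The geometric realization of `X` as a subset of `ℝ^N`: the union over the
faces `σ` of `X` of the convex hulls of the corresponding sets of standard basis
vectors. -/
def realization (X : SimplicialComplex2 N) : Set (Fin N → ℝ) :=
  ⋃ σ ∈ X.faces, convexHull ℝ (basisVec '' (σ : Set (Fin N)))

lemma vertex_mem_realization (X : SimplicialComplex2 N) {x : Fin N}
    (hx : {x} ∈ X.faces) : basisVec x ∈ realization X := by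
  refine Set.mem_biUnion hx ?_
  exact subset_convexHull ℝ _ ⟨x, by simp⟩

/-- The point of the realization corresponding to a vertex. -/
def vertexPt (X : SimplicialComplex2 N) {x : Fin N} (hx : {x} ∈ X.faces) :
    ↥(realization X) :=
  ⟨basisVec x, X.vertex_mem_realization hx⟩

end SimplicialComplex2

noncomputable section

/-- The family of groups consisting of one finitely generated free group (on `k`
generators) and `m` copies of `ℤ/2ℤ`. -/
def FPfamily (k m : ℕ) : Unit ⊕ Fin m → Type
  | Sum.inl _ => FreeGroup (Fin k)
  | Sum.inr _ => Multiplicative (ZMod 2)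

instance (k m : ℕ) : ∀ i, Group (FPfamily k m i)
  | Sum.inl _ => inferInstanceAs (Group (FreeGroup (Fin k)))
  | Sum.inr _ => inferInstanceAs (Group (Multiplicative (ZMod 2)))

/-- `G` is freely generated by a family indexed by `A` and a family of involutions
indexed by `B`. -/
def IsFreeInvol (A B G : Type) [Group G] : Prop :=
  ∃ (a : A → G) (b : B → G), (∀ i, b i * b i = 1) ∧
    (∀ (H : Type) [Group H] (a' : A → H) (b' : B → H), (∀ i, b' i * b' i = 1) →
      ∃ f : G →* H, (∀ i, f (a i) = a' i) ∧ ∀ i, f (b i) = b' i) ∧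
    ∀ (H : Type) [Group H] (f g : G →* H), (∀ i, f (a i) = g (a i)) →
      (∀ i, f (b i) = g (b i)) → f = g

/-- `G` is a free product of a finitely generated free group and finitely many groups of
order two. -/
def IsGood (G : Type) [Group G] : Prop :=
  ∃ A B : Type, Finite A ∧ Finite B ∧ IsFreeInvol A B G

lemma IsFreeInvol.nonempty_mulEquiv {A B G G' : Type} [Group G] [Group G']
    (h : IsFreeInvol A B G) (h' : IsFreeInvol A B G') : Nonempty (G ≃* G') := by
  obtain ⟨a, b, hb, he, hu⟩ := h
  obtain ⟨a', b', hb', he', hu'⟩ := h'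
  obtain ⟨f, fa, fb⟩ := he G' a' b' hb'
  obtain ⟨g, ga, gb⟩ := he' G a b hb
  exact ⟨f.toMulEquiv g (hu _ _ _ (by simp [fa, ga]) (by simp [fb, gb]))
    (hu' _ _ _ (by simp [fa, ga]) (by simp [fb, gb]))⟩

lemma IsFreeInvol.reindex {A B A' B' G : Type} [Group G] (eA : A ≃ A') (eB : B ≃ B')
    (h : IsFreeInvol A B G) : IsFreeInvol A' B' G := by
  obtain ⟨a, b, hb, he, hu⟩ := h
  refine ⟨a ∘ eA.symm, b ∘ eB.symm, fun i => hb _, ?_, ?_⟩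
  · intro H _ a' b' hb'
    obtain ⟨f, fa, fb⟩ := he H (a' ∘ eA) (b' ∘ eB) (fun i => hb' _)
    exact ⟨f, fun i => by simp [fa], fun i => by simp [fb]⟩
  · intro H _ f g h1 h2
    exact hu H f g (fun i => by simpa using h1 (eA i)) (fun i => by simpa using h2 (eB i))

/-- The homomorphism from the group of order two determined by an involution. -/
def involHom {H : Type} [Group H] (b : H) (hb : b * b = 1) : Multiplicative (ZMod 2) →* H :=
  AddMonoidHom.toMultiplicativeLeft (ZMod.lift 2 ⟨zmultiplesHom (Additive H) (Additive.ofMul b), by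
    simp only [Nat.cast_ofNat, zmultiplesHom_apply]
    rw [two_zsmul, ← ofMul_mul, hb]; rfl⟩)

lemma involHom_ofAdd_one {H : Type} [Group H] (b : H) (hb : b * b = 1) :
    involHom b hb (Multiplicative.ofAdd 1) = b := by
  have : (1 : ZMod 2) = ((1 : ℤ) : ZMod 2) := by simp
  simp only [involHom, AddMonoidHom.coe_toMultiplicativeLeft, Function.comp_apply, toAdd_ofAdd]
  rw [this, ZMod.lift_coe]
  simp

lemma monoidHom_zmod_two_ext {H : Type} [Group H] {f g : Multiplicative (ZMod 2) →* H}
    (h : f (Multiplicative.ofAdd 1) = g (Multiplicative.ofAdd 1)) : f = g := by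
  refine MonoidHom.ext fun x => ?_
  have : ∀ x : Multiplicative (ZMod 2), x = 1 ∨ x = Multiplicative.ofAdd 1 := by decide
  rcases this x with rfl | rfl
  · simp
  · exact h

/-- The inclusion of the free factor. -/
def freeIncl (k m : ℕ) : FreeGroup (Fin k) →* Monoid.CoprodI (FPfamily k m) :=
  Monoid.CoprodI.of (M := FPfamily k m) (i := Sum.inl ())

/-- The inclusion of a factor of order two. -/
def involIncl (k m : ℕ) (i : Fin m) :
    Multiplicative (ZMod 2) →* Monoid.CoprodI (FPfamily k m) :=
  Monoid.CoprodI.of (M := FPfamily k m) (i := Sum.inr i)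

lemma exists_hom_coprodI {k m : ℕ} {H : Type} [Group H] (f : FreeGroup (Fin k) →* H)
    (g : Fin m → Multiplicative (ZMod 2) →* H) :
    ∃ F : Monoid.CoprodI (FPfamily k m) →* H,
      F.comp (freeIncl k m) = f ∧ ∀ i, F.comp (involIncl k m i) = g i := by
  let F : ∀ i, FPfamily k m i →* H := fun i => match i with
    | Sum.inl _ => f
    | Sum.inr i => g i
  exact ⟨Monoid.CoprodI.lift F, Monoid.CoprodI.lift_comp_of F (Sum.inl ()),
    fun i => Monoid.CoprodI.lift_comp_of F (Sum.inr i)⟩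

lemma coprodI_hom_ext {k m : ℕ} {H : Type} [Group H]
    {f g : Monoid.CoprodI (FPfamily k m) →* H}
    (h1 : f.comp (freeIncl k m) = g.comp (freeIncl k m))
    (h2 : ∀ i, f.comp (involIncl k m i) = g.comp (involIncl k m i)) : f = g := by
  refine Monoid.CoprodI.ext_hom _ _ fun i => ?_
  rcases i with ⟨⟩ | i
  · exact h1
  · exact h2 i

lemma isFreeInvol_coprodI (k m : ℕ) :
    IsFreeInvol (Fin k) (Fin m) (Monoid.CoprodI (FPfamily k m)) := by
  refine ⟨fun i => freeIncl k m (FreeGroup.of i),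
    fun i => involIncl k m i (Multiplicative.ofAdd 1), ?_, ?_, ?_⟩
  · intro i
    rw [← map_mul, show (Multiplicative.ofAdd (1 : ZMod 2)) * Multiplicative.ofAdd 1 = 1 by decide,
      map_one]
  · intro H _ a' b' hb'
    obtain ⟨F, h1, h2⟩ := exists_hom_coprodI (FreeGroup.lift a') fun i => involHom (b' i) (hb' i)
    refine ⟨F, fun i => ?_, fun i => ?_⟩
    · rw [← MonoidHom.comp_apply, h1, FreeGroup.lift_apply_of]
    · rw [← MonoidHom.comp_apply, h2, involHom_ofAdd_one]
  · intro H _ f g h1 h2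
    exact coprodI_hom_ext (FreeGroup.ext_hom _ _ h1) fun i => monoidHom_zmod_two_ext (h2 i)

lemma IsGood.exists_mulEquiv {G : Type} [Group G] (h : IsGood G) :
    ∃ k m : ℕ, Nonempty (G ≃* Monoid.CoprodI (FPfamily k m)) := by
  obtain ⟨A, B, hA, hB, h⟩ := h
  exact ⟨Nat.card A, Nat.card B, (h.reindex (Finite.equivFin A)
    (Finite.equivFin B)).nonempty_mulEquiv (isFreeInvol_coprodI _ _)⟩

lemma IsGood.coprod {G G' : Type} [Group G] [Group G'] (h : IsGood G) (h' : IsGood G') :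
    IsGood (Monoid.Coprod G G') := by
  obtain ⟨A, B, hA, hB, a, b, hb, he, hu⟩ := h
  obtain ⟨A', B', hA', hB', a', b', hb', he', hu'⟩ := h'
  refine ⟨A ⊕ A', B ⊕ B', inferInstance, inferInstance,
    Sum.elim (Monoid.Coprod.inl ∘ a) (Monoid.Coprod.inr ∘ a'),
    Sum.elim (Monoid.Coprod.inl ∘ b) (Monoid.Coprod.inr ∘ b'), ?_, ?_, ?_⟩
  · rintro (i | i)
    · simp [← map_mul, hb]
    · simp [← map_mul, hb']
  · intro H _ s t ht
    obtain ⟨f, fa, fb⟩ := he H (s ∘ Sum.inl) (t ∘ Sum.inl) (fun i => ht _)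
    obtain ⟨g, ga, gb⟩ := he' H (s ∘ Sum.inr) (t ∘ Sum.inr) (fun i => ht _)
    refine ⟨Monoid.Coprod.lift f g, ?_, ?_⟩
    · rintro (i | i) <;> simp [fa, ga]
    · rintro (i | i) <;> simp [fb, gb]
  · intro H _ f g h1 h2
    refine Monoid.Coprod.hom_ext ?_ ?_
    · exact hu _ _ _ (fun i => h1 (Sum.inl i)) (fun i => h2 (Sum.inl i))
    · exact hu' _ _ _ (fun i => h1 (Sum.inr i)) (fun i => h2 (Sum.inr i))

lemma IsGood.of_subsingleton {G : Type} [Group G] [Subsingleton G] : IsGood G := by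
  refine ⟨Empty, Empty, inferInstance, inferInstance, Empty.elim, Empty.elim, nofun, ?_, ?_⟩
  · intro H _ a b _
    exact ⟨1, nofun, nofun⟩
  · intro H _ f g _ _
    ext x
    rw [Subsingleton.elim x 1, map_one, map_one]

lemma isGood_multiplicative_int : IsGood (Multiplicative ℤ) := by
  refine ⟨Unit, Empty, inferInstance, inferInstance, fun _ => Multiplicative.ofAdd 1,
    Empty.elim, nofun, ?_, ?_⟩
  · intro H _ a b _
    exact ⟨zpowersHom H (a ()), fun _ => by simp, nofun⟩
  · intro H _ f g h _
    exact MonoidHom.ext_mint (h ())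

lemma isGood_multiplicative_zmod_two : IsGood (Multiplicative (ZMod 2)) := by
  refine ⟨Empty, Unit, inferInstance, inferInstance, Empty.elim,
    fun _ => Multiplicative.ofAdd 1, by decide, ?_, ?_⟩
  · intro H _ a b hb
    exact ⟨involHom (b ()) (hb ()), nofun, fun _ => involHom_ofAdd_one _ _⟩
  · intro H _ f g _ h
    exact monoidHom_zmod_two_ext (h ())

section Cocycles

set_option linter.unusedSectionVars false

variable {α : Type} [DecidableEq α]

/-- `K` is a simplicial complex of dimension at most two. -/
structure IsCx (K : Finset (Finset α)) : Prop where
  nonempty : ∀ σ ∈ K, σ.Nonempty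
  card_le : ∀ σ ∈ K, σ.card ≤ 3
  down : ∀ σ ∈ K, ∀ τ ⊆ σ, τ.Nonempty → τ ∈ K

/-- Two vertices are joined by an edge path. -/
def Reach (K : Finset (Finset α)) : α → α → Prop :=
  Relation.ReflTransGen fun u v => {u, v} ∈ K

/-- `K` is nonempty and any two of its vertices are joined by an edge path. -/
def IsConn (K : Finset (Finset α)) : Prop :=
  (∃ x, {x} ∈ K) ∧ ∀ x y, {x} ∈ K → {y} ∈ K → Reach K x y

/-- A flat assignment of group elements to the oriented edges of `K`. -/
def IsCocycle {H : Type} [Group H] (K : Finset (Finset α)) (ψ : α → α → H) : Prop :=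
  ∀ u v w, {u, v, w} ∈ K → ψ u v * ψ v w = ψ u w

/-- `ψ` is the image of `φ` under `f`, up to the gauge transformation `c`. -/
def IsSol {G H : Type} [Group G] [Group H] (K : Finset (Finset α)) (x : α)
    (φ : α → α → G) (ψ : α → α → H) (f : G →* H) (c : α → H) : Prop :=
  c x = 1 ∧ ∀ u v, {u, v} ∈ K → c u * ψ u v = f (φ u v) * c v

/-- `φ` is the universal cocycle on `K` (based at `x`), so that `G` is the edge path group. -/
structure IsUniv (K : Finset (Finset α)) (x : α) (G : Type) [Group G] (φ : α → α → G) :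
    Prop where
  cocycle : IsCocycle K φ
  exists_sol : ∀ (H : Type) [Group H] (ψ : α → α → H), IsCocycle K ψ →
    ∃ (f : G →* H) (c : α → H), IsSol K x φ ψ f c
  unique : ∀ (H : Type) [Group H] (ψ : α → α → H) (f f' : G →* H) (c c' : α → H),
    IsSol K x φ ψ f c → IsSol K x φ ψ f' c' → f = f'

variable {K L : Finset (Finset α)} {G H : Type} [Group G] [Group H]

lemma IsCx.edge_mem (hK : IsCx K) {σ : Finset α} (hσ : σ ∈ K) {u v : α} (hu : u ∈ σ)
    (hv : v ∈ σ) : {u, v} ∈ K :=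
  hK.down σ hσ _ (by grind) (by simp)

lemma IsCx.vertex_mem (hK : IsCx K) {σ : Finset α} (hσ : σ ∈ K) {u : α} (hu : u ∈ σ) :
    {u} ∈ K :=
  hK.down σ hσ _ (by grind) (by simp)

lemma IsCx.left_mem (hK : IsCx K) {u v : α} (h : {u, v} ∈ K) : {u} ∈ K :=
  hK.vertex_mem h (by simp)

lemma IsCx.right_mem (hK : IsCx K) {u v : α} (h : {u, v} ∈ K) : {v} ∈ K :=
  hK.vertex_mem h (by simp)

lemma Reach.symm {x y : α} (h : Reach K x y) : Reach K y x := by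
  induction h with
  | refl => exact Relation.ReflTransGen.refl
  | tail _ hm ih => exact Relation.ReflTransGen.head (by rwa [Finset.pair_comm]) ih

lemma Reach.mono {x y : α} (h : Reach K x y) (hKL : K ⊆ L) : Reach L x y :=
  Relation.ReflTransGen.mono (fun _ _ h => hKL h) _ _ h

lemma Reach.trans {x y z : α} (h : Reach K x y) (h' : Reach K y z) : Reach K x z :=
  Relation.ReflTransGen.trans h h'

lemma Reach.edge {x y : α} (h : {x, y} ∈ K) : Reach K x y :=
  Relation.ReflTransGen.single h

lemma IsCocycle.mono {ψ : α → α → H} (h : IsCocycle L ψ) (hKL : K ⊆ L) : IsCocycle K ψ :=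
  fun u v w hm => h u v w (hKL hm)

lemma IsCocycle.mul {ψ : α → α → H} (h : IsCocycle K ψ) (hK : IsCx K) {σ : Finset α}
    (hσ : σ ∈ K) {u v w : α} (hu : u ∈ σ) (hv : v ∈ σ) (hw : w ∈ σ) :
    ψ u v * ψ v w = ψ u w :=
  h u v w (hK.down σ hσ _ (by grind) (by simp))

lemma IsCocycle.self {ψ : α → α → H} (h : IsCocycle K ψ) {u : α} (hu : {u} ∈ K) :
    ψ u u = 1 := by
  have := h u u u (by simpa using hu)
  simpa using this

lemma IsCocycle.mul_swap {ψ : α → α → H} (h : IsCocycle K ψ) (hK : IsCx K) {u v : α}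
    (hu : {u, v} ∈ K) : ψ u v * ψ v u = 1 := by
  rw [h.mul hK hu (by simp) (by simp) (by simp), h.self (hK.left_mem hu)]

lemma IsCocycle.inv {ψ : α → α → H} (h : IsCocycle K ψ) (hK : IsCx K) {u v : α}
    (hu : {u, v} ∈ K) : (ψ u v)⁻¹ = ψ v u :=
  inv_eq_of_mul_eq_one_right (h.mul_swap hK hu)

/-- A cocycle restricted to a single simplex is a coboundary. -/
lemma IsCocycle.of_potential {ψ : α → α → H}
    (h : ∀ σ ∈ K, ∃ p : α → H, ∀ u ∈ σ, ∀ v ∈ σ, ψ u v = (p u)⁻¹ * p v) : IsCocycle K ψ := by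
  intro u v w hm
  obtain ⟨p, hp⟩ := h _ hm
  rw [hp u (by simp) v (by simp), hp v (by simp) w (by simp), hp u (by simp) w (by simp)]
  group

lemma IsCocycle.map {ψ : α → α → G} (h : IsCocycle K ψ) (f : G →* H) :
    IsCocycle K fun u v => f (ψ u v) := fun u v w hm => by
  rw [← map_mul, h u v w hm]

lemma IsSol.mono {x : α} {φ : α → α → G} {ψ : α → α → H} {f : G →* H} {c : α → H}
    (h : IsSol L x φ ψ f c) (hKL : K ⊆ L) : IsSol K x φ ψ f c :=
  ⟨h.1, fun u v hm => h.2 u v (hKL hm)⟩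

/-- On a connected complex the gauge transformation is determined by the homomorphism. -/
lemma IsSol.gauge_eq {x : α} {φ : α → α → G} {ψ : α → α → H} {f : G →* H} {c c' : α → H}
    (h : IsSol K x φ ψ f c) (h' : IsSol K x φ ψ f c') {y : α} (hy : Reach K x y) :
    c y = c' y := by
  induction hy with
  | refl => rw [h.1, h'.1]
  | tail _ hm ih =>
    rename_i u v _
    have h1 := h.2 u v hm
    have h2 := h'.2 u v hm
    rw [ih, h2] at h1
    exact (mul_left_cancel h1).symm

lemma IsUniv.change_base {x : α} {φ : α → α → G} (h : IsUniv K x G φ) {y : α}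
    (hy : Reach K x y) : IsUniv K y G φ := by
  have key : ∀ (H : Type) [Group H] (ψ : α → α → H) (f : G →* H) (c : α → H) (a b : α),
      IsSol K a φ ψ f c →
      IsSol K b φ ψ ((MulAut.conj (c b)⁻¹).toMonoidHom.comp f) fun v => (c b)⁻¹ * c v := by
    intro H _ ψ f c a b hs
    refine ⟨by simp, fun u v hm => ?_⟩
    simp [mul_assoc, hs.2 u v hm]
  refine ⟨h.cocycle, fun H _ ψ hψ => ?_, fun H _ ψ f f' c c' hs hs' => ?_⟩
  · obtain ⟨f, c, hs⟩ := h.exists_sol H ψ hψ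
    exact ⟨_, _, key H ψ f c x y hs⟩
  · have e := h.unique H ψ _ _ _ _ (key H ψ f c y x hs) (key H ψ f' c' y x hs')
    have hc : c x = c' x := by
      have h1 := key H ψ f c y x hs
      have h2 := key H ψ f' c' y x hs'
      rw [← e] at h2
      have := h1.gauge_eq h2 hy
      simp only [hs.1, hs'.1, mul_one, inv_inj] at this
      exact this
    ext g
    have := DFunLike.congr_fun e g
    simpa [hc] using this

lemma IsUniv.gauge {x : α} {φ : α → α → G} (h : IsUniv K x G φ) (d : α → G) (hd : d x = 1) :
    IsUniv K x G fun u v => d u * φ u v * (d v)⁻¹ := by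
  have key : ∀ (H : Type) [Group H] (ψ : α → α → H) (f : G →* H) (c : α → H),
      IsSol K x (fun u v => d u * φ u v * (d v)⁻¹) ψ f c ↔
      IsSol K x φ ψ f fun v => f (d v)⁻¹ * c v := by
    intro H _ ψ f c
    refine and_congr (by simp [hd]) (forall_congr' fun u => forall_congr' fun v =>
      imp_congr Iff.rfl ?_)
    simp only [map_mul, map_inv, mul_assoc]
    rw [inv_mul_eq_iff_eq_mul]
  refine ⟨fun u v w hm => ?_, fun H _ ψ hψ => ?_, fun H _ ψ f f' c c' hs hs' => ?_⟩
  · rw [← h.cocycle u v w hm]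
    group
  · obtain ⟨f, c, hs⟩ := h.exists_sol H ψ hψ
    refine ⟨f, fun v => f (d v) * c v, (key _ _ _ _).2 ?_⟩
    simpa using hs
  · exact h.unique H ψ f f' _ _ ((key _ _ _ _).1 hs) ((key _ _ _ _).1 hs')

/-- A universal cocycle on `K` extends to one on `L` when cocycles extend uniquely. -/
lemma IsUniv.extend {x : α} {φ : α → α → G} (h : IsUniv K x G φ) (hKL : K ⊆ L)
    (hext : ∀ (H : Type) [Group H] (ψ : α → α → H), IsCocycle K ψ →
      ∃ ψ' : α → α → H, IsCocycle L ψ' ∧ ∀ u v, {u, v} ∈ K → ψ' u v = ψ u v)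
    (huniq : ∀ (H : Type) [Group H] (ψ ψ' : α → α → H), IsCocycle L ψ → IsCocycle L ψ' →
      (∀ u v, {u, v} ∈ K → ψ u v = ψ' u v) → ∀ u v, {u, v} ∈ L → ψ u v = ψ' u v) :
    ∃ φ' : α → α → G, IsUniv L x G φ' ∧ ∀ u v, {u, v} ∈ K → φ' u v = φ u v := by
  obtain ⟨φ', hφ', he⟩ := hext G φ h.cocycle
  refine ⟨φ', ⟨hφ', fun H _ ψ hψ => ?_, fun H _ ψ f f' c c' hs hs' => ?_⟩, he⟩
  · obtain ⟨f, c, hs⟩ := h.exists_sol H ψ (hψ.mono hKL)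
    refine ⟨f, c, hs.1, fun u v hm => ?_⟩
    have := huniq H (fun u v => c u * ψ u v * (c v)⁻¹) (fun u v => f (φ' u v))
      (fun u v w hm => by simp only [← hψ u v w hm]; group) (hφ'.map f)
      (fun u v hm => by simp only [hs.2 u v hm, he u v hm]; group) u v hm
    rw [← this]
    group
  · refine h.unique H ψ f f' c c' ⟨hs.1, fun u v hm => ?_⟩ ⟨hs'.1, fun u v hm => ?_⟩
    · rw [← he u v hm, hs.2 u v (hKL hm)]
    · rw [← he u v hm, hs'.2 u v (hKL hm)]

lemma isUniv_singleton (x : α) : IsUniv {{x}} x Unit fun _ _ => 1 := by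
  have key : ∀ u v : α, ({u, v} : Finset α) ∈ ({{x}} : Finset (Finset α)) → u = x ∧ v = x := by
    intro u v h
    simp only [Finset.mem_singleton, Finset.ext_iff, Finset.mem_insert] at h
    exact ⟨(h u).1 (Or.inl rfl), (h v).1 (Or.inr rfl)⟩
  refine ⟨fun u v w _ => rfl, fun H _ ψ hψ => ⟨1, fun _ => 1, rfl, fun u v hm => ?_⟩,
    fun H _ ψ f f' c c' hs hs' => ?_⟩
  · obtain ⟨rfl, rfl⟩ := key u v hm
    rw [hψ.self (by simp)]
    simp
  · exact MonoidHom.ext fun _ => (map_one f).trans (map_one f').symm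

/-- The closed edge. -/
def closedEdge (a b : α) : Finset (Finset α) := {{a}, {b}, {a, b}}

lemma mem_closedEdge {a b : α} {σ : Finset α} :
    σ ∈ closedEdge a b ↔ σ = {a} ∨ σ = {b} ∨ σ = {a, b} := by
  simp [closedEdge]

lemma mem_of_mem_closedEdge {a b : α} {σ : Finset α} (h : σ ∈ closedEdge a b) {u : α}
    (hu : u ∈ σ) : u = a ∨ u = b := by
  rw [mem_closedEdge] at h
  grind

lemma isUniv_closedEdge {a b : α} (hab : a ≠ b) :
    IsUniv (closedEdge a b) a Unit fun _ _ => 1 := by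
  refine ⟨fun u v w _ => rfl, fun H _ ψ hψ => ⟨1, fun v => ψ a v, hψ.self
    (by simp [closedEdge]), fun u v hm => ?_⟩, fun H _ ψ f f' c c' hs hs' => ?_⟩
  · have h1 := mem_of_mem_closedEdge hm (u := u) (by simp)
    have h2 := mem_of_mem_closedEdge hm (u := v) (by simp)
    rw [MonoidHom.one_apply, one_mul]
    refine hψ _ _ _ (mem_closedEdge.2 ?_)
    rcases h1 with rfl | rfl <;> rcases h2 with rfl | rfl <;> simp [Finset.pair_comm]
  · exact MonoidHom.ext fun _ => (map_one f).trans (map_one f').symm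

end Cocycles

section UnivConstructions

set_option linter.unusedSectionVars false

variable {α : Type} [DecidableEq α]
variable {K L : Finset (Finset α)} {G H : Type} [Group G] [Group H]

lemma pair_eq_pair {a b x y : α} (h : ({x, y} : Finset α) = {a, b}) :
    (x = a ∧ y = b) ∨ (x = b ∧ y = a) ∨ a = b := by
  simp only [Finset.ext_iff, Finset.mem_insert, Finset.mem_singleton] at h
  have h1 := h x
  have h2 := h y
  have h3 := h a
  have h4 := h b
  grind

lemma IsCocycle.potential {ψ : α → α → H} (h : IsCocycle K ψ) (hK : IsCx K) {σ : Finset α}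
    (hσ : σ ∈ K) {x : α} (hx : x ∈ σ) : ∀ u ∈ σ, ∀ v ∈ σ, ψ u v = (ψ x u)⁻¹ * ψ x v := by
  intro u hu v hv
  rw [← h.mul hK hσ hx hu hv]
  group

/-- Removing a free edge of a triangle, together with the triangle. -/
lemma IsUniv.of_collapse {x : α} {φ : α → α → G} {a b c : α} (hK : IsCx K)
    (hab : a ≠ b) (hac : a ≠ c) (hbc : b ≠ c) (ht : {a, b, c} ∈ K)
    (hfree : ∀ σ ∈ K, a ∈ σ → b ∈ σ → σ = {a, b} ∨ σ = {a, b, c})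
    (h : IsUniv ((K.erase {a, b, c}).erase {a, b}) x G φ) :
    ∃ φ' : α → α → G, IsUniv K x G φ' ∧
      ∀ u v, {u, v} ∈ (K.erase {a, b, c}).erase {a, b} → φ' u v = φ u v := by
  have hsub : ((K.erase {a, b, c}).erase {a, b}) ⊆ K :=
    (Finset.erase_subset _ _).trans (Finset.erase_subset _ _)
  have hmem : ∀ σ ∈ K, ¬ (a ∈ σ ∧ b ∈ σ) → σ ∈ (K.erase {a, b, c}).erase {a, b} := by
    intro σ hσ hn
    simp only [Finset.mem_erase]
    exact ⟨fun e => hn (by simp [e]), fun e => hn (by simp [e]), hσ⟩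
  have hnot : ∀ σ ∈ (K.erase {a, b, c}).erase {a, b}, ¬ (a ∈ σ ∧ b ∈ σ) := by
    intro σ hσ hn
    simp only [Finset.mem_erase] at hσ
    rcases hfree σ hσ.2.2 hn.1 hn.2 with h | h
    · exact hσ.1 h
    · exact hσ.2.1 h
  have hca : {c, a} ∈ (K.erase {a, b, c}).erase {a, b} :=
    hmem _ (hK.edge_mem ht (by simp) (by simp)) (by simp; grind)
  have hcb : {c, b} ∈ (K.erase {a, b, c}).erase {a, b} :=
    hmem _ (hK.edge_mem ht (by simp) (by simp)) (by simp; grind)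
  have hK' : IsCx ((K.erase {a, b, c}).erase {a, b}) := by
    refine ⟨fun σ hσ => hK.nonempty σ (hsub hσ), fun σ hσ => hK.card_le σ (hsub hσ), ?_⟩
    intro σ hσ τ hτ hne
    exact hmem τ (hK.down σ (hsub hσ) τ hτ hne) fun hh => hnot σ hσ ⟨hτ hh.1, hτ hh.2⟩
  refine h.extend hsub ?_ ?_
  · intro H _ ψ hψ
    refine ⟨fun u v => if u = a ∧ v = b then ψ a c * ψ c b else
      if u = b ∧ v = a then ψ b c * ψ c a else ψ u v, ?_, ?_⟩
    · refine IsCocycle.of_potential fun σ hσ => ?_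
      by_cases hn : a ∈ σ ∧ b ∈ σ
      · have hs : σ ⊆ {a, b, c} := by
          rcases hfree σ hσ hn.1 hn.2 with h | h <;> rw [h]
          grind
        have ea : ψ a c = (ψ c a)⁻¹ := by
          rw [hψ.inv hK' hca]
        have eb : ψ b c = (ψ c b)⁻¹ := by
          rw [hψ.inv hK' hcb]
        have ec : ψ c c = 1 := hψ.self (hK'.left_mem hca)
        have eaa : ψ a a = 1 := hψ.self (hK'.right_mem hca)
        have ebb : ψ b b = 1 := hψ.self (hK'.right_mem hcb)
        refine ⟨fun u => ψ c u, fun u hu v hv => ?_⟩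
        have hu' := hs hu
        have hv' := hs hv
        simp only [Finset.mem_insert, Finset.mem_singleton] at hu' hv'
        rcases hu' with rfl | rfl | rfl <;> rcases hv' with rfl | rfl | rfl <;>
          simp_all [Ne.symm]
      · have hσ' := hmem σ hσ hn
        obtain ⟨y, hy⟩ := hK.nonempty σ hσ
        refine ⟨ψ y, fun u hu v hv => ?_⟩
        rw [if_neg (by rintro ⟨rfl, rfl⟩; exact hn ⟨hu, hv⟩),
          if_neg (by rintro ⟨rfl, rfl⟩; exact hn ⟨hv, hu⟩)]
        exact hψ.potential hK' hσ' hy u hu v hv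
    · intro u v hm
      have := hnot _ hm
      beta_reduce
      rw [if_neg (by rintro ⟨rfl, rfl⟩; exact this (by simp)),
        if_neg (by rintro ⟨rfl, rfl⟩; exact this (by simp))]
  · intro H _ ψ ψ' h1 h2 he u v hm
    by_cases hn : a ∈ ({u, v} : Finset α) ∧ b ∈ ({u, v} : Finset α)
    · have hcu : ∀ u ∈ ({a, b} : Finset α), ψ c u = ψ' c u := by
        intro u hu
        simp only [Finset.mem_insert, Finset.mem_singleton] at hu
        rcases hu with rfl | rfl
        · exact he _ _ hca
        · exact he _ _ hcb
      have huv : u ∈ ({a, b} : Finset α) ∧ v ∈ ({a, b} : Finset α) := by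
        grind
      have hs : ({a, b} : Finset α) ⊆ {a, b, c} := by grind
      rw [h1.potential hK ht (x := c) (by simp) u (hs huv.1) v (hs huv.2),
        h2.potential hK ht (x := c) (by simp) u (hs huv.1) v (hs huv.2), hcu u huv.1,
        hcu v huv.2]
    · exact he u v (hmem _ hm hn)

/-- Every flat assignment on the other faces is flat on the triangle `t`. -/
def Removable (K : Finset (Finset α)) (t : Finset α) : Prop :=
  ∀ (H : Type) [Group H] (ψ : α → α → H), IsCocycle (K.erase t) ψ → IsCocycle K ψ

lemma IsCocycle.of_erase {ψ : α → α → H} {t : Finset α} (h : IsCocycle (K.erase t) ψ)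
    (h' : ∀ u v w, {u, v, w} = t → ψ u v * ψ v w = ψ u w) : IsCocycle K ψ := by
  intro u v w hm
  by_cases e : {u, v, w} = t
  · exact h' u v w e
  · exact h u v w (Finset.mem_erase.2 ⟨e, hm⟩)

lemma Removable.mono {t : Finset α} (h : Removable K t) (hKL : K ⊆ L) (ht : t ∈ K) :
    Removable L t := by
  intro H _ ψ hψ
  refine hψ.of_erase fun u v w e => ?_
  exact h H ψ (hψ.mono (Finset.erase_subset_erase _ hKL)) u v w (e ▸ ht)

lemma IsUniv.of_removable {x : α} {φ : α → α → G} {t : Finset α} (ht : t.card = 3)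
    (hr : Removable K t) (h : IsUniv (K.erase t) x G φ) :
    IsUniv K x G φ := by
  have hne : ∀ u v : α, {u, v} ∈ K → {u, v} ∈ K.erase t := by
    intro u v hm
    refine Finset.mem_erase.2 ⟨?_, hm⟩
    rintro rfl
    have := Finset.card_le_two (a := u) (b := v)
    omega
  refine ⟨hr G φ h.cocycle, fun H _ ψ hψ => ?_, fun H _ ψ f f' c c' hs hs' => ?_⟩
  · obtain ⟨f, c, hs⟩ := h.exists_sol H ψ (hψ.mono (Finset.erase_subset _ _))
    exact ⟨f, c, hs.1, fun u v hm => hs.2 u v (hne u v hm)⟩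
  · exact h.unique H ψ f f' c c' (hs.mono (Finset.erase_subset _ _))
      (hs'.mono (Finset.erase_subset _ _))

lemma IsCx.erase_of_card {t : Finset α} (hK : IsCx K) (ht : t.card = 3) :
    IsCx (K.erase t) := by
  refine ⟨fun σ hσ => hK.nonempty σ (Finset.mem_of_mem_erase hσ),
    fun σ hσ => hK.card_le σ (Finset.mem_of_mem_erase hσ), fun σ hσ τ hτ hne => ?_⟩
  rw [Finset.mem_erase] at hσ ⊢
  refine ⟨?_, hK.down σ hσ.2 τ hτ hne⟩
  rintro rfl
  exact hσ.1 (Finset.eq_of_subset_of_card_le hτ (by have := hK.card_le σ hσ.2; omega)).symm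

/-- Flatness on a triangle whose proper faces are already flat. -/
lemma IsCocycle.of_erase_triangle {ψ : α → α → H} (hK : IsCx K) {a b c : α}
    (hc : ({a, b, c} : Finset α).card = 3) (ht : {a, b, c} ∈ K)
    (h : IsCocycle (K.erase {a, b, c}) ψ) (h' : ψ a b * ψ b c * ψ c a = 1) :
    IsCocycle K ψ := by
  have hK' := hK.erase_of_card hc
  have hp : ∀ u ∈ ({a, b, c} : Finset α), ∀ v ∈ ({a, b, c} : Finset α),
      {u, v} ∈ K.erase {a, b, c} := by
    intro u hu v hv
    refine Finset.mem_erase.2 ⟨?_, hK.edge_mem ht hu hv⟩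
    intro e
    have := Finset.card_le_two (a := u) (b := v)
    rw [e] at this
    omega
  refine h.of_erase fun u v w e => ?_
  have ha : a ∈ ({a, b, c} : Finset α) := by simp
  have hb : b ∈ ({a, b, c} : Finset α) := by simp
  have hcc : c ∈ ({a, b, c} : Finset α) := by simp
  have eba : ψ b a = (ψ a b)⁻¹ := (h.inv hK' (hp a ha b hb)).symm
  have ecb : ψ c b = (ψ b c)⁻¹ := (h.inv hK' (hp b hb c hcc)).symm
  have eac : ψ a c = ψ a b * ψ b c := by
    rw [← h.inv hK' (hp c hcc a ha)]
    exact inv_eq_of_mul_eq_one_left h'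
  have eca : ψ c a = (ψ a c)⁻¹ := (h.inv hK' (hp a ha c hcc)).symm
  have eaa : ψ a a = 1 := h.self (hK'.left_mem (hp a ha a ha))
  have ebb : ψ b b = 1 := h.self (hK'.left_mem (hp b hb b hb))
  have ecc : ψ c c = 1 := h.self (hK'.left_mem (hp c hcc c hcc))
  have key : ∀ u ∈ ({a, b, c} : Finset α), ∀ v ∈ ({a, b, c} : Finset α),
      ψ u v = (ψ a u)⁻¹ * ψ a v := by
    intro u hu v hv
    simp only [Finset.mem_insert, Finset.mem_singleton] at hu hv
    rcases hu with rfl | rfl | rfl <;> rcases hv with rfl | rfl | rfl <;>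
      simp [eba, ecb, eca, eac, eaa, ebb, ecc]
  have hu : u ∈ ({a, b, c} : Finset α) := by rw [← e]; simp
  have hv : v ∈ ({a, b, c} : Finset α) := by rw [← e]; simp
  have hw : w ∈ ({a, b, c} : Finset α) := by rw [← e]; simp
  rw [key u hu v hv, key v hv w hw, key u hu w hw]
  group

lemma IsCocycle.triangle_eq_one {ψ : α → α → H} (hK : IsCx K) {a b c : α}
    (ht : {a, b, c} ∈ K) (h : IsCocycle K ψ) : ψ a b * ψ b c * ψ c a = 1 := by
  rw [h a b c ht, h.mul hK ht (by simp) (by simp) (by simp),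
    h.self (hK.vertex_mem ht (by simp))]

lemma IsSol.triangle {x : α} {φ : α → α → G} {ψ : α → α → H} {f : G →* H} {d : α → H}
    (hs : IsSol K x φ ψ f d) {a b c : α} (hab : {a, b} ∈ K) (hbc : {b, c} ∈ K)
    (hca : {c, a} ∈ K) :
    d a * (ψ a b * ψ b c * ψ c a) * (d a)⁻¹ = f (φ a b * φ b c * φ c a) := by
  have h1 := hs.2 a b hab
  have h2 := hs.2 b c hbc
  have h3 := hs.2 c a hca
  rw [← eq_mul_inv_iff_mul_eq] at h1 h2 h3
  rw [map_mul, map_mul, ← mul_inv_eq_iff_eq_mul.2 (hs.2 a b hab),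
    ← mul_inv_eq_iff_eq_mul.2 (hs.2 b c hbc), ← mul_inv_eq_iff_eq_mul.2 (hs.2 c a hca)]
  group

lemma removable_of_isUniv {x : α} {φ : α → α → G} (hK : IsCx K) {a b c : α}
    (hc : ({a, b, c} : Finset α).card = 3) (ht : {a, b, c} ∈ K)
    (h : IsUniv (K.erase {a, b, c}) x G φ) (h1 : φ a b * φ b c * φ c a = 1) :
    Removable K {a, b, c} := by
  intro H _ ψ hψ
  obtain ⟨f, d, hs⟩ := h.exists_sol H ψ hψ
  refine IsCocycle.of_erase_triangle hK hc ht hψ ?_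
  have hp : ∀ u ∈ ({a, b, c} : Finset α), ∀ v ∈ ({a, b, c} : Finset α),
      {u, v} ∈ K.erase {a, b, c} := by
    intro u hu v hv
    refine Finset.mem_erase.2 ⟨?_, hK.edge_mem ht hu hv⟩
    intro e
    have := Finset.card_le_two (a := u) (b := v)
    rw [e] at this
    omega
  have := hs.triangle (hp a (by simp) b (by simp)) (hp b (by simp) c (by simp))
    (hp c (by simp) a (by simp))
  rw [h1, map_one] at this
  simpa using this

/-- Attaching a triangle replaces the group by the quotient by its boundary. -/
lemma IsUniv.attach {Q : Type} [Group Q] {x : α} {φ : α → α → G} (hK : IsCx K) {a b c : α}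
    (hc : ({a, b, c} : Finset α).card = 3) (ht : {a, b, c} ∈ K)
    (h : IsUniv (K.erase {a, b, c}) x G φ) (q : G →* Q) (hq : Function.Surjective q)
    (hq1 : q (φ a b * φ b c * φ c a) = 1)
    (hq2 : ∀ (H : Type) [Group H] (f : G →* H), f (φ a b * φ b c * φ c a) = 1 →
      ∃ f' : Q →* H, f'.comp q = f) :
    IsUniv K x Q fun u v => q (φ u v) := by
  have hp : ∀ u v : α, {u, v} ∈ K → {u, v} ∈ K.erase {a, b, c} := by
    intro u v hu
    refine Finset.mem_erase.2 ⟨?_, hu⟩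
    intro e
    have := Finset.card_le_two (a := u) (b := v)
    rw [e] at this
    omega
  refine ⟨?_, fun H _ ψ hψ => ?_, fun H _ ψ f f' d d' hs hs' => ?_⟩
  · refine IsCocycle.of_erase_triangle hK hc ht (h.cocycle.map q) ?_
    simpa using hq1
  · obtain ⟨f, d, hs⟩ := h.exists_sol H ψ (hψ.mono (Finset.erase_subset _ _))
    have e := hs.triangle (hp a b (hK.edge_mem ht (by simp) (by simp)))
      (hp b c (hK.edge_mem ht (by simp) (by simp))) (hp c a (hK.edge_mem ht (by simp) (by simp)))
    rw [hψ.triangle_eq_one hK ht] at e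
    obtain ⟨f', rfl⟩ := hq2 H f (by simpa using e.symm)
    exact ⟨f', d, hs.1, fun u v hm => hs.2 u v (hp u v hm)⟩
  · have := h.unique H ψ (f.comp q) (f'.comp q) d d' (IsSol.mono hs (Finset.erase_subset _ _))
      (IsSol.mono hs' (Finset.erase_subset _ _))
    ext y
    obtain ⟨z, rfl⟩ := hq y
    exact DFunLike.congr_fun this z

/-- Attaching an edge to a connected complex. -/
lemma IsUniv.attach_edge {x : α} {φ : α → α → G} (hK : IsCx K) {a b : α} (hab : a ≠ b)
    (he : {a, b} ∈ K) (hmax : ∀ σ ∈ K, a ∈ σ → b ∈ σ → σ = {a, b})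
    (ha : Reach (K.erase {a, b}) x a) (hb : Reach (K.erase {a, b}) x b)
    (h : IsUniv (K.erase {a, b}) x G φ) :
    IsUniv K x (Monoid.Coprod G (Multiplicative ℤ)) fun u v =>
      if u = a ∧ v = b then Monoid.Coprod.inr (Multiplicative.ofAdd 1) else
      if u = b ∧ v = a then (Monoid.Coprod.inr (Multiplicative.ofAdd 1))⁻¹ else
      Monoid.Coprod.inl (φ u v) := by
  have hsub : K.erase {a, b} ⊆ K := Finset.erase_subset _ _
  have hmem : ∀ σ ∈ K, ¬ (a ∈ σ ∧ b ∈ σ) → σ ∈ K.erase {a, b} := by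
    intro σ hσ hn
    exact Finset.mem_erase.2 ⟨fun e => hn (by simp [e]), hσ⟩
  have hnot : ∀ σ ∈ K.erase {a, b}, ¬ (a ∈ σ ∧ b ∈ σ) := by
    intro σ hσ hn
    rw [Finset.mem_erase] at hσ
    exact hσ.1 (hmax σ hσ.2 hn.1 hn.2)
  have hK' : IsCx (K.erase {a, b}) := by
    refine ⟨fun σ hσ => hK.nonempty σ (hsub hσ), fun σ hσ => hK.card_le σ (hsub hσ), ?_⟩
    intro σ hσ τ hτ hne
    exact hmem τ (hK.down σ (hsub hσ) τ hτ hne) fun hh => hnot σ hσ ⟨hτ hh.1, hτ hh.2⟩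
  have hval : ∀ u v, {u, v} ∈ K.erase {a, b} → (if u = a ∧ v = b then
      Monoid.Coprod.inr (Multiplicative.ofAdd 1) else if u = b ∧ v = a then
      (Monoid.Coprod.inr (Multiplicative.ofAdd 1))⁻¹ else
      (Monoid.Coprod.inl (φ u v) : Monoid.Coprod G (Multiplicative ℤ))) =
        Monoid.Coprod.inl (φ u v) := by
    intro u v hm
    have := hnot _ hm
    rw [if_neg (by rintro ⟨rfl, rfl⟩; exact this (by simp)),
      if_neg (by rintro ⟨rfl, rfl⟩; exact this (by simp))]
  have haa : φ a a = 1 := h.cocycle.self (hmem _ (hK.left_mem he) (by simp; grind))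
  have hbb : φ b b = 1 := h.cocycle.self (hmem _ (hK.right_mem he) (by simp; grind))
  refine ⟨?_, fun H _ ψ hψ => ?_, fun H _ ψ f f' c c' hs hs' => ?_⟩
  · refine IsCocycle.of_potential fun σ hσ => ?_
    by_cases hn : a ∈ σ ∧ b ∈ σ
    · have hs : σ = {a, b} := hmax σ hσ hn.1 hn.2
      refine ⟨fun u => if u = b then Monoid.Coprod.inr (Multiplicative.ofAdd 1) else 1,
        fun u hu v hv => ?_⟩
      rw [hs] at hu hv
      simp only [Finset.mem_insert, Finset.mem_singleton] at hu hv
      rcases hu with rfl | rfl <;> rcases hv with rfl | rfl <;>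
          simp_all [hab.symm]
    · have hσ' := hmem σ hσ hn
      obtain ⟨y, hy⟩ := hK.nonempty σ hσ
      refine ⟨fun u => Monoid.Coprod.inl (φ y u), fun u hu v hv => ?_⟩
      rw [hval u v (hK'.edge_mem hσ' hu hv), h.cocycle.potential hK' hσ' hy u hu v hv]
      simp
  · obtain ⟨f, c, hs⟩ := h.exists_sol H ψ (hψ.mono hsub)
    refine ⟨Monoid.Coprod.lift f (zpowersHom H (c a * ψ a b * (c b)⁻¹)), c, hs.1,
      fun u v hm => ?_⟩
    by_cases hn : a ∈ ({u, v} : Finset α) ∧ b ∈ ({u, v} : Finset α)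
    · have : (u = a ∧ v = b) ∨ (u = b ∧ v = a) := by
        simp only [Finset.mem_insert, Finset.mem_singleton] at hn
        grind
      rcases this with ⟨rfl, rfl⟩ | ⟨rfl, rfl⟩
      · simp
      · beta_reduce
        rw [if_neg (by rintro ⟨e, -⟩; exact hab e.symm), if_pos ⟨rfl, rfl⟩, map_inv, Monoid.Coprod.lift_apply_inr,
          zpowersHom_apply, toAdd_ofAdd, zpow_one, ← hψ.inv hK he]
        group
    · beta_reduce
      rw [hval u v (hmem _ hm hn), Monoid.Coprod.lift_apply_inl]
      exact hs.2 u v (hmem _ hm hn)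
  · have key : ∀ {f : Monoid.Coprod G (Multiplicative ℤ) →* H} {c : α → H},
        IsSol K x (fun u v => if u = a ∧ v = b then
          Monoid.Coprod.inr (Multiplicative.ofAdd 1) else if u = b ∧ v = a then
          (Monoid.Coprod.inr (Multiplicative.ofAdd 1))⁻¹ else
          (Monoid.Coprod.inl (φ u v) : Monoid.Coprod G (Multiplicative ℤ))) ψ f c →
        IsSol (K.erase {a, b}) x φ ψ (f.comp Monoid.Coprod.inl) c ∧
          f (Monoid.Coprod.inr (Multiplicative.ofAdd 1)) = c a * ψ a b * (c b)⁻¹ := by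
      intro f c hs
      refine ⟨⟨hs.1, fun u v hm => ?_⟩, ?_⟩
      · rw [hs.2 u v (hsub hm)]
        beta_reduce
        rw [hval u v hm]
        rfl
      · rw [hs.2 a b he]
        simp
    have e := h.unique H ψ _ _ _ _ (key hs).1 (key hs').1
    refine Monoid.Coprod.hom_ext e (MonoidHom.ext_mint ?_)
    have h1 := (key hs).1
    have h2 := (key hs').1
    rw [← e] at h2
    rw [MonoidHom.comp_apply, MonoidHom.comp_apply, (key hs).2, (key hs').2, h1.gauge_eq h2 ha,
      h1.gauge_eq h2 hb]

/-- Van Kampen for two subcomplexes with connected intersection on which the universal cocycles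
are trivial. -/
lemma IsUniv.union {G' : Type} [Group G'] {A B : Finset (Finset α)} {x : α}
    {φ : α → α → G} {φ' : α → α → G'} (hA : IsCx A) (hB : IsCx B)
    (hconn : ∀ v, {v} ∈ A → {v} ∈ B → Reach (A ∩ B) x v)
    (h : IsUniv A x G φ) (h' : IsUniv B x G' φ')
    (h1 : ∀ u v, {u, v} ∈ A ∩ B → φ u v = 1) (h1' : ∀ u v, {u, v} ∈ A ∩ B → φ' u v = 1) :
    IsUniv (A ∪ B) x (Monoid.Coprod G G') fun u v =>
      if {u, v} ∈ A then Monoid.Coprod.inl (φ u v) else Monoid.Coprod.inr (φ' u v) := by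
  have hval : ∀ u v, {u, v} ∈ B → (if {u, v} ∈ A then Monoid.Coprod.inl (φ u v) else
      (Monoid.Coprod.inr (φ' u v) : Monoid.Coprod G G')) = Monoid.Coprod.inr (φ' u v) := by
    intro u v hm
    split_ifs with hm'
    · rw [h1 u v (Finset.mem_inter.2 ⟨hm', hm⟩), h1' u v (Finset.mem_inter.2 ⟨hm', hm⟩),
        map_one, map_one]
    · rfl
  refine ⟨?_, fun H _ ψ hψ => ?_, fun H _ ψ f f' c c' hs hs' => ?_⟩
  · intro u v w hm
    rcases Finset.mem_union.1 hm with hm | hm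
    · simp only [hA.edge_mem hm (show u ∈ ({u, v, w} : Finset α) by simp)
        (show v ∈ ({u, v, w} : Finset α) by simp),
        hA.edge_mem hm (show u ∈ ({u, v, w} : Finset α) by simp)
        (show w ∈ ({u, v, w} : Finset α) by simp),
        hA.edge_mem hm (show v ∈ ({u, v, w} : Finset α) by simp)
        (show w ∈ ({u, v, w} : Finset α) by simp), if_true, ← map_mul]
      rw [h.cocycle u v w hm]
    · simp only [hval _ _ (hB.edge_mem hm (show u ∈ ({u, v, w} : Finset α) by simp)
        (show v ∈ ({u, v, w} : Finset α) by simp)),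
        hval _ _ (hB.edge_mem hm (show u ∈ ({u, v, w} : Finset α) by simp)
        (show w ∈ ({u, v, w} : Finset α) by simp)),
        hval _ _ (hB.edge_mem hm (show v ∈ ({u, v, w} : Finset α) by simp)
        (show w ∈ ({u, v, w} : Finset α) by simp)), ← map_mul]
      rw [h'.cocycle u v w hm]
  · obtain ⟨f, c, hs⟩ := h.exists_sol H ψ (hψ.mono Finset.subset_union_left)
    obtain ⟨f', c', hs'⟩ := h'.exists_sol H ψ (hψ.mono Finset.subset_union_right)
    have hcc : ∀ v, {v} ∈ A → {v} ∈ B → c v = c' v := by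
      intro v hvA hvB
      have t1 : IsSol (A ∩ B) x (fun _ _ => (1 : H)) ψ (MonoidHom.id H) c :=
        ⟨hs.1, fun u v hm => by
          rw [hs.2 u v (Finset.mem_inter.1 hm).1, h1 u v hm]; simp⟩
      have t2 : IsSol (A ∩ B) x (fun _ _ => (1 : H)) ψ (MonoidHom.id H) c' :=
        ⟨hs'.1, fun u v hm => by
          rw [hs'.2 u v (Finset.mem_inter.1 hm).2, h1' u v hm]; simp⟩
      exact t1.gauge_eq t2 (hconn v hvA hvB)
    refine ⟨Monoid.Coprod.lift f f', fun v => if {v} ∈ A then c v else c' v, ?_,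
      fun u v hm => ?_⟩
    · beta_reduce
      split_ifs
      · exact hs.1
      · exact hs'.1
    · rcases Finset.mem_union.1 hm with hm | hm
      · simp only [hm, hA.left_mem hm, hA.right_mem hm, if_true, Monoid.Coprod.lift_apply_inl]
        exact hs.2 u v hm
      · beta_reduce
        rw [hval u v hm, Monoid.Coprod.lift_apply_inr]
        have e : ∀ v, {v} ∈ B → (if {v} ∈ A then c v else c' v) = c' v := by
          intro v hv
          split_ifs with hv'
          · exact hcc v hv' hv
          · rfl
        simp only [e u (hB.left_mem hm), e v (hB.right_mem hm)]
        exact hs'.2 u v hm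
  · refine Monoid.Coprod.hom_ext (h.unique H ψ _ _ c c' ?_ ?_) (h'.unique H ψ _ _ c c' ?_ ?_)
    · refine ⟨hs.1, fun u v hm => ?_⟩
      rw [hs.2 u v (Finset.mem_union_left _ hm)]
      beta_reduce
      rw [if_pos hm]
      rfl
    · refine ⟨hs'.1, fun u v hm => ?_⟩
      rw [hs'.2 u v (Finset.mem_union_left _ hm)]
      beta_reduce
      rw [if_pos hm]
      rfl
    · refine ⟨hs.1, fun u v hm => ?_⟩
      rw [hs.2 u v (Finset.mem_union_right _ hm)]
      beta_reduce
      rw [hval u v hm]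
      rfl
    · refine ⟨hs'.1, fun u v hm => ?_⟩
      rw [hs'.2 u v (Finset.mem_union_right _ hm)]
      beta_reduce
      rw [hval u v hm]
      rfl

end UnivConstructions

section EulerCharacteristic

set_option linter.unusedSectionVars false

variable {α : Type} [DecidableEq α] {K A B T Z : Finset (Finset α)}

/-- The Euler characteristic. -/
def chi (K : Finset (Finset α)) : ℤ := ∑ σ ∈ K, (-1) ^ (σ.card + 1)

/-- Three times the number of vertices minus the number of edges. -/
def slack (K : Finset (Finset α)) : ℤ :=
  ∑ σ ∈ K, if σ.card = 1 then 3 else if σ.card = 2 then -1 else 0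

/-- Three times the number of triangles minus twice the number of edges. -/
def excess (K : Finset (Finset α)) : ℤ :=
  ∑ σ ∈ K, if σ.card = 2 then -2 else if σ.card = 3 then 3 else 0

/-- The sparsity condition on the subcomplexes of `K`. -/
def IsSparse (K : Finset (Finset α)) : Prop :=
  ∀ L ⊆ K, IsCx L → (∃ e ∈ L, e.card = 2) → 0 < slack L

/-- The simplicial closure of a set of simplices. -/
def cl (T : Finset (Finset α)) : Finset (Finset α) := T.biUnion fun t => t.powerset.erase ∅

/-- The number of members of `T` containing `e`. -/
def deg (T : Finset (Finset α)) (e : Finset α) : ℕ := (T.filter (e ⊆ ·)).card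

/-- The edges of the closure. -/
def edges (T : Finset (Finset α)) : Finset (Finset α) := (cl T).filter (·.card = 2)

/-- A nonempty set of triangles without free edges. -/
structure IsCore (T : Finset (Finset α)) : Prop where
  nonempty : T.Nonempty
  card_eq : ∀ t ∈ T, t.card = 3
  two_le_deg : ∀ e ∈ edges T, 2 ≤ deg T e

lemma three_mul_chi (hK : IsCx K) : 3 * chi K = slack K + excess K := by
  rw [chi, slack, excess, Finset.mul_sum, ← Finset.sum_add_distrib]
  refine Finset.sum_congr rfl fun σ hσ => ?_
  have h1 := hK.card_le σ hσ
  have h2 := (hK.nonempty σ hσ).card_pos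
  interval_cases σ.card <;> simp

lemma chi_union_inter (A B : Finset (Finset α)) :
    chi (A ∪ B) + chi (A ∩ B) = chi A + chi B :=
  Finset.sum_union_inter

lemma chi_erase {σ : Finset α} (h : σ ∈ K) :
    chi (K.erase σ) = chi K - (-1) ^ (σ.card + 1) := by
  rw [chi, chi, ← Finset.add_sum_erase K _ h]
  ring

lemma chi_erase_edge {σ : Finset α} (h : σ ∈ K) (hc : σ.card = 2) :
    chi (K.erase σ) = chi K + 1 := by
  rw [chi_erase h, hc]
  norm_num

lemma chi_erase_triangle {σ : Finset α} (h : σ ∈ K) (hc : σ.card = 3) :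
    chi (K.erase σ) = chi K - 1 := by
  rw [chi_erase h, hc]
  norm_num

lemma mem_cl {σ : Finset α} : σ ∈ cl T ↔ σ.Nonempty ∧ ∃ t ∈ T, σ ⊆ t := by
  simp only [cl, Finset.mem_biUnion, Finset.mem_erase, Finset.mem_powerset,
    Finset.nonempty_iff_ne_empty]
  grind

lemma cl_union : cl (A ∪ B) = cl A ∪ cl B := by
  ext σ
  simp only [Finset.mem_union, mem_cl]
  grind

lemma cl_mono (h : A ⊆ B) : cl A ⊆ cl B := by
  intro σ
  simp only [mem_cl]
  grind

lemma subset_cl (hT : ∀ t ∈ T, t.card = 3) : T ⊆ cl T := fun t ht =>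
  mem_cl.2 ⟨Finset.card_pos.1 (by rw [hT t ht]; simp), t, ht, subset_rfl⟩

lemma isCx_cl (hT : ∀ t ∈ T, t.card = 3) : IsCx (cl T) := by
  refine ⟨fun σ hσ => (mem_cl.1 hσ).1, fun σ hσ => ?_, fun σ hσ τ hτ hne => ?_⟩
  · obtain ⟨-, t, ht, hs⟩ := mem_cl.1 hσ
    exact (Finset.card_le_card hs).trans (hT t ht).le
  · obtain ⟨-, t, ht, hs⟩ := mem_cl.1 hσ
    exact mem_cl.2 ⟨hne, t, ht, hτ.trans hs⟩

lemma IsCx.cl_subset (hK : IsCx K) (h : T ⊆ K) : cl T ⊆ K := by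
  intro σ hσ
  obtain ⟨hne, t, ht, hs⟩ := mem_cl.1 hσ
  exact hK.down t (h ht) σ hs hne

lemma mem_of_mem_cl (hT : ∀ t ∈ T, t.card = 3) {t : Finset α} (h : t ∈ cl T) (hc : t.card = 3) :
    t ∈ T := by
  obtain ⟨-, s, hs, hts⟩ := mem_cl.1 h
  rwa [Finset.eq_of_subset_of_card_le hts (by rw [hT s hs, hc])]

lemma mem_edges {e : Finset α} : e ∈ edges T ↔ e.card = 2 ∧ ∃ t ∈ T, e ⊆ t := by
  simp only [edges, Finset.mem_filter, mem_cl]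
  constructor
  · rintro ⟨⟨-, h⟩, h2⟩
    exact ⟨h2, h⟩
  · rintro ⟨h2, h⟩
    exact ⟨⟨Finset.card_pos.1 (by omega), h⟩, h2⟩

lemma deg_pos_iff {e : Finset α} : 0 < deg T e ↔ ∃ t ∈ T, e ⊆ t := by
  simp [deg, Finset.card_pos, Finset.Nonempty]

lemma deg_mono {e : Finset α} (h : A ⊆ B) : deg A e ≤ deg B e :=
  Finset.card_le_card (Finset.filter_subset_filter _ h)

lemma deg_union {e : Finset α} (h : Disjoint A B) : deg (A ∪ B) e = deg A e + deg B e := by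
  rw [deg, Finset.filter_union, Finset.card_union_of_disjoint]
  · rfl
  · exact Finset.disjoint_filter_filter h

lemma deg_sdiff {e : Finset α} (h : A ⊆ B) : deg (B \ A) e + deg A e = deg B e := by
  rw [← deg_union Finset.sdiff_disjoint, Finset.sdiff_union_of_subset h]

lemma isCore_of_even (hne : T.Nonempty) (hT : ∀ t ∈ T, t.card = 3)
    (he : ∀ e, e.card = 2 → Even (deg T e)) : IsCore T := by
  refine ⟨hne, hT, fun e h => ?_⟩
  obtain ⟨hc, h⟩ := mem_edges.1 h
  have := deg_pos_iff.2 h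
  obtain ⟨k, hk⟩ := he e hc
  omega

lemma IsCore.union (hA : IsCore A) (hB : IsCore B) : IsCore (A ∪ B) := by
  refine ⟨hA.nonempty.mono Finset.subset_union_left, fun t ht => ?_, fun e he => ?_⟩
  · rcases Finset.mem_union.1 ht with h | h
    · exact hA.card_eq t h
    · exact hB.card_eq t h
  · obtain ⟨hc, t, ht, hs⟩ := mem_edges.1 he
    rcases Finset.mem_union.1 ht with h | h
    · exact (hA.two_le_deg e (mem_edges.2 ⟨hc, t, h, hs⟩)).trans
        (deg_mono Finset.subset_union_left)
    · exact (hB.two_le_deg e (mem_edges.2 ⟨hc, t, h, hs⟩)).trans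
        (deg_mono Finset.subset_union_right)

lemma sum_deg (hT : ∀ t ∈ T, t.card = 3) : ∑ e ∈ edges T, deg T e = 3 * T.card := by
  simp only [deg, Finset.card_filter]
  rw [Finset.sum_comm, mul_comm, ← smul_eq_mul, ← Finset.sum_const]
  refine Finset.sum_congr rfl fun t ht => ?_
  rw [← Finset.card_filter]
  have : (edges T).filter (· ⊆ t) = t.powersetCard 2 := by
    ext e
    simp only [Finset.mem_filter, mem_edges, Finset.mem_powersetCard]
    grind
  rw [this, Finset.card_powersetCard, hT t ht]
  rfl

lemma excess_cl (hT : ∀ t ∈ T, t.card = 3) :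
    excess (cl T) = ∑ e ∈ edges T, ((deg T e : ℤ) - 2) := by
  have h3 : (cl T).filter (·.card = 3) = T := by
    ext t
    simp only [Finset.mem_filter]
    exact ⟨fun h => mem_of_mem_cl hT h.1 h.2, fun h => ⟨subset_cl hT h, hT t h⟩⟩
  have h : ∀ σ : Finset α, (if σ.card = 2 then (-2 : ℤ) else if σ.card = 3 then 3 else 0) =
      (if σ.card = 2 then -2 else 0) + if σ.card = 3 then 3 else 0 := by
    intro σ
    split_ifs <;> omega
  have h4 := sum_deg hT
  rw [excess]
  simp only [h]
  rw [Finset.sum_add_distrib, ← Finset.sum_filter, ← Finset.sum_filter, h3,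
    Finset.sum_sub_distrib, ← Nat.cast_sum, h4, edges]
  simp
  ring

lemma IsCore.excess_nonneg (hT : IsCore T) : 0 ≤ excess (cl T) := by
  rw [excess_cl hT.card_eq]
  refine Finset.sum_nonneg fun e he => ?_
  have := hT.two_le_deg e he
  omega

lemma IsCore.edges_nonempty (hT : IsCore T) : ∃ e ∈ cl T, e.card = 2 := by
  obtain ⟨t, ht⟩ := hT.nonempty
  obtain ⟨e, he, hc⟩ := Finset.exists_subset_card_eq (s := t) (n := 2)
    (by rw [hT.card_eq t ht]; omega)
  exact ⟨e, (Finset.mem_filter.1 (mem_edges.2 ⟨hc, t, ht, he⟩)).1, hc⟩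

lemma IsCore.slack_pos (hT : IsCore T) (hK : IsSparse K) (h : cl T ⊆ K) :
    0 < slack (cl T) :=
  hK _ h (isCx_cl hT.card_eq) hT.edges_nonempty

lemma IsCore.one_le_chi (hT : IsCore T) (hK : IsSparse K) (h : cl T ⊆ K) : 1 ≤ chi (cl T) := by
  have h1 := three_mul_chi (isCx_cl hT.card_eq)
  have h2 := hT.slack_pos hK h
  have h3 := hT.excess_nonneg
  omega

/-- A graph all of whose vertices have even degree has at least three edges, if any. -/
lemma three_le_card_of_even {O : Finset (Finset α)} (hO : O.Nonempty)
    (h2 : ∀ e ∈ O, e.card = 2) (hv : ∀ v, Even (O.filter (v ∈ ·)).card) : 3 ≤ O.card := by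
  have key : ∀ e ∈ O, ∀ v ∈ e, ∃ e' ∈ O, v ∈ e' ∧ e' ≠ e := by
    intro e he v hve
    have h1 : 1 ≤ (O.filter (v ∈ ·)).card := Finset.card_pos.2 ⟨e, by simp [he, hve]⟩
    have h2 : 1 < (O.filter (v ∈ ·)).card := by
      obtain ⟨k, hk⟩ := hv v
      omega
    obtain ⟨e', he', hne⟩ := Finset.exists_mem_ne h2 e
    rw [Finset.mem_filter] at he'
    exact ⟨e', he'.1, he'.2, hne⟩
  obtain ⟨e, he⟩ := hO
  obtain ⟨a, b, hab, rfl⟩ := Finset.card_eq_two.1 (h2 e he)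
  obtain ⟨e1, he1, ha1, hn1⟩ := key _ he a (by simp)
  obtain ⟨e2, he2, hb2, hn2⟩ := key _ he b (by simp)
  have h12 : e1 ≠ e2 := by
    rintro rfl
    refine hn1 (Finset.eq_of_subset_of_card_le ?_ ?_).symm
    · grind
    · rw [h2 _ he1, Finset.card_pair hab]
  have : ({{a, b}, e1, e2} : Finset (Finset α)).card = 3 := by
    rw [Finset.card_insert_of_notMem, Finset.card_pair h12]
    simp only [Finset.mem_insert, Finset.mem_singleton]
    rintro (h | h)
    · exact hn1 h.symm
    · exact hn2 h.symm
  rw [← this]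
  exact Finset.card_le_card (by grind)

/-- At every vertex the number of edges of odd degree is even. -/
lemma even_card_odd_edges (hT : ∀ t ∈ T, t.card = 3) (v : α) :
    Even (((edges T).filter fun e => Odd (deg T e)).filter (v ∈ ·)).card := by
  have h1 : ∑ e ∈ (edges T).filter (v ∈ ·), deg T e = 2 * (T.filter (v ∈ ·)).card := by
    simp only [deg, Finset.card_filter]
    rw [Finset.sum_comm, ← Finset.card_filter, mul_comm, Finset.card_eq_sum_ones, Finset.sum_mul,
      Finset.sum_filter]
    refine Finset.sum_congr rfl fun t ht => ?_
    rw [← Finset.card_filter]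
    split_ifs with hv
    · have : ((edges T).filter (v ∈ ·)).filter (· ⊆ t) = (t.erase v).image fun w => {v, w} := by
        ext e
        simp only [Finset.mem_filter, mem_edges, Finset.mem_image, Finset.mem_erase]
        constructor
        · rintro ⟨⟨⟨hc, -⟩, hve⟩, hs⟩
          obtain ⟨a, b, hab, rfl⟩ := Finset.card_eq_two.1 hc
          simp only [Finset.mem_insert, Finset.mem_singleton] at hve
          rcases hve with rfl | rfl
          · exact ⟨b, ⟨hab.symm, hs (by simp)⟩, rfl⟩
          · exact ⟨a, ⟨hab, hs (by simp)⟩, Finset.pair_comm _ _⟩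
        · rintro ⟨w, ⟨hwv, hw⟩, rfl⟩
          have hs : {v, w} ⊆ t := by grind
          exact ⟨⟨⟨Finset.card_pair hwv.symm, t, ht, hs⟩, by simp⟩, hs⟩
      rw [this, Finset.card_image_of_injOn, Finset.card_erase_of_mem hv, hT t ht, one_mul]
      intro a ha b hb hab
      have ha' : a ≠ v := (Finset.mem_erase.1 ha).1
      have hb' : b ≠ v := (Finset.mem_erase.1 hb).1
      have : a ∈ ({v, b} : Finset α) := by
        rw [← show ({v, a} : Finset α) = {v, b} from hab]; simp
      simp only [Finset.mem_insert, Finset.mem_singleton] at this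
      exact this.resolve_left ha'
    · rw [Finset.card_eq_zero, Finset.filter_eq_empty_iff]
      intro e he hs
      exact hv (hs (Finset.mem_filter.1 he).2)
  have h2 : Even (∑ e ∈ (edges T).filter (v ∈ ·), deg T e) := by
    rw [h1]
    exact even_two_mul _
  rw [Finset.even_sum_iff_even_card_odd] at h2
  convert h2 using 2
  ext e
  simp only [Finset.mem_filter]
  tauto

lemma IsCore.even_of_excess_le (hT : IsCore T) (h : excess (cl T) ≤ 2) (e : Finset α)
    (he : e.card = 2) : Even (deg T e) := by
  by_contra hodd
  rw [Nat.not_even_iff_odd] at hodd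
  have h3 := three_le_card_of_even (O := (edges T).filter fun e => Odd (deg T e))
    ⟨e, Finset.mem_filter.2 ⟨mem_edges.2 ⟨he, deg_pos_iff.1 hodd.pos⟩, hodd⟩⟩
    (fun e he => (mem_edges.1 (Finset.mem_filter.1 he).1).1)
    (even_card_odd_edges hT.card_eq)
  have h4 : ((((edges T).filter fun e => Odd (deg T e)).card : ℕ) : ℤ) ≤ excess (cl T) := by
    rw [excess_cl hT.card_eq, Finset.card_filter, Nat.cast_sum]
    refine Finset.sum_le_sum fun e he => ?_
    have := hT.two_le_deg e he
    split_ifs with ho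
    · obtain ⟨k, hk⟩ := ho
      omega
    · omega
  omega

lemma IsCore.excess_le_two (hT : IsCore T) (hK : IsSparse K) (h : cl T ⊆ K)
    (hchi : chi (cl T) = 1) : excess (cl T) ≤ 2 := by
  have h1 := three_mul_chi (isCx_cl hT.card_eq)
  have h2 := hT.slack_pos hK h
  omega

lemma isCore_sdiff (hAB : A ⊆ B) (hne : A ≠ B) (hB : ∀ t ∈ B, t.card = 3)
    (h1 : ∀ e, e.card = 2 → Even (deg A e)) (h2 : ∀ e, e.card = 2 → Even (deg B e)) :
    IsCore (B \ A) := by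
  refine isCore_of_even ?_ (fun t ht => hB t (Finset.mem_sdiff.1 ht).1) fun e he => ?_
  · rw [Finset.sdiff_nonempty]
    exact fun h => hne (hAB.antisymm h)
  · have h := deg_sdiff (e := e) hAB
    have := h1 e he
    have := h2 e he
    grind

end EulerCharacteristic

section Collapse

set_option linter.unusedSectionVars false

variable {α : Type} [DecidableEq α] {K L A B T Z : Finset (Finset α)}

lemma IsConn.of_edges (hL : IsConn L) (hKL : K ⊆ L) (hv : ∀ v, {v} ∈ L → {v} ∈ K)
    (he : ∀ u v, {u, v} ∈ L → Reach K u v) : IsConn K := by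
  obtain ⟨⟨x, hx⟩, h⟩ := hL
  refine ⟨⟨x, hv x hx⟩, fun y z hy hz => ?_⟩
  have hr := h y z (hKL hy) (hKL hz)
  clear hz
  induction hr with
  | refl => exact Relation.ReflTransGen.refl
  | tail _ hm ih => exact ih.trans (he _ _ hm)

lemma IsConn.reach_of_mem (hL : IsConn L) {x y : α} (hx : {x} ∈ L) (hy : {y} ∈ L) :
    Reach L x y :=
  hL.2 x y hx hy

lemma IsConn.erase_triangle (hK : IsConn K) {t : Finset α} (ht : t.card = 3) :
    IsConn (K.erase t) := by
  refine hK.of_edges (Finset.erase_subset _ _) (fun v hv => ?_) fun u v hm => ?_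
  · refine Finset.mem_erase.2 ⟨?_, hv⟩
    rintro rfl
    simp at ht
  · refine Reach.edge (Finset.mem_erase.2 ⟨?_, hm⟩)
    rintro rfl
    have := Finset.card_le_two (a := u) (b := v)
    omega

lemma IsCx.erase_of_maximal {σ : Finset α} (hK : IsCx K)
    (hmax : ∀ τ ∈ K, σ ⊆ τ → τ = σ) : IsCx (K.erase σ) := by
  refine ⟨fun τ hτ => hK.nonempty τ (Finset.mem_of_mem_erase hτ),
    fun τ hτ => hK.card_le τ (Finset.mem_of_mem_erase hτ), fun τ hτ ρ hρ hne => ?_⟩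
  rw [Finset.mem_erase] at hτ ⊢
  refine ⟨?_, hK.down τ hτ.2 ρ hρ hne⟩
  rintro rfl
  exact hτ.1 (hmax τ hτ.2 hρ)

/-- The edge `{a, b}` lies in a single triangle `{a, b, c}` of `K`. -/
structure IsFreeEdge (K : Finset (Finset α)) (a b c : α) : Prop where
  hab : a ≠ b
  hac : a ≠ c
  hbc : b ≠ c
  mem : {a, b, c} ∈ K
  eq_or : ∀ σ ∈ K, a ∈ σ → b ∈ σ → σ = {a, b} ∨ σ = {a, b, c}

lemma IsFreeEdge.card_eq {a b c : α} (h : IsFreeEdge K a b c) :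
    ({a, b, c} : Finset α).card = 3 :=
  Finset.card_eq_three.2 ⟨a, b, c, h.hab, h.hac, h.hbc, rfl⟩

lemma IsFreeEdge.mem_erase {a b c : α} (h : IsFreeEdge K a b c) {σ : Finset α} :
    σ ∈ (K.erase {a, b, c}).erase {a, b} ↔ σ ∈ K ∧ ¬ (a ∈ σ ∧ b ∈ σ) := by
  simp only [Finset.mem_erase]
  constructor
  · rintro ⟨h1, h2, h3⟩
    refine ⟨h3, fun hh => ?_⟩
    rcases h.eq_or σ h3 hh.1 hh.2 with e | e
    · exact h1 e
    · exact h2 e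
  · rintro ⟨h1, h2⟩
    exact ⟨fun e => h2 (by simp [e]), fun e => h2 (by simp [e]), h1⟩

lemma IsFreeEdge.isCx {a b c : α} (h : IsFreeEdge K a b c) (hK : IsCx K) :
    IsCx ((K.erase {a, b, c}).erase {a, b}) := by
  refine ⟨fun σ hσ => hK.nonempty σ (h.mem_erase.1 hσ).1,
    fun σ hσ => hK.card_le σ (h.mem_erase.1 hσ).1, fun σ hσ τ hτ hne => ?_⟩
  rw [h.mem_erase] at hσ ⊢
  exact ⟨hK.down σ hσ.1 τ hτ hne, fun hh => hσ.2 ⟨hτ hh.1, hτ hh.2⟩⟩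

lemma IsFreeEdge.isConn {a b c : α} (h : IsFreeEdge K a b c) (hK : IsCx K) (hc : IsConn K) :
    IsConn ((K.erase {a, b, c}).erase {a, b}) := by
  have hab := h.hab
  have hac := h.hac
  have hbc := h.hbc
  have e1 : Reach ((K.erase {a, b, c}).erase {a, b}) a c :=
    Reach.edge (h.mem_erase.2 ⟨hK.edge_mem h.mem (by simp) (by simp), by simp; grind⟩)
  have e2 : Reach ((K.erase {a, b, c}).erase {a, b}) b c :=
    Reach.edge (h.mem_erase.2 ⟨hK.edge_mem h.mem (by simp) (by simp), by simp; grind⟩)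
  refine hc.of_edges ((Finset.erase_subset _ _).trans (Finset.erase_subset _ _))
    (fun v hv => h.mem_erase.2 ⟨hv, by simp; grind⟩) fun u v hm => ?_
  by_cases hn : a ∈ ({u, v} : Finset α) ∧ b ∈ ({u, v} : Finset α)
  · have : (u = a ∧ v = b) ∨ (u = b ∧ v = a) := by
      simp only [Finset.mem_insert, Finset.mem_singleton] at hn
      grind
    rcases this with ⟨rfl, rfl⟩ | ⟨rfl, rfl⟩
    · exact e1.trans e2.symm
    · exact e2.trans e1.symm
  · exact Reach.edge (h.mem_erase.2 ⟨hm, hn⟩)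

lemma IsFreeEdge.chi_eq {a b c : α} (h : IsFreeEdge K a b c) (hK : IsCx K) :
    chi ((K.erase {a, b, c}).erase {a, b}) = chi K := by
  have hne : ({a, b} : Finset α) ≠ {a, b, c} := by
    intro e
    have := h.card_eq
    rw [← e, Finset.card_pair h.hab] at this
    omega
  rw [chi_erase_edge (Finset.mem_erase.2 ⟨hne, hK.edge_mem h.mem (by simp) (by simp)⟩)
    (Finset.card_pair h.hab), chi_erase_triangle h.mem h.card_eq]
  ring

/-- The part of `K` that can be reached from `v`. -/
noncomputable def comp (K : Finset (Finset α)) (v : α) : Finset (Finset α) :=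
  open Classical in K.filter fun σ => ∀ u ∈ σ, Reach K v u

lemma mem_comp {v : α} {σ : Finset α} : σ ∈ comp K v ↔ σ ∈ K ∧ ∀ u ∈ σ, Reach K v u := by
  simp [comp]

lemma comp_subset {v : α} : comp K v ⊆ K := fun _ h => (mem_comp.1 h).1

lemma IsCx.mem_comp_of_reach (hK : IsCx K) {v u : α} {σ : Finset α} (hσ : σ ∈ K) (hu : u ∈ σ)
    (h : Reach K v u) : σ ∈ comp K v :=
  mem_comp.2 ⟨hσ, fun _ hw => h.trans (Reach.edge (hK.edge_mem hσ hu hw))⟩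

lemma IsCx.isCx_comp (hK : IsCx K) (v : α) : IsCx (comp K v) := by
  refine ⟨fun σ hσ => hK.nonempty σ (comp_subset hσ), fun σ hσ => hK.card_le σ (comp_subset hσ),
    fun σ hσ τ hτ hne => ?_⟩
  rw [mem_comp] at hσ ⊢
  exact ⟨hK.down σ hσ.1 τ hτ hne, fun u hu => hσ.2 u (hτ hu)⟩

lemma IsCx.reach_comp (hK : IsCx K) {v u : α} (h : Reach K v u) : Reach (comp K v) v u := by
  induction h with
  | refl => exact Relation.ReflTransGen.refl
  | tail h hm ih =>
    exact ih.trans (Reach.edge (hK.mem_comp_of_reach hm (by simp) h))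

lemma IsCx.isConn_comp (hK : IsCx K) {v : α} (hv : {v} ∈ K) : IsConn (comp K v) := by
  refine ⟨⟨v, hK.mem_comp_of_reach hv (by simp) Relation.ReflTransGen.refl⟩, fun x y hx hy => ?_⟩
  exact (hK.reach_comp ((mem_comp.1 hx).2 x (by simp))).symm.trans
    (hK.reach_comp ((mem_comp.1 hy).2 y (by simp)))

/-- `K` consists of two disjoint connected complexes and an edge joining them. -/
structure IsBridged (K A B : Finset (Finset α)) (a b : α) : Prop where
  cx_left : IsCx A
  cx_right : IsCx B
  conn_left : IsConn A
  conn_right : IsConn B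
  mem_left : {a} ∈ A
  mem_right : {b} ∈ B
  disj : ∀ v, {v} ∈ A → {v} ∉ B
  eq_insert : K = insert {a, b} (A ∪ B)

namespace IsBridged

variable {a b : α}

lemma symm (h : IsBridged K A B a b) : IsBridged K B A b a :=
  ⟨h.cx_right, h.cx_left, h.conn_right, h.conn_left, h.mem_right, h.mem_left,
    fun v h1 h2 => h.disj v h2 h1, by rw [h.eq_insert, Finset.pair_comm, Finset.union_comm]⟩

lemma ne (h : IsBridged K A B a b) : a ≠ b := by
  rintro rfl
  exact h.disj _ h.mem_left h.mem_right

lemma left_subset (h : IsBridged K A B a b) : A ⊆ K := by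
  rw [h.eq_insert]
  grind

lemma right_subset (h : IsBridged K A B a b) : B ⊆ K := h.symm.left_subset

lemma notMem_left (h : IsBridged K A B a b) {σ : Finset α} (hb : b ∈ σ) : σ ∉ A :=
  fun hm => h.disj b (h.cx_left.vertex_mem hm hb) h.mem_right

lemma notMem_right (h : IsBridged K A B a b) {σ : Finset α} (ha : a ∈ σ) : σ ∉ B :=
  h.symm.notMem_left ha

lemma disjoint (h : IsBridged K A B a b) : Disjoint A B := by
  rw [Finset.disjoint_left]
  intro σ h1 h2
  obtain ⟨v, hv⟩ := h.cx_left.nonempty σ h1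
  exact h.disj v (h.cx_left.vertex_mem h1 hv) (h.cx_right.vertex_mem h2 hv)

lemma mem_edge (h : IsBridged K A B a b) : {a, b} ∈ K := by
  rw [h.eq_insert]
  simp

lemma erase_eq (h : IsBridged K A B a b) : K.erase {a, b} = A ∪ B := by
  rw [h.eq_insert, Finset.erase_insert]
  rw [Finset.mem_union]
  rintro (hm | hm)
  · exact h.notMem_left (by simp) hm
  · exact h.notMem_right (by simp) hm

lemma chi_eq (h : IsBridged K A B a b) : chi K = chi A + chi B - 1 := by
  have h1 := chi_erase_edge h.mem_edge (Finset.card_pair h.ne)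
  have h2 := chi_union_inter A B
  rw [Finset.disjoint_iff_inter_eq_empty.1 h.disjoint, ← h.erase_eq] at h2
  simp only [chi, Finset.sum_empty] at h1 h2 ⊢
  omega

lemma card_left_lt (h : IsBridged K A B a b) : A.card < K.card :=
  Finset.card_lt_card ⟨h.left_subset, fun hs => h.notMem_left (by simp) (hs h.mem_edge)⟩

lemma card_right_lt (h : IsBridged K A B a b) : B.card < K.card := h.symm.card_left_lt

end IsBridged

lemma exists_isBridged {a b : α} (hK : IsCx K) (hconn : IsConn K) (hab : a ≠ b)
    (he : {a, b} ∈ K) (hmax : ∀ σ ∈ K, {a, b} ⊆ σ → σ = {a, b})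
    (hn : ¬ IsConn (K.erase {a, b})) : ∃ A B, IsBridged K A B a b := by
  have hK' := hK.erase_of_maximal hmax
  have hv : ∀ v, {v} ∈ K → {v} ∈ K.erase {a, b} := by
    intro v hv
    refine Finset.mem_erase.2 ⟨?_, hv⟩
    intro e
    have := Finset.card_pair hab
    rw [← e] at this
    simp at this
  have ha := hv a (hK.left_mem he)
  have hb := hv b (hK.right_mem he)
  have hnr : ¬ Reach (K.erase {a, b}) a b := by
    intro hr
    refine hn (hconn.of_edges (Finset.erase_subset _ _) hv fun u v hm => ?_)
    by_cases hm' : ({u, v} : Finset α) = {a, b}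
    · rcases pair_eq_pair hm' with ⟨rfl, rfl⟩ | ⟨rfl, rfl⟩ | h
      · exact hr
      · exact hr.symm
      · exact absurd h hab
    · exact Reach.edge (Finset.mem_erase.2 ⟨hm', hm⟩)
  have hall : ∀ v, Reach K a v → Reach (K.erase {a, b}) a v ∨ Reach (K.erase {a, b}) b v := by
    intro v hr
    induction hr with
    | refl => exact Or.inl Relation.ReflTransGen.refl
    | tail _ hm ih =>
      rename_i u v _
      by_cases hm' : ({u, v} : Finset α) = {a, b}
      · rcases pair_eq_pair hm' with ⟨rfl, rfl⟩ | ⟨rfl, rfl⟩ | h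
        · exact Or.inr Relation.ReflTransGen.refl
        · exact Or.inl Relation.ReflTransGen.refl
        · exact absurd h hab
      · have := Reach.edge (Finset.mem_erase.2 ⟨hm', hm⟩)
        exact ih.imp (fun h => h.trans this) fun h => h.trans this
  refine ⟨comp (K.erase {a, b}) a, comp (K.erase {a, b}) b, hK'.isCx_comp _, hK'.isCx_comp _,
    hK'.isConn_comp ha, hK'.isConn_comp hb,
    hK'.mem_comp_of_reach ha (by simp) Relation.ReflTransGen.refl,
    hK'.mem_comp_of_reach hb (by simp) Relation.ReflTransGen.refl, fun v h1 h2 => ?_, ?_⟩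
  · exact hnr (((mem_comp.1 h1).2 v (by simp)).trans ((mem_comp.1 h2).2 v (by simp)).symm)
  · ext σ
    rw [Finset.mem_insert, Finset.mem_union]
    constructor
    · intro hσ
      by_cases e : σ = {a, b}
      · exact Or.inl e
      · have hσ' := Finset.mem_erase.2 ⟨e, hσ⟩
        obtain ⟨v, hvσ⟩ := hK.nonempty σ hσ
        have hr := hconn.reach_of_mem (hK.left_mem he) (hK.vertex_mem hσ hvσ)
        exact Or.inr ((hall v hr).imp (hK'.mem_comp_of_reach hσ' hvσ)
          (hK'.mem_comp_of_reach hσ' hvσ))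
    · rintro (rfl | h | h)
      · exact he
      · exact Finset.mem_of_mem_erase (comp_subset h)
      · exact Finset.mem_of_mem_erase (comp_subset h)

/-- Induction for connected complexes: collapse free edges, remove edges contained in no
triangle, and finally treat complexes whose triangles form a core. -/
theorem collapse_induction {P : Finset (Finset α) → Prop}
    (hcol : ∀ K a b c, IsCx K → IsConn K → IsFreeEdge K a b c →
      P ((K.erase {a, b, c}).erase {a, b}) → P K)
    (hedge : ∀ K a b, IsCx K → IsConn K → a ≠ b → {a, b} ∈ K →
      (∀ σ ∈ K, {a, b} ⊆ σ → σ = {a, b}) → IsConn (K.erase {a, b}) →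
      P (K.erase {a, b}) → P K)
    (hbridge : ∀ K A B a b, IsCx K → IsConn K → IsBridged K A B a b → P A → P B → P K)
    (hpt : ∀ x, P {{x}})
    (hcore : ∀ T, IsCore T → IsConn (cl T) →
      (∀ L, L ⊂ cl T → IsCx L → IsConn L → P L) → P (cl T))
    (K : Finset (Finset α)) (hK : IsCx K) (hconn : IsConn K) : P K := by
  induction hn : K.card using Nat.strong_induction_on generalizing K with
  | _ n ih =>
  subst hn
  have ih' : ∀ L, L ⊂ K → IsCx L → IsConn L → P L := fun L hL h1 h2 =>
    ih _ (Finset.card_lt_card hL) L h1 h2 rfl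
  set T := K.filter (·.card = 3) with hT
  have hT3 : ∀ t ∈ T, t.card = 3 := fun t ht => (Finset.mem_filter.1 ht).2
  have hTK : T ⊆ K := Finset.filter_subset _ _
  by_cases h1 : ∃ e ∈ K, e.card = 2 ∧ deg T e = 1
  · obtain ⟨e, he, hc, hd⟩ := h1
    obtain ⟨t, ht⟩ := Finset.card_eq_one.1 hd
    have htm : t ∈ T ∧ e ⊆ t := by
      rw [← Finset.mem_filter, ht]
      simp
    obtain ⟨a, b, hab, rfl⟩ := Finset.card_eq_two.1 hc
    have hc1 : (t \ {a, b}).card = 1 := by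
      rw [Finset.card_sdiff_of_subset htm.2, hT3 t htm.1, hc]
    obtain ⟨c, hc2⟩ := Finset.card_eq_one.1 hc1
    have hcm : c ∈ t \ {a, b} := by rw [hc2]; simp
    have hte : t = {a, b, c} := by
      rw [← Finset.sdiff_union_of_subset htm.2, hc2]
      ext
      simp
      tauto
    have hf : IsFreeEdge K a b c := by
      refine ⟨hab, by grind, by grind, hte ▸ hTK htm.1, fun σ hσ ha hb => ?_⟩
      have hs : {a, b} ⊆ σ := by grind
      have h3 := hK.card_le σ hσ
      have h2 := Finset.card_le_card hs
      rw [hc] at h2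
      by_cases hc3 : σ.card = 3
      · right
        have : σ ∈ T.filter ({a, b} ⊆ ·) :=
          Finset.mem_filter.2 ⟨Finset.mem_filter.2 ⟨hσ, hc3⟩, hs⟩
        rw [ht, Finset.mem_singleton] at this
        rw [this, hte]
      · left
        exact (Finset.eq_of_subset_of_card_le hs (by rw [hc]; omega)).symm
    refine hcol K a b c hK hconn hf (ih' _ ⟨fun σ hσ => (hf.mem_erase.1 hσ).1, fun hs => ?_⟩
      (hf.isCx hK) (hf.isConn hK hconn))
    exact (hf.mem_erase.1 (hs he)).2 (by simp)
  by_cases h2 : ∃ e ∈ K, e.card = 2 ∧ deg T e = 0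
  · obtain ⟨e, he, hc, hd⟩ := h2
    obtain ⟨a, b, hab, rfl⟩ := Finset.card_eq_two.1 hc
    have hmax : ∀ σ ∈ K, {a, b} ⊆ σ → σ = {a, b} := by
      intro σ hσ hs
      by_contra hne
      have h3 := hK.card_le σ hσ
      have h2 : ({a, b} : Finset α).card < σ.card := Finset.card_lt_card
        ⟨hs, fun h => hne (h.antisymm hs)⟩
      have : 0 < deg T {a, b} :=
        deg_pos_iff.2 ⟨σ, Finset.mem_filter.2 ⟨hσ, by omega⟩, hs⟩
      omega
    by_cases hc' : IsConn (K.erase {a, b})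
    · exact hedge K a b hK hconn hab he hmax hc'
        (ih' _ (Finset.erase_ssubset he) (hK.erase_of_maximal hmax) hc')
    · obtain ⟨A, B, h⟩ := exists_isBridged hK hconn hab he hmax hc'
      exact hbridge K A B a b hK hconn h (ih _ h.card_left_lt A h.cx_left h.conn_left rfl)
        (ih _ h.card_right_lt B h.cx_right h.conn_right rfl)
  have hd : ∀ e ∈ K, e.card = 2 → 2 ≤ deg T e := by
    intro e he hc
    have a1 : deg T e ≠ 1 := fun h => h1 ⟨e, he, hc, h⟩
    have a2 : deg T e ≠ 0 := fun h => h2 ⟨e, he, hc, h⟩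
    omega
  obtain ⟨x, hx⟩ := hconn.1
  by_cases h3 : ∃ e ∈ K, e.card = 2
  · obtain ⟨e, he, hc⟩ := h3
    have hKT : K = cl T := by
      refine Finset.Subset.antisymm (fun σ hσ => ?_) (hK.cl_subset hTK)
      have hc1 := hK.card_le σ hσ
      have hc2 := (hK.nonempty σ hσ).card_pos
      have hedge : ∀ e ∈ K, e.card = 2 → ∃ t ∈ T, e ⊆ t := fun e he hc =>
        deg_pos_iff.1 (by have := hd e he hc; omega)
      refine mem_cl.2 ⟨hK.nonempty σ hσ, ?_⟩
      have : σ.card = 1 ∨ σ.card = 2 ∨ σ.card = 3 := by omega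
      rcases this with h | h | h
      · obtain ⟨v, rfl⟩ := Finset.card_eq_one.1 h
        suffices ∃ e ∈ K, e.card = 2 ∧ v ∈ e by
          obtain ⟨e, he, hc, hv⟩ := this
          obtain ⟨t, ht, hs⟩ := hedge e he hc
          exact ⟨t, ht, by simpa using hs hv⟩
        by_cases hve : v ∈ e
        · exact ⟨e, he, hc, hve⟩
        obtain ⟨w, hw⟩ := hK.nonempty e he
        have hr := hconn.reach_of_mem (hK.vertex_mem he hw) hσ
        have hwv : w ≠ v := by
          rintro rfl
          exact hve hw
        have hlast : ∀ y, Reach K w y → y = v → ∃ e ∈ K, e.card = 2 ∧ v ∈ e := by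
          intro y hy
          induction hy with
          | refl => exact fun h => absurd h hwv
          | @tail p q _ hm ih =>
            intro hq
            by_cases hpv : p = v
            · exact ih hpv
            · exact ⟨{p, q}, hm, Finset.card_pair (fun h => hpv (h.trans hq)), by simp [hq]⟩
        exact hlast v hr rfl
      · exact hedge σ hσ h
      · exact ⟨σ, Finset.mem_filter.2 ⟨hσ, h⟩, subset_rfl⟩
    have hcT : IsCore T := by
      refine ⟨?_, hT3, fun e he => hd e ?_ ?_⟩
      · obtain ⟨t, ht, -⟩ := deg_pos_iff.1 (show 0 < deg T e by have := hd e he hc; omega)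
        exact ⟨t, ht⟩
      · rw [hKT]
        exact (Finset.mem_filter.1 he).1
      · exact (mem_edges.1 he).1
    rw [hKT]
    rw [hKT] at ih' hconn
    exact hcore T hcT hconn ih'
  · have : K = {{x}} := by
      have hxe : ∀ y, Reach K x y → y = x := by
        intro y hy
        induction hy with
        | refl => rfl
        | tail _ hm ih =>
          rename_i u y _
          by_contra hne
          exact h3 ⟨_, hm, Finset.card_pair (by rw [ih]; exact Ne.symm hne)⟩
      ext σ
      rw [Finset.mem_singleton]
      constructor
      · intro hσ
        have : ∀ v ∈ σ, v = x := fun v hv =>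
          hxe v (hconn.reach_of_mem hx (hK.vertex_mem hσ hv))
        exact Finset.eq_singleton_iff_nonempty_unique_mem.2 ⟨hK.nonempty σ hσ, this⟩
      · rintro rfl
        exact hx
    rw [this]
    exact hpt x

end Collapse

section HasUniversalCocycle

set_option linter.unusedSectionVars false

variable {α : Type} [DecidableEq α] {K L A B T Z : Finset (Finset α)}
variable {G G' : Type} [Group G] [Group G']

lemma IsUniv.congr {x : α} {φ : α → α → G} (h : IsUniv K x G φ) (e : G ≃* G') :
    IsUniv K x G' fun u v => e (φ u v) := by
  refine ⟨h.cocycle.map e.toMonoidHom, fun H _ ψ hψ => ?_, fun H _ ψ f f' c c' hs hs' => ?_⟩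
  · obtain ⟨f, c, hs⟩ := h.exists_sol H ψ hψ
    refine ⟨f.comp e.symm.toMonoidHom, c, hs.1, fun u v hm => ?_⟩
    rw [hs.2 u v hm]
    simp
  · have := h.unique H ψ (f.comp e.toMonoidHom) (f'.comp e.toMonoidHom) c c'
      ⟨hs.1, fun u v hm => hs.2 u v hm⟩ ⟨hs'.1, fun u v hm => hs'.2 u v hm⟩
    refine MonoidHom.ext fun g => ?_
    simpa using DFunLike.congr_fun this (e.symm g)

/-- `G` is the fundamental group of `K`. -/
def HasUniv (K : Finset (Finset α)) (G : Type) [Group G] : Prop :=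
  ∃ x, {x} ∈ K ∧ ∃ φ : α → α → G, IsUniv K x G φ

lemma HasUniv.congr (h : HasUniv K G) (e : G ≃* G') : HasUniv K G' := by
  obtain ⟨x, hx, φ, h⟩ := h
  exact ⟨x, hx, _, h.congr e⟩

lemma HasUniv.exists_at (h : HasUniv K G) (hK : IsConn K) {y : α} (hy : {y} ∈ K) :
    ∃ φ : α → α → G, IsUniv K y G φ := by
  obtain ⟨x, hx, φ, h⟩ := h
  exact ⟨φ, h.change_base (hK.reach_of_mem hx hy)⟩

lemma hasUniv_singleton (x : α) : HasUniv {{x}} Unit :=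
  ⟨x, by simp, _, isUniv_singleton x⟩

lemma HasUniv.of_isFreeEdge {a b c : α} (hK : IsCx K) (hf : IsFreeEdge K a b c)
    (h : HasUniv ((K.erase {a, b, c}).erase {a, b}) G) : HasUniv K G := by
  obtain ⟨x, hx, φ, h⟩ := h
  obtain ⟨φ', h', -⟩ := h.of_collapse hK hf.hab hf.hac hf.hbc hf.mem hf.eq_or
  exact ⟨x, (hf.mem_erase.1 hx).1, φ', h'⟩

lemma HasUniv.of_erase_edge {a b : α} (hK : IsCx K) (hab : a ≠ b) (he : {a, b} ∈ K)
    (hmax : ∀ σ ∈ K, {a, b} ⊆ σ → σ = {a, b}) (hc : IsConn (K.erase {a, b}))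
    (h : HasUniv (K.erase {a, b}) G) : HasUniv K (Monoid.Coprod G (Multiplicative ℤ)) := by
  obtain ⟨x, hx, φ, h⟩ := h
  have hne : ∀ v, ({v} : Finset α) ≠ {a, b} := fun v e => by
    have := Finset.card_pair hab
    rw [← e] at this
    simp at this
  exact ⟨x, Finset.mem_of_mem_erase hx, _, h.attach_edge hK hab he
    (fun σ hσ ha hb => hmax σ hσ (by grind))
    (hc.reach_of_mem hx (Finset.mem_erase.2 ⟨hne a, hK.left_mem he⟩))
    (hc.reach_of_mem hx (Finset.mem_erase.2 ⟨hne b, hK.right_mem he⟩))⟩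

lemma HasUniv.of_isBridged {a b : α} (h : IsBridged K A B a b) (hcA : HasUniv A G)
    (hcB : HasUniv B G') : HasUniv K (Monoid.Coprod G G') := by
  have hab := h.ne
  obtain ⟨φ, hA⟩ := hcA.exists_at h.conn_left h.mem_left
  obtain ⟨φ', hB⟩ := hcB.exists_at h.conn_right h.mem_right
  have hE : IsCx (closedEdge a b) := by
    refine ⟨fun σ hσ => ?_, fun σ hσ => ?_, fun σ hσ τ hτ hne => ?_⟩
    · rw [mem_closedEdge] at hσ
      rcases hσ with rfl | rfl | rfl <;> simp
    · rw [mem_closedEdge] at hσ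
      rcases hσ with rfl | rfl | rfl
      · simp
      · simp
      · exact (Finset.card_le_two).trans (by norm_num)
    · have : τ ⊆ {a, b} := fun u hu => by simpa using mem_of_mem_closedEdge hσ (hτ hu)
      rw [mem_closedEdge]
      obtain ⟨w, hw⟩ := hne
      by_cases ha : a ∈ τ <;> by_cases hb : b ∈ τ <;> grind
  have hAE : ∀ σ, σ ∈ A ∩ closedEdge a b → σ = {a} := by
    intro σ hσ
    rw [Finset.mem_inter, mem_closedEdge] at hσ
    rcases hσ.2 with e | e | e
    · exact e
    · exact absurd hσ.1 (h.notMem_left (by simp [e]))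
    · exact absurd hσ.1 (h.notMem_left (by simp [e]))
  have hsing : ∀ u v w : α, ({u, v} : Finset α) = {w} → u = w ∧ v = w := by
    intro u v w e
    simp only [Finset.ext_iff, Finset.mem_insert, Finset.mem_singleton] at e
    exact ⟨(e u).1 (Or.inl rfl), (e v).1 (Or.inr rfl)⟩
  have h1 := IsUniv.union h.cx_left hE (fun v h1 h2 => by
      have := hAE {v} (Finset.mem_inter.2 ⟨h1, h2⟩)
      rw [Finset.singleton_inj] at this
      rw [this]
      exact Relation.ReflTransGen.refl) hA (isUniv_closedEdge hab)
    (fun u v hm => by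
      obtain ⟨rfl, rfl⟩ := hsing _ _ _ (hAE _ hm)
      exact hA.cocycle.self h.mem_left) fun _ _ _ => rfl
  have hcx : IsCx (A ∪ closedEdge a b) := by
    refine ⟨fun σ hσ => ?_, fun σ hσ => ?_, fun σ hσ τ hτ hne => ?_⟩
    · rcases Finset.mem_union.1 hσ with hσ | hσ
      exacts [h.cx_left.nonempty σ hσ, hE.nonempty σ hσ]
    · rcases Finset.mem_union.1 hσ with hσ | hσ
      exacts [h.cx_left.card_le σ hσ, hE.card_le σ hσ]
    · rw [Finset.mem_union] at hσ ⊢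
      exact hσ.imp (fun h' => h.cx_left.down σ h' τ hτ hne) fun h' => hE.down σ h' τ hτ hne
  have hBE : ∀ σ, σ ∈ (A ∪ closedEdge a b) ∩ B → σ = {b} := by
    intro σ hσ
    rw [Finset.mem_inter, Finset.mem_union, mem_closedEdge] at hσ
    rcases hσ.1 with e | e | e | e
    · exact absurd hσ.2 (Finset.disjoint_left.1 h.disjoint e)
    · exact absurd hσ.2 (h.notMem_right (by simp [e]))
    · exact e
    · exact absurd hσ.2 (h.notMem_right (by simp [e]))
  have h2 := h1.change_base (y := b) (Reach.edge (Finset.mem_union_right _ (by simp [closedEdge])))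
  have h3 := IsUniv.union hcx h.cx_right (fun v h1 h2 => by
      have := hBE {v} (Finset.mem_inter.2 ⟨h1, h2⟩)
      rw [Finset.singleton_inj] at this
      rw [this]
      exact Relation.ReflTransGen.refl) h2 hB
    (fun u v hm => by
      obtain ⟨rfl, rfl⟩ := hsing _ _ _ (hBE _ hm)
      exact h2.cocycle.self (Finset.mem_union_right _ (by simp [closedEdge])))
    (fun u v hm => by
      obtain ⟨rfl, rfl⟩ := hsing _ _ _ (hBE _ hm)
      exact hB.cocycle.self h.mem_right)
  have hKe : A ∪ closedEdge a b ∪ B = K := by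
    rw [h.eq_insert]
    have := h.mem_left
    have := h.mem_right
    ext σ
    simp only [Finset.mem_union, mem_closedEdge, Finset.mem_insert]
    grind
  rw [hKe] at h3
  have h4 : HasUniv K (Monoid.Coprod (Monoid.Coprod G Unit) G') :=
    ⟨b, h.right_subset h.mem_right, _, h3⟩
  exact h4.congr (MulEquiv.coprodCongr (MulEquiv.coprodPUnit _) (MulEquiv.refl G'))

lemma chi_singleton (x : α) : chi ({{x}} : Finset (Finset α)) = 1 := by
  simp [chi]

lemma IsFreeEdge.erase_subset {a b c : α} : (K.erase {a, b, c}).erase {a, b} ⊆ K :=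
  (Finset.erase_subset _ _).trans (Finset.erase_subset _ _)

lemma chi_le_one (hK : IsCx K) (hconn : IsConn K)
    (h : ∀ T ⊆ K, IsCore T → IsConn (cl T) → chi (cl T) ≤ 1) : chi K ≤ 1 := by
  refine collapse_induction
    (P := fun L => (∀ T ⊆ L, IsCore T → IsConn (cl T) → chi (cl T) ≤ 1) → chi L ≤ 1)
    ?_ ?_ ?_ ?_ ?_ K hK hconn h
  · intro K a b c hK hconn hf ih h
    rw [← hf.chi_eq hK]
    exact ih fun T hT => h T (hT.trans IsFreeEdge.erase_subset)
  · intro K a b hK hconn hab he hmax hc ih h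
    have := ih fun T hT => h T (hT.trans (Finset.erase_subset _ _))
    rw [chi_erase_edge he (Finset.card_pair hab)] at this
    omega
  · intro K A B a b hK hconn hb ihA ihB h
    have h1 := ihA fun T hT => h T (hT.trans hb.left_subset)
    have h2 := ihB fun T hT => h T (hT.trans hb.right_subset)
    rw [hb.chi_eq]
    omega
  · intro x _
    rw [chi_singleton]
  · intro T hT hc _ h
    exact h T (subset_cl hT.card_eq) hT hc

/-- A connected complex of Euler characteristic one without cores is simply connected. -/
lemma hasUniv_unit (hK : IsCx K) (hconn : IsConn K) (h : ∀ T ⊆ K, ¬ IsCore T)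
    (hchi : chi K = 1) : HasUniv K Unit := by
  refine collapse_induction (P := fun L => (∀ T ⊆ L, ¬ IsCore T) → chi L = 1 → HasUniv L Unit)
    ?_ ?_ ?_ ?_ ?_ K hK hconn h hchi
  · intro K a b c hK hconn hf ih h hchi
    exact (ih (fun T hT => h T (hT.trans IsFreeEdge.erase_subset))
      (by rw [hf.chi_eq hK, hchi])).of_isFreeEdge hK hf
  · intro K a b hK hconn hab he hmax hc ih h hchi
    have := chi_le_one (hK.erase_of_maximal hmax) hc fun T hT hT' =>
      absurd hT' (h T (hT.trans (Finset.erase_subset _ _)))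
    rw [chi_erase_edge he (Finset.card_pair hab)] at this
    omega
  · intro K A B a b hK hconn hb ihA ihB h hchi
    have hA : ∀ T ⊆ A, ¬ IsCore T := fun T hT => h T (hT.trans hb.left_subset)
    have hB : ∀ T ⊆ B, ¬ IsCore T := fun T hT => h T (hT.trans hb.right_subset)
    have h1 := chi_le_one hb.cx_left hb.conn_left fun T hT hT' => absurd hT' (hA T hT)
    have h2 := chi_le_one hb.cx_right hb.conn_right fun T hT hT' => absurd hT' (hB T hT)
    rw [hb.chi_eq] at hchi
    exact ((ihA hA (by omega)).of_isBridged hb (ihB hB (by omega))).congr (MulEquiv.coprodPUnit _)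
  · intro x _ _
    exact hasUniv_singleton x
  · intro T hT _ _ h
    exact absurd hT (h T (subset_cl hT.card_eq))

lemma cl_filter_comp (hT : ∀ t ∈ T, t.card = 3) (v : α) :
    cl (T.filter (· ∈ comp (cl T) v)) = comp (cl T) v := by
  have hcx := isCx_cl hT
  have hsub := subset_cl hT
  ext σ
  rw [mem_cl]
  constructor
  · rintro ⟨hne, t, ht, hs⟩
    exact (hcx.isCx_comp v).down t (Finset.mem_filter.1 ht).2 σ hs hne
  · intro hσ
    obtain ⟨hne, t, ht, hs⟩ := mem_cl.1 (comp_subset hσ)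
    obtain ⟨u, hu⟩ := hne
    exact ⟨⟨u, hu⟩, t, Finset.mem_filter.2 ⟨ht, hcx.mem_comp_of_reach (hsub ht) (hs hu)
      ((mem_comp.1 hσ).2 u hu)⟩, hs⟩

lemma IsCore.of_comp (hT : IsCore T) {v : α} (hv : {v} ∈ cl T) :
    ∃ T' ⊆ T, IsCore T' ∧ cl T' = comp (cl T) v := by
  have hcx := isCx_cl hT.card_eq
  have hsub := subset_cl hT.card_eq
  refine ⟨T.filter (· ∈ comp (cl T) v), Finset.filter_subset _ _, ?_, ?_⟩
  · have hT3 : ∀ t ∈ T.filter (· ∈ comp (cl T) v), t.card = 3 := fun t ht =>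
      hT.card_eq t (Finset.mem_filter.1 ht).1
    refine ⟨?_, hT3, fun e he => ?_⟩
    · obtain ⟨-, t, ht, hs⟩ := mem_cl.1 hv
      exact ⟨t, Finset.mem_filter.2 ⟨ht, hcx.mem_comp_of_reach (hsub ht) (by simpa using hs)
        Relation.ReflTransGen.refl⟩⟩
    · obtain ⟨hc, t, ht, hs⟩ := mem_edges.1 he
      rw [Finset.mem_filter] at ht
      have h2 := hT.two_le_deg e (mem_edges.2 ⟨hc, t, ht.1, hs⟩)
      have : (T.filter (· ∈ comp (cl T) v)).filter (e ⊆ ·) = T.filter (e ⊆ ·) := by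
        ext s
        simp only [Finset.mem_filter]
        constructor
        · rintro ⟨⟨h1, -⟩, h2⟩
          exact ⟨h1, h2⟩
        · rintro ⟨h1, h2⟩
          obtain ⟨u, hu⟩ := Finset.card_pos.1 (by rw [hc]; norm_num : 0 < e.card)
          exact ⟨⟨h1, hcx.mem_comp_of_reach (hsub h1) (h2 hu) ((mem_comp.1 ht.2).2 u (hs hu))⟩, h2⟩
      rwa [deg, this]
  · exact cl_filter_comp hT.card_eq v

lemma IsCore.exists_vertex (hT : IsCore T) : ∃ v, {v} ∈ cl T := by
  obtain ⟨t, ht⟩ := hT.nonempty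
  obtain ⟨v, hv⟩ := Finset.card_pos.1 (by rw [hT.card_eq t ht]; norm_num : 0 < t.card)
  exact ⟨v, mem_cl.2 ⟨by simp, t, ht, by simpa using hv⟩⟩

/-- A core containing no smaller core. -/
structure IsMinCore (Z : Finset (Finset α)) : Prop where
  isCore : IsCore Z
  eq_of_subset : ∀ T ⊆ Z, IsCore T → T = Z

lemma IsMinCore.isConn (hZ : IsMinCore Z) : IsConn (cl Z) := by
  obtain ⟨v, hv⟩ := hZ.isCore.exists_vertex
  obtain ⟨T', hs, hT', he⟩ := hZ.isCore.of_comp hv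
  rw [hZ.eq_of_subset T' hs hT'] at he
  rw [he]
  exact (isCx_cl hZ.isCore.card_eq).isConn_comp hv

lemma IsCore.exists_isMinCore (hT : IsCore T) : ∃ Z ⊆ T, IsMinCore Z := by
  induction hn : T.card using Nat.strong_induction_on generalizing T with
  | _ n ih =>
  subst hn
  by_cases h : ∃ T' ⊆ T, IsCore T' ∧ T' ≠ T
  · obtain ⟨T', hs, hc, hne⟩ := h
    obtain ⟨Z, hZ, hm⟩ := ih _ (Finset.card_lt_card (hs.ssubset_of_ne hne)) hc rfl
    exact ⟨Z, hZ.trans hs, hm⟩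
  · exact ⟨T, subset_rfl, hT, fun T' hs hc => by_contra fun hne => h ⟨T', hs, hc, hne⟩⟩

/-- A connected complex of Euler characteristic one with a single connected core has the same
fundamental group as this core. -/
lemma HasUniv.of_unique_core (hZ : IsCore Z) (hZ1 : chi (cl Z) = 1) (hZG : HasUniv (cl Z) G)
    (hK : IsCx K) (hconn : IsConn K) (hZK : Z ⊆ K)
    (h : ∀ T ⊆ K, IsCore T → IsConn (cl T) → T = Z)
    (hchi : chi K = 1) : HasUniv K G := by
  have key : ∀ L, IsCx L → IsConn L → (∀ T ⊆ L, IsCore T → IsConn (cl T) → T = Z) →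
      chi L ≤ 1 := fun L h1 h2 h3 => chi_le_one h1 h2 fun T hT h4 h5 => by
    rw [h3 T hT h4 h5, hZ1]
  have key2 : ∀ L, (∀ T ⊆ L, IsCore T → IsConn (cl T) → T = Z) → ¬ Z ⊆ L →
      ∀ T ⊆ L, ¬ IsCore T := by
    intro L h1 h2 T hT hT'
    obtain ⟨Z', hZ', hm⟩ := hT'.exists_isMinCore
    refine h2 ?_
    rw [← h1 Z' (hZ'.trans hT) hm.isCore hm.isConn]
    exact hZ'.trans hT
  refine collapse_induction (P := fun L => (∀ T ⊆ L, IsCore T → IsConn (cl T) → T = Z) →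
    Z ⊆ L → chi L = 1 → HasUniv L G)
    ?_ ?_ ?_ ?_ ?_ K hK hconn h hZK hchi
  · intro K a b c hK hconn hf ih h hZK hchi
    refine (ih (fun T hT => h T (hT.trans IsFreeEdge.erase_subset)) (fun t ht => ?_)
      (by rw [hf.chi_eq hK, hchi])).of_isFreeEdge hK hf
    refine hf.mem_erase.2 ⟨hZK ht, fun hab => ?_⟩
    have he : {a, b} ⊆ t := by grind
    have h2 := hZ.two_le_deg {a, b} (mem_edges.2 ⟨Finset.card_pair hf.hab, t, ht, he⟩)
    have h3 : Z.filter ({a, b} ⊆ ·) ⊆ {{a, b, c}} := by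
      intro s hs
      rw [Finset.mem_filter] at hs
      rw [Finset.mem_singleton]
      refine (hf.eq_or s (hZK hs.1) (hs.2 (by simp)) (hs.2 (by simp))).resolve_left ?_
      rintro rfl
      have := hZ.card_eq _ hs.1
      rw [Finset.card_pair hf.hab] at this
      omega
    have := Finset.card_le_card h3
    rw [Finset.card_singleton] at this
    rw [deg] at h2
    omega
  · intro K a b hK hconn hab he hmax hc ih h hZK hchi
    have := key _ (hK.erase_of_maximal hmax) hc fun T hT =>
      h T (hT.trans (Finset.erase_subset _ _))
    rw [chi_erase_edge he (Finset.card_pair hab)] at this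
    omega
  · intro K A B a b hK hconn hb ihA ihB h hZK hchi
    have hA : ∀ T ⊆ A, IsCore T → IsConn (cl T) → T = Z := fun T hT =>
      h T (hT.trans hb.left_subset)
    have hB : ∀ T ⊆ B, IsCore T → IsConn (cl T) → T = Z := fun T hT =>
      h T (hT.trans hb.right_subset)
    have h1 := key A hb.cx_left hb.conn_left hA
    have h2 := key B hb.cx_right hb.conn_right hB
    rw [hb.chi_eq] at hchi
    have hor : Z ⊆ A ∨ Z ⊆ B := by
      by_contra hn
      rw [not_or] at hn
      have a1 := hasUniv_unit hb.cx_left hb.conn_left (key2 A hA hn.1) (by omega)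
      obtain ⟨t, ht⟩ := hZ.nonempty
      by_cases hne : ∃ T ⊆ K, IsCore T ∧ IsConn (cl T)
      · have hconnZ : IsConn (cl Z) := by
          obtain ⟨T, hT, hc, hcc⟩ := hne
          rw [← h T hT hc hcc]
          exact hcc
        have ht3 := hZ.card_eq
        have hcl := hK.cl_subset hZK
        have hZb : ∀ σ ∈ cl Z, σ ≠ {a, b} := by
          rintro σ hσ rfl
          obtain ⟨-, t, ht, hs⟩ := mem_cl.1 hσ
          have hm := hZK ht
          rw [hb.eq_insert] at hm
          rcases Finset.mem_insert.1 hm with e | hm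
          · have := ht3 t ht
            rw [e, Finset.card_pair hb.ne] at this
            omega
          · rcases Finset.mem_union.1 hm with hm | hm
            · exact hb.notMem_left (hs (by simp)) hm
            · exact hb.notMem_right (hs (by simp)) hm
        have hAB : ∀ σ ∈ cl Z, σ ∈ A ∪ B := by
          intro σ hσ
          rw [← hb.erase_eq]
          exact Finset.mem_erase.2 ⟨hZb σ hσ, hcl hσ⟩
        have hr : ∀ u v, Reach (cl Z) u v → {u} ∈ A → {v} ∈ A := by
          intro u v hr hu
          induction hr with
          | refl => exact hu
          | tail _ hm ih =>
            rcases Finset.mem_union.1 (hAB _ hm) with h' | h'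
            · exact hb.cx_left.right_mem h'
            · exact absurd (hb.cx_right.left_mem h') (hb.disj _ ih)
        have hcx := isCx_cl ht3
        have hall : ∀ C, (∀ σ ∈ A ∪ B, ∀ v ∈ σ, {v} ∈ C → σ ∈ C) →
            (∀ s ∈ Z, ∃ v ∈ s, {v} ∈ C) → Z ⊆ C := by
          intro C h1 h2 s hs
          obtain ⟨v, hv, hvC⟩ := h2 s hs
          exact h1 s (hAB s (subset_cl ht3 hs)) v hv hvC
        rcases Finset.mem_union.1 (hAB t (subset_cl ht3 ht)) with htA | htB
        · refine hn.1 (hall A (fun σ hσ v hv hvA => ?_) fun s hs => ?_)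
          · rcases Finset.mem_union.1 hσ with h' | h'
            · exact h'
            · exact absurd (hb.cx_right.vertex_mem h' hv) (hb.disj _ hvA)
          · obtain ⟨u, hu⟩ := hb.cx_left.nonempty t htA
            obtain ⟨v, hv⟩ := hcx.nonempty s (subset_cl ht3 hs)
            exact ⟨v, hv, hr u v (hconnZ.reach_of_mem (hcx.vertex_mem (subset_cl ht3 ht) hu)
              (hcx.vertex_mem (subset_cl ht3 hs) hv)) (hb.cx_left.vertex_mem htA hu)⟩
        · refine hn.2 (hall B (fun σ hσ v hv hvB => ?_) fun s hs => ?_)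
          · rcases Finset.mem_union.1 hσ with h' | h'
            · exact absurd hvB (hb.disj _ (hb.cx_left.vertex_mem h' hv))
            · exact h'
          · obtain ⟨u, hu⟩ := hb.cx_right.nonempty t htB
            obtain ⟨v, hv⟩ := hcx.nonempty s (subset_cl ht3 hs)
            refine ⟨v, hv, ?_⟩
            have hvm := hcx.vertex_mem (subset_cl ht3 hs) hv
            rcases Finset.mem_union.1 (hAB _ hvm) with h' | h'
            · exact absurd (hb.cx_right.vertex_mem htB hu) (hb.disj _ (hr v u
                (hconnZ.reach_of_mem hvm (hcx.vertex_mem (subset_cl ht3 ht) hu)) h'))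
            · exact h'
      · obtain ⟨Z', hZ', hm⟩ := hZ.exists_isMinCore
        exact hne ⟨Z', hZ'.trans hZK, hm.isCore, hm.isConn⟩
    have hdisj : ¬ (Z ⊆ A ∧ Z ⊆ B) := by
      rintro ⟨h1, h2⟩
      obtain ⟨t, ht⟩ := hZ.nonempty
      exact Finset.disjoint_left.1 hb.disjoint (h1 ht) (h2 ht)
    rcases hor with hZA | hZB
    · have hn : ¬ Z ⊆ B := fun h => hdisj ⟨hZA, h⟩
      exact ((ihA hA hZA (by omega)).of_isBridged hb (hasUniv_unit hb.cx_right hb.conn_right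
        (key2 B hB hn) (by omega))).congr (MulEquiv.coprodPUnit _)
    · have hn : ¬ Z ⊆ A := fun h => hdisj ⟨h, hZB⟩
      exact ((hasUniv_unit hb.cx_left hb.conn_left
        (key2 A hA hn) (by omega)).of_isBridged hb (ihB hB hZB (by omega))).congr
          (MulEquiv.punitCoprod _)
  · intro x _ hZK _
    obtain ⟨t, ht⟩ := hZ.nonempty
    have := Finset.mem_singleton.1 (hZK ht)
    have h3 := hZ.card_eq t ht
    rw [this] at h3
    simp at h3
  · intro T hT hc _ h _ _
    rw [h T (subset_cl hT.card_eq) hT hc]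
    exact hZG

end HasUniversalCocycle

section Holonomy

set_option linter.unusedSectionVars false

variable {α : Type} [DecidableEq α] {K L A B T Z : Finset (Finset α)}

lemma eq_of_subset_triple {x y z : α} {e : Finset α} (he : e.card = 2) (hs : e ⊆ {x, y, z}) :
    e = {x, y} ∨ e = {y, z} ∨ e = {z, x} := by
  obtain ⟨p, q, hpq, rfl⟩ := Finset.card_eq_two.1 he
  have hp : p ∈ ({x, y, z} : Finset α) := hs (by simp)
  have hq : q ∈ ({x, y, z} : Finset α) := hs (by simp)
  simp only [Finset.mem_insert, Finset.mem_singleton] at hp hq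
  have h1 := Finset.pair_comm x y
  have h2 := Finset.pair_comm y z
  have h3 := Finset.pair_comm x z
  rcases hp with hp | hp | hp <;> rcases hq with hq | hq | hq <;> subst hp <;>
    first
    | exact absurd hq.symm hpq
    | (rw [hq]; tauto)

lemma ne_of_card_triple {x y z : α} (h : ({x, y, z} : Finset α).card = 3) :
    x ≠ y ∧ x ≠ z ∧ y ≠ z := by
  refine ⟨?_, ?_, ?_⟩
  · rintro rfl
    have := Finset.card_le_two (a := x) (b := z)
    simp at h
    omega
  · rintro rfl
    have := Finset.card_le_two (a := x) (b := y)
    rw [show ({x, y, x} : Finset α) = {x, y} by grind] at h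
    omega
  · rintro rfl
    have := Finset.card_le_two (a := x) (b := y)
    simp at h
    omega

/-- In an even set of triangles, a cocycle with values in the group of order two defined away
from one triangle has trivial holonomy around this triangle. -/
lemma holonomy_eq_one (hZ : ∀ t ∈ Z, t.card = 3) (hev : ∀ e, e.card = 2 → Even (deg Z e))
    {a b c : α} (hc : ({a, b, c} : Finset α).card = 3) (ht : {a, b, c} ∈ Z)
    {φ : α → α → Multiplicative (ZMod 2)} (hφ : IsCocycle ((cl Z).erase {a, b, c}) φ) :
    φ a b * φ b c * φ c a = 1 := by
  classical
  have hcx := (isCx_cl hZ).erase_of_card hc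
  have hzz : ∀ x y : Multiplicative (ZMod 2), x * y = 1 → x = y := by decide
  set val : Finset α → ZMod 2 := fun e =>
    if h : ∃ u v : α, u ≠ v ∧ e = {u, v} then
      Multiplicative.toAdd (φ h.choose h.choose_spec.choose) else 0 with hval
  have hmem : ∀ t ∈ Z, ∀ u ∈ t, ∀ v ∈ t, {u, v} ∈ (cl Z).erase {a, b, c} := by
    intro t ht u hu v hv
    refine Finset.mem_erase.2 ⟨fun e => ?_, mem_cl.2 ⟨by simp, t, ht, by grind⟩⟩
    have := Finset.card_le_two (a := u) (b := v)
    rw [e] at this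
    omega
  have hv : ∀ t ∈ Z, ∀ u ∈ t, ∀ v ∈ t, u ≠ v → val {u, v} = Multiplicative.toAdd (φ u v) := by
    intro t ht u hu v hv huv
    have hex : ∃ x y : α, x ≠ y ∧ ({u, v} : Finset α) = {x, y} := ⟨u, v, huv, rfl⟩
    have hd : val {u, v} = Multiplicative.toAdd (φ hex.choose hex.choose_spec.choose) :=
      dif_pos hex
    have key : ∀ p q, p ≠ q ∧ ({u, v} : Finset α) = {p, q} → φ p q = φ u v := by
      intro p q hs
      rcases pair_eq_pair hs.2 with ⟨rfl, rfl⟩ | ⟨rfl, rfl⟩ | h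
      · rfl
      · exact (hzz _ _ (hφ.mul_swap hcx (hmem t ht u hu v hv))).symm
      · exact absurd h hs.1
    rw [hd]
    exact congrArg _ (key _ _ hex.choose_spec.choose_spec)
  have htri : ∀ x y z : α, ({x, y, z} : Finset α).card = 3 → {x, y, z} ∈ Z →
      ∑ e ∈ (edges Z).filter (· ⊆ {x, y, z}), val e =
        Multiplicative.toAdd (φ x y * φ y z * φ z x) := by
    intro x y z h3 hm
    obtain ⟨hxy, hxz, hyz⟩ := ne_of_card_triple h3
    have hs : (edges Z).filter (· ⊆ {x, y, z}) = {{x, y}, {y, z}, {z, x}} := by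
      ext e
      simp only [Finset.mem_filter, mem_edges, Finset.mem_insert, Finset.mem_singleton]
      constructor
      · rintro ⟨⟨he, -⟩, hs⟩
        exact eq_of_subset_triple he hs
      · rintro (rfl | rfl | rfl)
        · exact ⟨⟨Finset.card_pair hxy, _, hm, by grind⟩, by grind⟩
        · exact ⟨⟨Finset.card_pair hyz, _, hm, by grind⟩, by grind⟩
        · exact ⟨⟨Finset.card_pair hxz.symm, _, hm, by grind⟩, by grind⟩
    rw [hs, Finset.sum_insert, Finset.sum_insert, Finset.sum_singleton,
      hv _ hm x (by simp) y (by simp) hxy, hv _ hm y (by simp) z (by simp) hyz,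
      hv _ hm z (by simp) x (by simp) hxz.symm, toAdd_mul, toAdd_mul, add_assoc]
    · rw [Finset.mem_singleton]
      intro e
      rcases pair_eq_pair e with h | h | h <;> grind
    · simp only [Finset.mem_insert, Finset.mem_singleton]
      rintro (e | e) <;> rcases pair_eq_pair e with h | h | h <;> grind
  have h0 : ∑ t ∈ Z, ∑ e ∈ (edges Z).filter (· ⊆ t), val e = 0 := by
    simp only [Finset.sum_filter]
    rw [Finset.sum_comm]
    refine Finset.sum_eq_zero fun e he => ?_
    rw [← Finset.sum_filter, Finset.sum_const, nsmul_eq_mul]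
    have := hev e (mem_edges.1 he).1
    rw [deg] at this
    rw [(ZMod.natCast_eq_zero_iff_even).2 this, zero_mul]
  rw [Finset.sum_eq_single_of_mem {a, b, c} ht, htri a b c hc ht] at h0
  · exact h0
  · intro s hs hne
    obtain ⟨x, y, z, -, -, -, rfl⟩ := Finset.card_eq_three.1 (hZ s hs)
    rw [htri x y z (hZ _ hs) hs]
    exact hφ.triangle_eq_one hcx (Finset.mem_erase.2 ⟨hne, subset_cl hZ hs⟩)

/-- A connected graph of Euler characteristic zero has a cycle avoiding a given edge or has a
non-separating edge different from the given one. -/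
lemma exists_nonseparating (e₀ : Finset α) (hL : IsCx L) (hc : IsConn L)
    (h2 : ∀ σ ∈ L, σ.card ≤ 2) (hchi : chi L = 0) :
    ∃ a b, a ≠ b ∧ {a, b} ∈ L ∧ {a, b} ≠ e₀ ∧ IsConn (L.erase {a, b}) := by
  induction hn : L.card using Nat.strong_induction_on generalizing L with
  | _ n ih =>
  subst hn
  have hnc : ∀ M ⊆ L, IsCx M → IsConn M → chi M ≤ 1 := fun M hM h1 h2' =>
    chi_le_one h1 h2' fun T hT hT' => by
      obtain ⟨t, ht⟩ := hT'.nonempty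
      have a1 := hT'.card_eq t ht
      have a2 := h2 t (hM (hT ht))
      omega
  have hex : ∃ a b, a ≠ b ∧ {a, b} ∈ L ∧ {a, b} ≠ e₀ := by
    by_contra hno
    push Not at hno
    have hsum : chi L = ((L.filter (·.card = 1)).card : ℤ) - (L.filter (·.card = 2)).card := by
      rw [chi, Finset.card_filter, Finset.card_filter]
      push_cast
      rw [← Finset.sum_sub_distrib]
      refine Finset.sum_congr rfl fun σ hσ => ?_
      have a1 := h2 σ hσ
      have a2 := (hL.nonempty σ hσ).card_pos
      have : σ.card = 1 ∨ σ.card = 2 := by omega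
      rcases this with h | h <;> simp [h]
    have hE : L.filter (·.card = 2) ⊆ {e₀} := by
      intro e he
      rw [Finset.mem_filter] at he
      obtain ⟨a, b, hab, rfl⟩ := Finset.card_eq_two.1 he.2
      exact Finset.mem_singleton.2 (hno a b hab he.1)
    have hE1 := Finset.card_le_card hE
    rw [Finset.card_singleton] at hE1
    obtain ⟨x, hx⟩ := hc.1
    have hV : 0 < (L.filter (·.card = 1)).card :=
      Finset.card_pos.2 ⟨{x}, Finset.mem_filter.2 ⟨hx, by simp⟩⟩
    obtain ⟨e, he⟩ : (L.filter (·.card = 2)).Nonempty := Finset.card_pos.1 (by omega)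
    rw [Finset.mem_filter] at he
    obtain ⟨a, b, hab, rfl⟩ := Finset.card_eq_two.1 he.2
    have hs : {{a}, {b}} ⊆ L.filter (·.card = 1) := by
      intro σ hσ
      rw [Finset.mem_insert, Finset.mem_singleton] at hσ
      rcases hσ with rfl | rfl
      · exact Finset.mem_filter.2 ⟨hL.left_mem he.1, by simp⟩
      · exact Finset.mem_filter.2 ⟨hL.right_mem he.1, by simp⟩
    have := Finset.card_le_card hs
    rw [Finset.card_pair (by simpa using hab)] at this
    omega
  obtain ⟨a, b, hab, he, hne⟩ := hex
  by_cases hc' : IsConn (L.erase {a, b})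
  · exact ⟨a, b, hab, he, hne, hc'⟩
  have hmax : ∀ σ ∈ L, {a, b} ⊆ σ → σ = {a, b} := fun σ hσ hs =>
    (Finset.eq_of_subset_of_card_le hs (by rw [Finset.card_pair hab]; exact h2 σ hσ)).symm
  have key : ∀ A B a b, IsBridged L A B a b → chi A = 0 →
      ∃ a b, a ≠ b ∧ {a, b} ∈ L ∧ {a, b} ≠ e₀ ∧ IsConn (L.erase {a, b}) := by
    intro A B a b hb hA
    obtain ⟨p, q, hpq, hm, hne, hcc⟩ := ih _ hb.card_left_lt hb.cx_left hb.conn_left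
      (fun σ hσ => h2 σ (hb.left_subset hσ)) hA rfl
    have hsing : ∀ v, ({v} : Finset α) ≠ {p, q} := fun v e => by
      have := Finset.card_pair hpq
      rw [← e] at this
      simp at this
    refine ⟨p, q, hpq, hb.left_subset hm, hne, hc.of_edges (Finset.erase_subset _ _)
      (fun v hv => Finset.mem_erase.2 ⟨hsing v, hv⟩) fun u v huv => ?_⟩
    by_cases e : ({u, v} : Finset α) = {p, q}
    · rw [← e] at hm hcc hsing ⊢
      exact (hcc.reach_of_mem (Finset.mem_erase.2 ⟨hsing u, hb.cx_left.left_mem hm⟩)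
        (Finset.mem_erase.2 ⟨hsing v, hb.cx_left.right_mem hm⟩)).mono
          (Finset.erase_subset_erase _ hb.left_subset)
    · exact Reach.edge (Finset.mem_erase.2 ⟨e, huv⟩)
  obtain ⟨A, B, hb⟩ := exists_isBridged hL hc hab he hmax hc'
  have h1 := hnc A hb.left_subset hb.cx_left hb.conn_left
  have h3 := hnc B hb.right_subset hb.cx_right hb.conn_right
  have h4 := hb.chi_eq
  have : chi A = 0 ∨ chi B = 0 := by omega
  rcases this with h | h
  · exact key A B a b hb h
  · exact key B A b a hb.symm h

end Holonomy

section Winding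

set_option linter.unusedSectionVars false

variable {α : Type} [DecidableEq α] {K L A B T Z : Finset (Finset α)}

lemma deg_erase {t e : Finset α} (ht : t ∈ T) :
    deg (T.erase t) e + (if e ⊆ t then 1 else 0) = deg T e := by
  rw [deg, deg, Finset.filter_erase]
  split_ifs with h
  · exact Finset.card_erase_add_one (Finset.mem_filter.2 ⟨ht, h⟩)
  · rw [Finset.erase_eq_of_notMem (by simp [h]), add_zero]

/-- The oriented edge from `x` to `y`, as an antisymmetric function. -/
def orientedEdge (x y u v : α) : ℤ :=
  (if u = x ∧ v = y then 1 else 0) - if u = y ∧ v = x then 1 else 0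

/-- The oriented boundary of a triangle, as an antisymmetric function. -/
def orientedBoundary (a b c u v : α) : ℤ :=
  orientedEdge a b u v + orientedEdge b c u v + orientedEdge c a u v

lemma orientedEdge_swap (x y u v : α) : orientedEdge x y u v = -orientedEdge x y v u := by
  simp only [orientedEdge]
  grind

lemma orientedBoundary_swap (a b c u v : α) :
    orientedBoundary a b c u v = -orientedBoundary a b c v u := by
  simp only [orientedBoundary]
  rw [orientedEdge_swap a b, orientedEdge_swap b c, orientedEdge_swap c a]
  ring

lemma abs_orientedBoundary_le {a b c u v : α} (hab : a ≠ b) (hac : a ≠ c) (hbc : b ≠ c) :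
    |orientedBoundary a b c u v| ≤ if {u, v} ⊆ ({a, b, c} : Finset α) then 1 else 0 := by
  rw [abs_le]
  simp only [orientedBoundary, orientedEdge, Finset.insert_subset_iff, Finset.singleton_subset_iff,
    Finset.mem_insert, Finset.mem_singleton]
  grind

lemma orientedBoundary_self {a b c : α} (hab : a ≠ b) (hac : a ≠ c) (hbc : b ≠ c) :
    orientedBoundary a b c a b = 1 := by
  simp only [orientedBoundary, orientedEdge]
  grind

variable [Fintype α]

lemma sum_orientedEdge (x y : α) (ψ : α → α → ℤ) :
    ∑ u, ∑ v, orientedEdge x y u v * ψ u v = ψ x y - ψ y x := by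
  simp only [orientedEdge, sub_mul, Finset.sum_sub_distrib, ite_and, ite_mul, one_mul, zero_mul]
  simp

lemma sum_orientedBoundary (a b c : α) (ψ : α → α → ℤ) :
    ∑ u, ∑ v, orientedBoundary a b c u v * ψ u v =
      (ψ a b - ψ b a) + (ψ b c - ψ c b) + (ψ c a - ψ a c) := by
  simp only [orientedBoundary, add_mul, Finset.sum_add_distrib, sum_orientedEdge]

lemma exists_winding_le (e₀ : Finset α) (hdeg : ∀ e, e.card = 2 → e ≠ e₀ → deg Z e ≤ 2)
    (hfree : ∀ T ⊆ Z, T.Nonempty → T ≠ Z → ∃ e, e.card = 2 ∧ deg Z e = 2 ∧ deg T e = 1)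
    (hLZ : ∀ t ∈ L, t.card = 3 → t ∈ Z) {t : Finset α} (ht : t ∈ Z) (htL : t ∉ L)
    (hL : IsCx L) (hc : IsConn L) (hchi : chi L = 0)
    (R : α → α → ℤ) (hR : ∀ u v, R u v = -R v u) (hsupp : ∀ u v, {u, v} ∉ L → R u v = 0)
    (hRZ : ∀ u v, u ≠ v → |R u v| + deg (L.filter (·.card = 3)) {u, v} ≤ deg Z {u, v}) :
    ∃ x, {x} ∈ L ∧ ∃ φ : α → α → Multiplicative ℤ, IsUniv L x (Multiplicative ℤ) φ ∧
      |∑ u, ∑ v, R u v * Multiplicative.toAdd (φ u v)| ≤ 4 := by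
  induction hn : L.card using Nat.strong_induction_on generalizing L R with
  | _ n ih =>
  subst hn
  set T := L.filter (·.card = 3) with hT
  have hT3 : ∀ s ∈ T, s.card = 3 := fun s hs => (Finset.mem_filter.1 hs).2
  have hTL : T ⊆ L := Finset.filter_subset _ _
  have hTZ : T ⊆ Z := fun s hs => hLZ s (hTL hs) (hT3 s hs)
  by_cases hTne : T.Nonempty
  · obtain ⟨e, hec, heZ, heT⟩ := hfree T hTZ hTne (by
      rintro h
      exact htL (hTL (h ▸ ht)))
    obtain ⟨s, hs⟩ := Finset.card_eq_one.1 heT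
    have hsm : s ∈ T ∧ e ⊆ s := by
      rw [← Finset.mem_filter, hs]
      simp
    obtain ⟨a, b, hab, rfl⟩ := Finset.card_eq_two.1 hec
    obtain ⟨c, hc2⟩ : ∃ c, s \ {a, b} = {c} := Finset.card_eq_one.1 (by
      rw [Finset.card_sdiff_of_subset hsm.2, hT3 s hsm.1, hec])
    have hcm : c ∈ s \ {a, b} := by rw [hc2]; simp
    have hse : s = {a, b, c} := by
      rw [← Finset.sdiff_union_of_subset hsm.2, hc2]
      ext
      simp
      tauto
    subst hse
    have hs3 := hT3 _ hsm.1
    obtain ⟨-, hac, hbc⟩ := ne_of_card_triple hs3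
    have hf : IsFreeEdge L a b c := by
      refine ⟨hab, hac, hbc, hTL hsm.1, fun σ hσ ha hb => ?_⟩
      have hs' : {a, b} ⊆ σ := by grind
      by_cases hc3 : σ.card = 3
      · right
        have : σ ∈ T.filter ({a, b} ⊆ ·) :=
          Finset.mem_filter.2 ⟨Finset.mem_filter.2 ⟨hσ, hc3⟩, hs'⟩
        rwa [hs, Finset.mem_singleton] at this
      · left
        have := hL.card_le σ hσ
        exact (Finset.eq_of_subset_of_card_le hs' (by rw [hec]; omega)).symm
    set L' := (L.erase {a, b, c}).erase {a, b} with hL'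
    have hT' : L'.filter (·.card = 3) = T.erase {a, b, c} := by
      ext σ
      simp only [hL', hT, Finset.mem_filter, Finset.mem_erase]
      constructor
      · tauto
      · rintro ⟨h1, h2, h3⟩
        refine ⟨⟨?_, h1, h2⟩, h3⟩
        rintro rfl
        omega
    have hRab : |R a b| ≤ 1 := by
      have := hRZ a b hab
      rw [heT, heZ] at this
      push_cast at this
      linarith
    set R' : α → α → ℤ := fun u v => R u v - R a b * orientedBoundary a b c u v with hR'
    have hb := fun u v => abs_orientedBoundary_le (u := u) (v := v) hab hac hbc
    obtain ⟨x, hx, φ, hφ, hsum⟩ := ih L'.card (Finset.card_lt_card ⟨IsFreeEdge.erase_subset,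
        fun h => (hf.mem_erase.1 (h hf.mem)).2 (by simp)⟩)
      (fun σ hσ => hLZ σ (hf.mem_erase.1 hσ).1) (fun h => htL (hf.mem_erase.1 h).1)
      (hf.isCx hL) (hf.isConn hL hc) (by rw [hf.chi_eq hL, hchi]) R'
      (fun u v => by
        simp only [hR']
        rw [hR u v, orientedBoundary_swap]
        ring)
      (fun u v huv => by
        simp only [hR']
        rw [hf.mem_erase] at huv
        by_cases hm : {u, v} ∈ L
        · have hn : a ∈ ({u, v} : Finset α) ∧ b ∈ ({u, v} : Finset α) := by tauto
          have : (u = a ∧ v = b) ∨ (u = b ∧ v = a) := by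
            simp only [Finset.mem_insert, Finset.mem_singleton] at hn
            grind
          rcases this with ⟨rfl, rfl⟩ | ⟨rfl, rfl⟩
          · rw [orientedBoundary_self hab hac hbc]
            ring
          · rw [orientedBoundary_swap, orientedBoundary_self hab hac hbc, hR u v]
            ring
        · have h1 := hb u v
          rw [if_neg (fun h => hm (hL.down _ hf.mem _ h (by simp)))] at h1
          rw [hsupp u v hm, abs_nonpos_iff.1 h1]
          ring)
      (fun u v huv => by
        have h1 := hRZ u v huv
        have h2 := hb u v
        have h3 := deg_erase (e := {u, v}) hsm.1
        rw [← hT'] at h3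
        have h4 : |R' u v| ≤ |R u v| + |R a b| * |orientedBoundary a b c u v| := by
          rw [← abs_mul]
          exact abs_sub _ _
        have h5 : |R a b| * |orientedBoundary a b c u v| ≤ 1 * |orientedBoundary a b c u v| :=
          mul_le_mul_of_nonneg_right hRab (abs_nonneg _)
        rw [← h3] at h1
        push_cast at h1
        linarith) rfl
    obtain ⟨φ', hφ', hag⟩ := hφ.of_collapse hL hf.hab hf.hac hf.hbc hf.mem hf.eq_or
    refine ⟨x, (hf.mem_erase.1 hx).1, φ', hφ', ?_⟩
    have e1 : ∀ u v, R u v * Multiplicative.toAdd (φ' u v) =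
        R' u v * Multiplicative.toAdd (φ u v) +
          R a b * (orientedBoundary a b c u v * Multiplicative.toAdd (φ' u v)) := by
      intro u v
      by_cases hm : {u, v} ∈ L'
      · rw [hag u v hm]
        simp only [hR']
        ring
      · have h0 : R' u v = 0 := by
          have : R u v = R a b * orientedBoundary a b c u v := by
            rw [hf.mem_erase] at hm
            by_cases hm' : {u, v} ∈ L
            · have hn : a ∈ ({u, v} : Finset α) ∧ b ∈ ({u, v} : Finset α) := by tauto
              have : (u = a ∧ v = b) ∨ (u = b ∧ v = a) := by
                simp only [Finset.mem_insert, Finset.mem_singleton] at hn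
                grind
              rcases this with ⟨rfl, rfl⟩ | ⟨rfl, rfl⟩
              · rw [orientedBoundary_self hab hac hbc]
                ring
              · rw [orientedBoundary_swap, orientedBoundary_self hab hac hbc, hR u v]
                ring
            · have h1 := hb u v
              rw [if_neg (fun h => hm' (hL.down _ hf.mem _ h (by simp)))] at h1
              rw [hsupp u v hm', abs_nonpos_iff.1 h1]
              ring
          simp only [hR']
          rw [this]
          ring
        have h1 : R u v = R a b * orientedBoundary a b c u v := by
          simp only [hR'] at h0
          linarith
        rw [h0, h1]
        ring
    have e2 : ∑ u, ∑ v, orientedBoundary a b c u v * Multiplicative.toAdd (φ' u v) = 0 := by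
      rw [sum_orientedBoundary a b c fun u v => Multiplicative.toAdd (φ' u v)]
      have hsw : ∀ u v, {u, v} ∈ L → Multiplicative.toAdd (φ' u v) =
          -Multiplicative.toAdd (φ' v u) := by
        intro u v hm
        have := congrArg Multiplicative.toAdd (hφ'.cocycle.mul_swap hL hm)
        rw [toAdd_mul, toAdd_one] at this
        linarith
      have htr := congrArg Multiplicative.toAdd (hφ'.cocycle.triangle_eq_one hL hf.mem)
      rw [toAdd_mul, toAdd_mul, toAdd_one] at htr
      have a1 := hsw a b (hL.edge_mem hf.mem (by simp) (by simp))
      have a2 := hsw b c (hL.edge_mem hf.mem (by simp) (by simp))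
      have a3 := hsw c a (hL.edge_mem hf.mem (by simp) (by simp))
      linarith
    simp only [e1, Finset.sum_add_distrib, ← Finset.mul_sum]
    rw [e2, mul_zero, add_zero]
    exact hsum
  · rw [Finset.not_nonempty_iff_eq_empty] at hTne
    have hL2 : ∀ σ ∈ L, σ.card ≤ 2 := by
      intro σ hσ
      by_contra hlt
      have h3 := hL.card_le σ hσ
      have : σ ∈ T := Finset.mem_filter.2 ⟨hσ, by omega⟩
      rw [hTne] at this
      simp at this
    obtain ⟨a, b, hab, he, hne, hcc⟩ := exists_nonseparating e₀ hL hc hL2 hchi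
    have hmax : ∀ σ ∈ L, {a, b} ⊆ σ → σ = {a, b} := fun σ hσ hs =>
      (Finset.eq_of_subset_of_card_le hs (by rw [Finset.card_pair hab]; exact hL2 σ hσ)).symm
    have hsing : ∀ v, ({v} : Finset α) ≠ {a, b} := fun v e => by
      have := Finset.card_pair hab
      rw [← e] at this
      simp at this
    have ha : {a} ∈ L.erase {a, b} := Finset.mem_erase.2 ⟨hsing a, hL.left_mem he⟩
    have hb : {b} ∈ L.erase {a, b} := Finset.mem_erase.2 ⟨hsing b, hL.right_mem he⟩
    obtain ⟨φ, hφ⟩ := (hasUniv_unit (hL.erase_of_maximal hmax) hcc (fun S hS hS' => by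
      obtain ⟨s, hs⟩ := hS'.nonempty
      have a1 := hS'.card_eq s hs
      have a2 := hL2 s (Finset.mem_of_mem_erase (hS hs))
      omega) (by rw [chi_erase_edge he (Finset.card_pair hab), hchi]; rfl)).exists_at hcc ha
    have h1 := (hφ.attach_edge hL hab he (fun σ hσ ha hb => hmax σ hσ (by grind))
      (hcc.reach_of_mem ha ha) (hcc.reach_of_mem ha hb)).congr (MulEquiv.punitCoprod _)
    refine ⟨a, hL.left_mem he, _, h1, ?_⟩
    have h2 : ∀ u v, Multiplicative.toAdd ((MulEquiv.punitCoprod (Multiplicative ℤ))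
        (if u = a ∧ v = b then Monoid.Coprod.inr (Multiplicative.ofAdd 1) else
          if u = b ∧ v = a then (Monoid.Coprod.inr (Multiplicative.ofAdd 1))⁻¹ else
          Monoid.Coprod.inl (φ u v))) = orientedEdge a b u v := by
      intro u v
      have hu : φ u v = 1 := rfl
      simp only [orientedEdge, hu, map_one]
      by_cases c1 : u = a ∧ v = b
      · have c2 : ¬ (u = b ∧ v = a) := by grind
        rw [if_pos c1, if_pos c1, if_neg c2]
        simp
      · rw [if_neg c1, if_neg c1]
        by_cases c2 : u = b ∧ v = a
        · rw [if_pos c2, if_pos c2, map_inv]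
          simp
        · rw [if_neg c2, if_neg c2]
          simp
    simp only [h2]
    have h3 : ∀ u v, R u v * orientedEdge a b u v = orientedEdge a b u v * R u v :=
      fun u v => mul_comm _ _
    simp only [h3]
    rw [sum_orientedEdge, hR b a]
    have h4 := hRZ a b hab
    have h5 := hdeg {a, b} (Finset.card_pair hab) hne
    have h6 : |R a b| ≤ 2 := by
      have : ((deg Z {a, b} : ℕ) : ℤ) ≤ 2 := by exact_mod_cast h5
      have : (0 : ℤ) ≤ (deg T {a, b} : ℕ) := by positivity
      linarith
    rw [abs_le] at h6 ⊢
    constructor <;> linarith [h6.1, h6.2]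

end Winding

section MinimalCore

set_option linter.unusedSectionVars false

variable {α : Type} [DecidableEq α] {K L A B T Z : Finset (Finset α)}

lemma IsCore.sub_two_nonneg (hT : IsCore T) {e : Finset α} (he : e ∈ edges T) :
    0 ≤ (deg T e : ℤ) - 2 := by
  have := hT.two_le_deg e he
  omega

lemma mem_edges_of_pos {e : Finset α} (hc : e.card = 2) (h : 0 < deg T e) : e ∈ edges T :=
  mem_edges.2 ⟨hc, deg_pos_iff.1 h⟩

lemma IsCore.exists_edge_deg_le (hT : IsCore T) (h : excess (cl T) ≤ 2) :
    ∃ e₀, ∀ e, e.card = 2 → e ≠ e₀ → deg T e ≤ 2 := by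
  by_cases hex : ∃ e₀, e₀.card = 2 ∧ 2 < deg T e₀
  · obtain ⟨e₀, hc₀, h₀⟩ := hex
    refine ⟨e₀, fun e hc hne => ?_⟩
    by_contra hlt
    have hs : {e, e₀} ⊆ edges T := by
      intro x hx
      rw [Finset.mem_insert, Finset.mem_singleton] at hx
      rcases hx with rfl | rfl
      · exact mem_edges_of_pos hc (by omega)
      · exact mem_edges_of_pos hc₀ (by omega)
    have hle := Finset.sum_le_sum_of_subset_of_nonneg (f := fun e => (deg T e : ℤ) - 2) hs
      fun e he _ => hT.sub_two_nonneg he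
    rw [← excess_cl hT.card_eq, Finset.sum_pair hne] at hle
    obtain ⟨k, hk⟩ := hT.even_of_excess_le h e hc
    obtain ⟨k', hk'⟩ := hT.even_of_excess_le h e₀ hc₀
    omega
  · push Not at hex
    exact ⟨∅, fun e hc _ => hex e hc⟩

lemma IsMinCore.exists_free (hZ : IsMinCore Z) {e₀ : Finset α}
    (he₀ : ∀ e, e.card = 2 → e ≠ e₀ → deg Z e ≤ 2) (hTZ : T ⊆ Z) (hT : T.Nonempty)
    (hne : T ≠ Z) : ∃ e, e.card = 2 ∧ deg Z e = 2 ∧ deg T e = 1 := by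
  by_contra hno
  push Not at hno
  have hT3 : ∀ t ∈ T, t.card = 3 := fun t ht => hZ.isCore.card_eq t (hTZ ht)
  have hmain : ∀ e ∈ edges T, e ≠ e₀ → deg T e = 2 := by
    intro e he hne
    obtain ⟨hc, hp⟩ := mem_edges.1 he
    have h1 : 0 < deg T e := deg_pos_iff.2 hp
    have h2 := deg_mono (e := e) hTZ
    have h3 := he₀ e hc hne
    have h4 := hZ.isCore.two_le_deg e (mem_edges_of_pos hc (by omega))
    have h5 := hno e hc (by omega)
    omega
  have hev : ∀ e, e.card = 2 → Even (deg T e) := by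
    intro e hc
    by_contra hodd
    rw [Nat.not_even_iff_odd] at hodd
    have h3 := three_le_card_of_even (O := (edges T).filter fun e => Odd (deg T e))
      ⟨e, Finset.mem_filter.2 ⟨mem_edges_of_pos hc hodd.pos, hodd⟩⟩
      (fun e he => (mem_edges.1 (Finset.mem_filter.1 he).1).1) (even_card_odd_edges hT3)
    have : (edges T).filter (fun e => Odd (deg T e)) ⊆ {e₀} := by
      intro e he
      rw [Finset.mem_filter] at he
      rw [Finset.mem_singleton]
      by_contra hne
      rw [hmain e he.1 hne] at he
      exact absurd he.2 (by decide)
    have := Finset.card_le_card this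
    rw [Finset.card_singleton] at this
    omega
  exact hne (hZ.eq_of_subset T hTZ (isCore_of_even hT hT3 hev))

lemma cl_erase_filter (hT : ∀ t ∈ T, t.card = 3) (t : Finset α) :
    ((cl T).erase t).filter (·.card = 3) = T.erase t := by
  ext s
  simp only [Finset.mem_filter, Finset.mem_erase]
  constructor
  · rintro ⟨⟨h1, h2⟩, h3⟩
    exact ⟨h1, mem_of_mem_cl hT h2 h3⟩
  · rintro ⟨h1, h2⟩
    exact ⟨⟨h1, subset_cl hT h2⟩, hT s h2⟩

/-- A minimal core of Euler characteristic one without superfluous triangles has fundamental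
group of order two. -/
theorem IsMinCore.hasUniv [Fintype α] (hZ : IsMinCore Z) (hK : IsSparse K) (hZK : cl Z ⊆ K)
    (hchi : chi (cl Z) = 1) (hNR : ∀ t ∈ Z, ¬ Removable (cl Z) t) :
    HasUniv (cl Z) (Multiplicative (ZMod 2)) := by
  have hex := hZ.isCore.excess_le_two hK hZK hchi
  have hev := hZ.isCore.even_of_excess_le hex
  have hZ3 := hZ.isCore.card_eq
  obtain ⟨e₀, he₀⟩ := hZ.isCore.exists_edge_deg_le hex
  obtain ⟨t, ht⟩ := hZ.isCore.nonempty
  obtain ⟨a, b, c, hab, hac, hbc, rfl⟩ := Finset.card_eq_three.1 (hZ3 t ht)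
  have h3 := hZ3 _ ht
  have htm := subset_cl hZ3 ht
  have hcx := isCx_cl hZ3
  obtain ⟨x, hx, φ, hφ, hsum⟩ := exists_winding_le (L := (cl Z).erase {a, b, c}) e₀ he₀
    (fun T hT hne hTZ => hZ.exists_free he₀ hT hne hTZ)
    (fun s hs hc => mem_of_mem_cl hZ3 (Finset.mem_of_mem_erase hs) hc) ht
    (Finset.notMem_erase _ _) (hcx.erase_of_card h3) (hZ.isConn.erase_triangle h3)
    (by rw [chi_erase_triangle htm h3, hchi]; rfl) (orientedBoundary a b c)
    (orientedBoundary_swap a b c)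
    (fun u v huv => by
      have hle := abs_orientedBoundary_le (u := u) (v := v) hab hac hbc
      rw [if_neg, abs_nonpos_iff] at hle
      · exact hle
      · intro hs
        refine huv (Finset.mem_erase.2 ⟨fun e => ?_, hcx.down _ htm _ hs (by simp)⟩)
        have := Finset.card_le_two (a := u) (b := v)
        rw [e] at this
        omega)
    (fun u v huv => by
      rw [cl_erase_filter hZ3]
      have h1 := abs_orientedBoundary_le (u := u) (v := v) hab hac hbc
      have h2 := deg_erase (e := {u, v}) ht
      rw [← h2]
      push_cast
      linarith)
  have hmem : ∀ u ∈ ({a, b, c} : Finset α), ∀ v ∈ ({a, b, c} : Finset α),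
      {u, v} ∈ (cl Z).erase {a, b, c} := by
    intro u hu v hv
    refine Finset.mem_erase.2 ⟨fun e => ?_, hcx.edge_mem htm hu hv⟩
    have := Finset.card_le_two (a := u) (b := v)
    rw [e] at this
    omega
  have hsw : ∀ u ∈ ({a, b, c} : Finset α), ∀ v ∈ ({a, b, c} : Finset α),
      Multiplicative.toAdd (φ u v) = -Multiplicative.toAdd (φ v u) := by
    intro u hu v hv
    have := congrArg Multiplicative.toAdd
      (hφ.cocycle.mul_swap (hcx.erase_of_card h3) (hmem u hu v hv))
    rw [toAdd_mul, toAdd_one] at this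
    linarith
  obtain ⟨n, hn'⟩ : ∃ n : ℤ, φ a b * φ b c * φ c a = Multiplicative.ofAdd n := ⟨_, rfl⟩
  have hn : Multiplicative.toAdd (φ a b * φ b c * φ c a) = n := by rw [hn', toAdd_ofAdd]
  have hn2 : |2 * n| ≤ 4 := by
    rw [sum_orientedBoundary a b c fun u v => Multiplicative.toAdd (φ u v)] at hsum
    convert hsum using 2
    rw [← hn, toAdd_mul, toAdd_mul, hsw b (by simp) a (by simp), hsw c (by simp) b (by simp),
      hsw a (by simp) c (by simp)]
    ring
  have hn0 : n ≠ 0 := by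
    intro h0
    exact hNR _ ht (removable_of_isUniv hcx h3 htm hφ (by rw [hn', h0]; rfl))
  let q : Multiplicative ℤ →* Multiplicative (ZMod 2) :=
    AddMonoidHom.toMultiplicative (Int.castAddHom (ZMod 2))
  have hqn : q (φ a b * φ b c * φ c a) = 1 := by
    have h := holonomy_eq_one (φ := fun u v => q (φ u v)) hZ3 hev h3 ht (hφ.cocycle.map q)
    rw [map_mul, map_mul]
    exact h
  have hev2 : (2 : ℤ) ∣ n := by
    rw [hn'] at hqn
    have : ((n : ℤ) : ZMod 2) = 0 := congrArg Multiplicative.toAdd hqn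
    exact_mod_cast (ZMod.intCast_zmod_eq_zero_iff_dvd n 2).1 this
  have hn3 : n = 2 ∨ n = -2 := by
    obtain ⟨k, hk⟩ := hev2
    rw [abs_le] at hn2
    omega
  refine ⟨x, Finset.mem_of_mem_erase hx, _, hφ.attach hcx h3 htm q ?_ hqn ?_⟩
  · intro y
    obtain ⟨m, hm⟩ := ZMod.intCast_surjective (Multiplicative.toAdd y)
    exact ⟨Multiplicative.ofAdd m, congrArg Multiplicative.ofAdd hm⟩
  · intro H _ f hf
    have h2 : f (Multiplicative.ofAdd 1) * f (Multiplicative.ofAdd 1) = 1 := by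
      rw [← map_mul, ← ofAdd_add]
      rcases hn3 with h | h
      · rw [hn', h] at hf
        exact hf
      · rw [hn', h] at hf
        have := congrArg Inv.inv hf
        rw [← map_inv, inv_one] at this
        exact this
    refine ⟨involHom _ h2, MonoidHom.ext_mint ?_⟩
    have : q (Multiplicative.ofAdd 1) = Multiplicative.ofAdd 1 := by
      simp [q]
    rw [MonoidHom.comp_apply, this, involHom_ofAdd_one]

end MinimalCore

section Split

set_option linter.unusedSectionVars false

variable {α : Type} [DecidableEq α] {K L A B T Z : Finset (Finset α)}

/-- `A` is a component of the complement of `Z` in `T`. -/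
structure IsSplit (T Z A : Finset (Finset α)) : Prop where
  subset : A ⊆ T \ Z
  nonempty : A.Nonempty
  conn_left : IsConn (cl A)
  conn_right : IsConn (cl (T \ A))
  inter_subset : cl A ∩ cl (T \ A) ⊆ cl Z
  exists_vertex : ∃ v, {v} ∈ cl A ∩ cl (T \ A)
  mem_of_subset : ∀ e ∈ edges A, ∀ t ∈ T \ Z, e ⊆ t → t ∈ A

lemma mem_cl_singleton {v : α} : {v} ∈ cl T ↔ ∃ t ∈ T, v ∈ t := by
  simp [mem_cl]

lemma mem_cl_pair {u v : α} : {u, v} ∈ cl T ↔ ∃ t ∈ T, u ∈ t ∧ v ∈ t := by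
  simp [mem_cl, Finset.insert_subset_iff]

lemma exists_isSplit (hT : ∀ t ∈ T, t.card = 3) (hconn : IsConn (cl T)) (hZT : Z ⊆ T)
    (hne : Z ≠ T) (hZ : IsConn (cl Z)) : ∃ A, IsSplit T Z A := by
  have hD : ∀ t ∈ T \ Z, t.card = 3 := fun t ht => hT t (Finset.mem_sdiff.1 ht).1
  have hcx := isCx_cl hD
  obtain ⟨t₀, ht₀⟩ : (T \ Z).Nonempty := by
    rw [Finset.sdiff_nonempty]
    exact fun h => hne (hZT.antisymm h)
  obtain ⟨v, hv⟩ := Finset.card_pos.1 (by rw [hD t₀ ht₀]; norm_num : 0 < t₀.card)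
  have hvD : {v} ∈ cl (T \ Z) := mem_cl_singleton.2 ⟨t₀, ht₀, hv⟩
  obtain ⟨A, hA⟩ : ∃ A, A = (T \ Z).filter (· ∈ comp (cl (T \ Z)) v) := ⟨_, rfl⟩
  have hcA : cl A = comp (cl (T \ Z)) v := by rw [hA, cl_filter_comp hD]
  have hAD : A ⊆ T \ Z := by rw [hA]; exact Finset.filter_subset _ _
  have hmem : ∀ t ∈ T \ Z, ∀ u ∈ t, {u} ∈ cl A → t ∈ A := by
    intro t ht u hu hm
    rw [hcA, mem_comp] at hm
    rw [hA, Finset.mem_filter]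
    exact ⟨ht, hcx.mem_comp_of_reach (subset_cl hD ht) hu (hm.2 u (by simp))⟩
  have hinter : cl A ∩ cl (T \ A) ⊆ cl Z := by
    intro σ hσ
    rw [Finset.mem_inter, mem_cl, mem_cl] at hσ
    obtain ⟨⟨hne, t, ht, hst⟩, -, s, hs, hss⟩ := hσ
    rw [Finset.mem_sdiff] at hs
    by_cases hsZ : s ∈ Z
    · exact mem_cl.2 ⟨hne, s, hsZ, hss⟩
    · obtain ⟨u, hu⟩ := hne
      exact absurd (hmem s (Finset.mem_sdiff.2 ⟨hs.1, hsZ⟩) u (hss hu)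
        (mem_cl_singleton.2 ⟨t, ht, hst hu⟩)) hs.2
  have hZB : Z ⊆ T \ A := fun z hz => Finset.mem_sdiff.2
    ⟨hZT hz, fun h => (Finset.mem_sdiff.1 (hAD h)).2 hz⟩
  have hcase : ∀ t ∈ T, t ∈ A ∨ t ∈ T \ A := fun t ht => by
    rw [Finset.mem_sdiff]
    tauto
  obtain ⟨⟨z, hz⟩, hZc⟩ := hZ
  have hzT : {z} ∈ cl T := cl_mono hZT hz
  have hzB : {z} ∈ cl (T \ A) := cl_mono hZB hz
  have hreach : ∀ u, Reach (cl T) u z → {u} ∈ cl (T \ A) →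
      ∃ z', {z'} ∈ cl Z ∧ Reach (cl (T \ A)) u z' := by
    intro u hu
    induction hu using Relation.ReflTransGen.head_induction_on with
    | refl => exact fun _ => ⟨z, hz, Relation.ReflTransGen.refl⟩
    | @head u w he _ ih =>
      intro hm
      obtain ⟨t, ht, hut, hwt⟩ := mem_cl_pair.1 he
      rcases hcase t ht with h | h
      · exact ⟨u, hinter (Finset.mem_inter.2 ⟨mem_cl_singleton.2 ⟨t, h, hut⟩, hm⟩),
          Relation.ReflTransGen.refl⟩
      · obtain ⟨z', hz', hr⟩ := ih (mem_cl_singleton.2 ⟨t, h, hwt⟩)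
        exact ⟨z', hz', (Reach.edge (mem_cl_pair.2 ⟨t, h, hut, hwt⟩)).trans hr⟩
  have hreach' : ∀ u, Reach (cl T) u z → {u} ∈ cl A → ∃ w, {w} ∈ cl A ∩ cl (T \ A) := by
    intro u hu
    induction hu using Relation.ReflTransGen.head_induction_on with
    | refl => exact fun h => ⟨z, Finset.mem_inter.2 ⟨h, hzB⟩⟩
    | @head u w he _ ih =>
      intro hm
      obtain ⟨t, ht, hut, hwt⟩ := mem_cl_pair.1 he
      rcases hcase t ht with h | h
      · exact ih (mem_cl_singleton.2 ⟨t, h, hwt⟩)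
      · exact ⟨u, Finset.mem_inter.2 ⟨hm, mem_cl_singleton.2 ⟨t, h, hut⟩⟩⟩
  have hvA : {v} ∈ cl A := by
    rw [hcA]
    exact hcx.mem_comp_of_reach hvD (by simp) Relation.ReflTransGen.refl
  refine ⟨A, hAD, ?_, ?_, ⟨⟨z, hzB⟩, ?_⟩, hinter,
    hreach' v (hconn.2 _ _ (cl_mono (hAD.trans Finset.sdiff_subset) hvA) hzT) hvA, ?_⟩
  · obtain ⟨t, ht, -⟩ := mem_cl_singleton.1 hvA
    exact ⟨t, ht⟩
  · rw [hcA]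
    exact hcx.isConn_comp hvD
  · have hB : ∀ u, {u} ∈ cl (T \ A) → Reach (cl (T \ A)) u z := by
      intro u hu
      obtain ⟨z', hz', hr⟩ := hreach u (hconn.2 _ _ (cl_mono Finset.sdiff_subset hu) hzT) hu
      exact hr.trans ((hZc _ _ hz' hz).mono (cl_mono hZB))
    exact fun x y hx hy => (hB x hx).trans (hB y hy).symm
  · intro e he t ht het
    obtain ⟨hc, s, hs, hes⟩ := mem_edges.1 he
    obtain ⟨u, hu⟩ := Finset.card_pos.1 (by rw [hc]; norm_num : 0 < e.card)
    exact hmem t ht u (het hu) (mem_cl_singleton.2 ⟨s, hs, hes hu⟩)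

lemma IsSplit.subset_left (h : IsSplit T Z A) : A ⊆ T := h.subset.trans Finset.sdiff_subset

lemma IsSplit.subset_sdiff (h : IsSplit T Z A) (hZT : Z ⊆ T) : Z ⊆ T \ A := fun _ hz =>
  Finset.mem_sdiff.2 ⟨hZT hz, fun hm => (Finset.mem_sdiff.1 (h.subset hm)).2 hz⟩

lemma IsSplit.cl_union (h : IsSplit T Z A) : cl A ∪ cl (T \ A) = cl T := by
  rw [← _root_.cl_union, Finset.union_sdiff_of_subset h.subset_left]

lemma IsSplit.chi_inter (h : IsSplit T Z A) :
    chi (cl T) + chi (cl A ∩ cl (T \ A)) = chi (cl A) + chi (cl (T \ A)) := by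
  rw [← h.cl_union, chi_union_inter]

lemma IsSplit.card_ne_three (h : IsSplit T Z A) (hT : ∀ t ∈ T, t.card = 3) :
    ∀ σ ∈ cl A ∩ cl (T \ A), σ.card ≠ 3 := by
  intro σ hσ hc
  rw [Finset.mem_inter] at hσ
  have h1 := mem_of_mem_cl (fun t ht => hT t (h.subset_left ht)) hσ.1 hc
  have h2 := mem_of_mem_cl (fun t ht => hT t (Finset.sdiff_subset ht)) hσ.2 hc
  exact (Finset.mem_sdiff.1 h2).2 h1

lemma isCx_inter (hA : IsCx A) (hB : IsCx B) : IsCx (A ∩ B) := by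
  refine ⟨fun σ h => hA.nonempty σ (Finset.mem_inter.1 h).1,
    fun σ h => hA.card_le σ (Finset.mem_inter.1 h).1, fun σ h τ hτ hne => ?_⟩
  rw [Finset.mem_inter] at h ⊢
  exact ⟨hA.down σ h.1 τ hτ hne, hB.down σ h.2 τ hτ hne⟩

lemma chi_eq_card_sub_card (hK : IsCx K) (h3 : ∀ σ ∈ K, σ.card ≠ 3) :
    chi K = ((K.filter (·.card = 1)).card : ℤ) - (K.filter (·.card = 2)).card := by
  rw [chi, Finset.card_filter, Finset.card_filter]
  push_cast
  rw [← Finset.sum_sub_distrib]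
  refine Finset.sum_congr rfl fun σ hσ => ?_
  have h1 := hK.card_le σ hσ
  have h2 := (hK.nonempty σ hσ).card_pos
  have h4 := h3 σ hσ
  obtain h | h : σ.card = 1 ∨ σ.card = 2 := by omega
  all_goals rw [h]; norm_num

/-- A nonempty graph with at most two edges has positive Euler characteristic. -/
lemma three_le_card_edges (hK : IsCx K) (h3 : ∀ σ ∈ K, σ.card ≠ 3) (hv : ∃ v, {v} ∈ K)
    (hchi : chi K ≤ 0) : 3 ≤ (K.filter (·.card = 2)).card := by
  have hE := chi_eq_card_sub_card hK h3
  have hV : ∀ W : Finset α, (∀ v ∈ W, {v} ∈ K) → W.card ≤ (K.filter (·.card = 1)).card := by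
    intro W hW
    rw [← Finset.card_image_of_injective W Finset.singleton_injective]
    refine Finset.card_le_card fun σ hσ => ?_
    obtain ⟨v, hv, rfl⟩ := Finset.mem_image.1 hσ
    exact Finset.mem_filter.2 ⟨hW v hv, by simp⟩
  obtain ⟨v, hv⟩ := hv
  have h1 := hV {v} (by simpa using hv)
  rw [Finset.card_singleton] at h1
  by_contra hlt
  obtain ⟨e, he⟩ : (K.filter (·.card = 2)).Nonempty := by
    rw [← Finset.card_pos]
    omega
  rw [Finset.mem_filter] at he
  have h2 := hV e fun v hv => hK.vertex_mem he.1 hv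
  rw [he.2] at h2
  obtain ⟨f, hf, hne⟩ := Finset.exists_mem_ne (s := K.filter (·.card = 2)) (by omega) e
  rw [Finset.mem_filter] at hf
  have h5 := hV (e ∪ f) fun v hv => by
    rcases Finset.mem_union.1 hv with h | h
    · exact hK.vertex_mem he.1 h
    · exact hK.vertex_mem hf.1 h
  have h6 : 3 ≤ (e ∪ f).card := by
    by_contra hlt
    have h7 := Finset.eq_of_subset_of_card_le (Finset.subset_union_left (s₁ := e) (s₂ := f))
      (by omega)
    have h8 := Finset.eq_of_subset_of_card_le (Finset.subset_union_right (s₁ := e) (s₂ := f))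
      (by omega)
    exact hne (h8.trans h7.symm)
  omega

/-- A core of Euler characteristic at least two branches along three edges of each proper
connected subcore, provided the connected cores strictly inside it have small Euler
characteristic. -/
lemma IsCore.exists_branching (hT : IsCore T) (hconn : IsConn (cl T))
    (hsmall : ∀ S ⊆ T, S ≠ T → IsCore S → IsConn (cl S) → chi (cl S) ≤ 1)
    (hchi : 2 ≤ chi (cl T)) (hZ : IsCore Z) (hZc : IsConn (cl Z)) (hZT : Z ⊆ T) (hne : Z ≠ T) :
    ∃ E : Finset (Finset α), 3 ≤ E.card ∧ ∀ e ∈ E, e ∈ edges Z ∧ 3 ≤ deg T e := by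
  obtain ⟨A, hA⟩ := exists_isSplit hT.card_eq hconn hZT hne hZc
  have hcx : ∀ S ⊆ T, IsCx (cl S) := fun S hS => isCx_cl fun t ht => hT.card_eq t (hS ht)
  have key : ∀ S ⊆ T, S ≠ T → IsConn (cl S) → chi (cl S) ≤ 1 := by
    intro S hS hne hc
    refine chi_le_one (hcx S hS) hc fun R hR h1 h2 => ?_
    have hRS : R ⊆ S := fun t ht => mem_of_mem_cl (fun t ht => hT.card_eq t (hS ht))
      (hR ht) (h1.card_eq t ht)
    refine hsmall R (hRS.trans hS) ?_ h1 h2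
    rintro rfl
    exact hne (hS.antisymm hRS)
  have hAT := hA.subset_left
  obtain ⟨z, hz⟩ := hZ.nonempty
  obtain ⟨a, ha⟩ := hA.nonempty
  have h1 := key A hAT (by
    rintro rfl
    exact (Finset.mem_sdiff.1 (hA.subset (hZT hz))).2 hz) hA.conn_left
  have h2 := key (T \ A) Finset.sdiff_subset (fun h => by
    rw [← h] at hAT
    exact (Finset.mem_sdiff.1 (hAT ha)).2 ha) hA.conn_right
  have h3 := hA.chi_inter
  refine ⟨_, three_le_card_edges (isCx_inter (hcx A hAT) (hcx _ Finset.sdiff_subset))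
    (hA.card_ne_three hT.card_eq) hA.exists_vertex (by omega), fun e he => ?_⟩
  rw [Finset.mem_filter] at he
  have he1 : e ∈ edges Z := Finset.mem_filter.2 ⟨hA.inter_subset he.1, he.2⟩
  refine ⟨he1, ?_⟩
  have h4 := hZ.two_le_deg e he1
  have h5 : 0 < deg A e := by
    obtain ⟨-, h⟩ := mem_cl.1 (Finset.mem_inter.1 he.1).1
    exact deg_pos_iff.2 h
  have h6 := deg_mono (e := e) (hA.subset_sdiff hZT)
  have h7 := deg_sdiff (e := e) hAT
  omega

end Split

section CoreCharacteristic

set_option linter.unusedSectionVars false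

variable {α : Type} [DecidableEq α] {K L A B T Z Z' : Finset (Finset α)}

lemma isConn_cl_union (hA : IsConn (cl A)) (hB : IsConn (cl B)) {v : α} (hvA : {v} ∈ cl A)
    (hvB : {v} ∈ cl B) : IsConn (cl (A ∪ B)) := by
  have hsA : cl A ⊆ cl (A ∪ B) := cl_mono Finset.subset_union_left
  have hsB : cl B ⊆ cl (A ∪ B) := cl_mono Finset.subset_union_right
  have h : ∀ x, {x} ∈ cl (A ∪ B) → Reach (cl (A ∪ B)) x v := by
    intro x hx
    rw [cl_union, Finset.mem_union] at hx
    rcases hx with hx | hx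
    · exact (hA.2 x v hx hvA).mono hsA
    · exact (hB.2 x v hx hvB).mono hsB
  exact ⟨⟨v, hsA hvA⟩, fun x y hx hy => (h x hx).trans (h y hy).symm⟩

lemma isConn_cl_union_of_mem (hA : IsConn (cl A)) (hB : IsConn (cl B)) {t : Finset α}
    (ht : t.card = 3) (htA : t ∈ A) (htB : t ∈ B) : IsConn (cl (A ∪ B)) := by
  obtain ⟨v, hv⟩ := Finset.card_pos.1 (by rw [ht]; norm_num : 0 < t.card)
  exact isConn_cl_union hA hB (mem_cl_singleton.2 ⟨t, htA, hv⟩) (mem_cl_singleton.2 ⟨t, htB, hv⟩)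

lemma subset_erase_of_subset_cl_erase {S : Finset (Finset α)} {t : Finset α}
    (hT : ∀ t ∈ T, t.card = 3) (hS : ∀ s ∈ S, s.card = 3) (h : S ⊆ (cl T).erase t) :
    S ⊆ T.erase t := by
  intro s hs
  have h' := Finset.mem_erase.1 (h hs)
  exact Finset.mem_erase.2 ⟨h'.1, mem_of_mem_cl hT h'.2 (hS s hs)⟩

lemma removable_of_hasUniv_unit (hT : ∀ t ∈ T, t.card = 3) {t : Finset α} (ht : t ∈ T)
    (h : HasUniv ((cl T).erase t) Unit) : Removable (cl T) t := by
  obtain ⟨a, b, c, -, -, -, rfl⟩ := Finset.card_eq_three.1 (hT t ht)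
  obtain ⟨x, -, φ, h⟩ := h
  exact removable_of_isUniv (isCx_cl hT) (hT _ ht) (subset_cl hT ht) h rfl

lemma removable_of_even_core (hT : ∀ t ∈ T, t.card = 3) (hZT : Z ⊆ T)
    (hev : ∀ e, e.card = 2 → Even (deg Z e)) {t : Finset α} (ht : t ∈ Z)
    (h : HasUniv ((cl T).erase t) (Multiplicative (ZMod 2))) : Removable (cl T) t := by
  have hZ : ∀ t ∈ Z, t.card = 3 := fun t ht => hT t (hZT ht)
  obtain ⟨a, b, c, -, -, -, rfl⟩ := Finset.card_eq_three.1 (hZ t ht)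
  obtain ⟨x, -, φ, h⟩ := h
  exact removable_of_isUniv (isCx_cl hT) (hZ _ ht) (subset_cl hT (hZT ht)) h
    (holonomy_eq_one hZ hev (hZ _ ht) ht
      (h.cocycle.mono (Finset.erase_subset_erase _ (cl_mono hZT))))

/-- In an induction on connected cores, two disjoint connected subcores force too much
branching. -/
lemma IsCore.six_le_excess (hT : IsCore T) (hconn : IsConn (cl T))
    (hsmall : ∀ S ⊆ T, S ≠ T → IsCore S → IsConn (cl S) → chi (cl S) ≤ 1)
    (hchi : 2 ≤ chi (cl T)) (hZ : IsCore Z) (hZc : IsConn (cl Z)) (hZT : Z ⊆ T) (hne : Z ≠ T)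
    (hZ' : IsCore Z') (hZc' : IsConn (cl Z')) (hZT' : Z' ⊆ T) (hne' : Z' ≠ T)
    (hdisj : Disjoint Z Z') : 6 ≤ excess (cl T) := by
  obtain ⟨E, hE, hEd⟩ := hT.exists_branching hconn hsmall hchi hZ hZc hZT hne
  obtain ⟨E', hE', hEd'⟩ := hT.exists_branching hconn hsmall hchi hZ' hZc' hZT' hne'
  have hsub : E ⊆ edges T := fun e he => by
    have := hEd e he
    exact mem_edges_of_pos (mem_edges.1 this.1).1 (by omega)
  have hsub' : E' ⊆ edges T := fun e he => by
    have := hEd' e he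
    exact mem_edges_of_pos (mem_edges.1 this.1).1 (by omega)
  have hle : ∑ e ∈ edges T, ((if e ∈ E then 1 else 0) + if e ∈ E' then 1 else 0 : ℤ) ≤
      excess (cl T) := by
    rw [excess_cl hT.card_eq]
    refine Finset.sum_le_sum fun e he => ?_
    have h2 := hT.two_le_deg e he
    split_ifs with h h' h'
    · have h3 := hZ.two_le_deg e (hEd e h).1
      have h4 := hZ'.two_le_deg e (hEd' e h').1
      have h5 := deg_mono (e := e) (Finset.union_subset hZT hZT')
      rw [deg_union hdisj] at h5
      omega
    · have := (hEd e h).2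
      omega
    · have := (hEd' e h').2
      omega
    · omega
  rw [Finset.sum_add_distrib, Finset.sum_ite_mem, Finset.sum_ite_mem,
    Finset.inter_eq_right.2 hsub, Finset.inter_eq_right.2 hsub'] at hle
  simp only [Finset.sum_const, mul_one, nsmul_eq_mul] at hle
  omega

/-- In a sparse complex without superfluous triangles every connected core has Euler
characteristic one. -/
theorem IsCore.chi_eq_one [Fintype α] (hK : IsSparse K)
    (hNR : ∀ t ∈ K, t.card = 3 → ¬ Removable K t) (hT : IsCore T) (hconn : IsConn (cl T))
    (hTK : cl T ⊆ K) : chi (cl T) = 1 := by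
  induction hn : T.card using Nat.strong_induction_on generalizing T with
  | _ n ih =>
  subst hn
  replace ih : ∀ S ⊆ T, S ≠ T → IsCore S → IsConn (cl S) → chi (cl S) = 1 :=
    fun S hS hne h1 h2 => ih _ (Finset.card_lt_card (hS.ssubset_of_ne hne)) h1 h2
      ((cl_mono hS).trans hTK) rfl
  have hT3 := hT.card_eq
  have hcx := isCx_cl hT3
  have hcxe : ∀ t ∈ T, IsCx ((cl T).erase t) := fun t ht => hcx.erase_of_card (hT3 t ht)
  have hce : ∀ t ∈ T, IsConn ((cl T).erase t) := fun t ht => hconn.erase_triangle (hT3 t ht)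
  have hNR' : ∀ S ⊆ T, ∀ t ∈ S, ¬ Removable (cl S) t := fun S hS t ht hr => by
    have h3 := hT3 t (hS ht)
    have hm : t ∈ cl S := subset_cl (fun t ht => hT3 t (hS ht)) ht
    exact hNR t (hTK (cl_mono hS hm)) h3 (hr.mono ((cl_mono hS).trans hTK) hm)
  have hone := hT.one_le_chi hK hTK
  by_contra hne1
  have hlt : 2 ≤ chi (cl T) := by omega
  have hchie : ∀ t ∈ T, chi ((cl T).erase t) = chi (cl T) - 1 := fun t ht =>
    chi_erase_triangle (subset_cl hT3 ht) (hT3 t ht)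
  have htwo : chi (cl T) = 2 := by
    obtain ⟨t, ht⟩ := hT.nonempty
    have h1 := chi_le_one (hcxe t ht) (hce t ht) fun S hS h1 h2 => by
      have hS' := subset_erase_of_subset_cl_erase hT3 h1.card_eq hS
      refine (ih S (hS'.trans (Finset.erase_subset _ _)) ?_ h1 h2).le
      rintro rfl
      exact (Finset.mem_erase.1 (hS' ht)).1 rfl
    have h2 := hchie t ht
    omega
  have hex : excess (cl T) ≤ 5 := by
    have h1 := three_mul_chi hcx
    have h2 := hT.slack_pos hK hTK
    omega
  obtain ⟨Z, hZT, hZ⟩ := hT.exists_isMinCore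
  obtain ⟨t, ht⟩ := hZ.isCore.nonempty
  obtain ⟨Z', hZT', hZ', htZ'⟩ : ∃ Z' ⊆ T, IsMinCore Z' ∧ t ∉ Z' := by
    by_contra hno
    refine hNR' T subset_rfl t (hZT ht) (removable_of_hasUniv_unit hT3 (hZT ht)
      (hasUniv_unit (hcxe t (hZT ht)) (hce t (hZT ht)) (fun S hS hcore => hno ?_)
        (by rw [hchie t (hZT ht), htwo]; rfl)))
    have hS' := subset_erase_of_subset_cl_erase hT3 hcore.card_eq hS
    obtain ⟨Z', h1, h2⟩ := hcore.exists_isMinCore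
    exact ⟨Z', h1.trans (hS'.trans (Finset.erase_subset _ _)), h2, fun hm =>
      (Finset.mem_erase.1 (hS' (h1 hm))).1 rfl⟩
  have hZne : Z ≠ T := by
    rintro rfl
    exact htZ' (by rwa [hZ.eq_of_subset _ hZT' hZ'.isCore])
  have hZne' : Z' ≠ T := by
    rintro rfl
    exact htZ' (hZT ht)
  have heven : ∀ S ⊆ T, S ≠ T → IsCore S → IsConn (cl S) → ∀ e, e.card = 2 → Even (deg S e) :=
    fun S hS hne h1 h2 => h1.even_of_excess_le
      (h1.excess_le_two hK ((cl_mono hS).trans hTK) (ih S hS hne h1 h2))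
  have hev := heven Z hZT hZne hZ.isCore hZ.isConn
  have hev' := heven Z' hZT' hZne' hZ'.isCore hZ'.isConn
  obtain ⟨t', ht', htZ⟩ : ∃ t' ∈ Z', t' ∉ Z := by
    by_contra hno
    push Not at hno
    exact htZ' (by rwa [hZ.eq_of_subset Z' hno hZ'.isCore])
  by_cases hdisj : Disjoint Z Z'
  · have := hT.six_le_excess hconn (fun S hS hne h1 h2 => (ih S hS hne h1 h2).le) hlt
      hZ.isCore hZ.isConn hZT hZne hZ'.isCore hZ'.isConn hZT' hZne' hdisj
    omega
  obtain ⟨s, hsZ, hsZ'⟩ := Finset.not_disjoint_iff.1 hdisj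
  have hunion : ∀ M ⊆ T, IsCore M → IsConn (cl M) → Z ∪ M ≠ T → (∃ s ∈ Z, s ∈ M) →
      (Z ∪ M) \ Z ⊆ Z' → Z ∪ M = Z ∨ (Z ∪ M) \ Z = Z' := by
    rintro M hM hMc hMconn hne ⟨s, hs, hs'⟩ hsub
    by_cases h : Z = Z ∪ M
    · exact Or.inl h.symm
    have hcore := hZ.isCore.union hMc
    refine Or.inr (hZ'.eq_of_subset _ hsub (isCore_sdiff Finset.subset_union_left h hcore.card_eq
      hev (heven _ (Finset.union_subset hZT hM) hne hcore ?_)))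
    exact isConn_cl_union_of_mem hZ.isConn hMconn (hZ.isCore.card_eq s hs) hs hs'
  by_cases hM : Z ∪ Z' = T
  · have hTZ : T \ Z ⊆ Z' := by
      rw [← hM]
      grind
    refine hNR' T subset_rfl t' (hZT' ht') (removable_of_even_core hT3 hZT' hev' ht'
      (HasUniv.of_unique_core hZ.isCore (ih Z hZT hZne hZ.isCore hZ.isConn)
        (hZ.hasUniv hK ((cl_mono hZT).trans hTK) (ih Z hZT hZne hZ.isCore hZ.isConn)
          (hNR' Z hZT)) (hcxe t' (hZT' ht')) (hce t' (hZT' ht')) ?_ ?_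
        (by rw [hchie t' (hZT' ht'), htwo]; rfl)))
    · intro z hz
      refine Finset.mem_erase.2 ⟨?_, subset_cl hT3 (hZT hz)⟩
      rintro rfl
      exact htZ hz
    · intro M hML hMc hMconn
      have hMT := subset_erase_of_subset_cl_erase hT3 hMc.card_eq hML
      have hMT' := hMT.trans (Finset.erase_subset _ _)
      have htM : t' ∉ M := fun h => (Finset.mem_erase.1 (hMT h)).1 rfl
      have htU : t' ∉ Z ∪ M := fun h => (Finset.mem_union.1 h).elim htZ htM
      by_cases hd : ∃ s ∈ Z, s ∈ M
      · rcases hunion M hMT' hMc hMconn (fun h => htU (by rw [h]; exact hZT' ht')) hd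
          ((Finset.sdiff_subset_sdiff (Finset.union_subset hZT hMT') subset_rfl).trans hTZ)
          with h | h
        · exact hZ.eq_of_subset M (by rw [← h]; exact Finset.subset_union_right) hMc
        · exact absurd (Finset.sdiff_subset (h ▸ ht')) htU
      · push Not at hd
        have := hZ'.eq_of_subset M (fun m hm => hTZ (Finset.mem_sdiff.2
          ⟨hMT' hm, fun hz => hd m hz hm⟩)) hMc
        exact absurd (this ▸ ht') htM
  · rcases hunion Z' hZT' hZ'.isCore hZ'.isConn hM ⟨s, hsZ, hsZ'⟩ (by grind) with h | h
    · exact htZ (by rw [← h]; exact Finset.mem_union_right _ ht')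
    · rw [← h] at hsZ'
      exact (Finset.mem_sdiff.1 hsZ').2 hsZ

end CoreCharacteristic

section Assembly

set_option linter.unusedSectionVars false

variable {α : Type} [DecidableEq α] {K L A B T Z W : Finset (Finset α)}
  {G G' : Type} [Group G] [Group G']

lemma IsSparse.mono (hK : IsSparse K) (h : L ⊆ K) : IsSparse L :=
  fun M hM => hK M (hM.trans h)

/-- A universal cocycle can be made trivial on a given edge. -/
lemma HasUniv.exists_trivial_at (h : HasUniv A G) (hA : IsCx A) (hconn : IsConn A) {x y : α}
    (hxy : {x, y} ∈ A) : ∃ φ : α → α → G, IsUniv A x G φ ∧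
      ∀ u v, (u = x ∨ u = y) → (v = x ∨ v = y) → φ u v = 1 := by
  have hx := hA.left_mem hxy
  have hy := hA.right_mem hxy
  obtain ⟨φ, hφ⟩ := h.exists_at hconn hx
  have hd : (fun v => if v = y then φ x y else 1) x = 1 := by
    by_cases h : x = y
    · subst h
      simp [hφ.cocycle.self hx]
    · simp [h]
  have h1 := hφ.gauge (fun v => if v = y then φ x y else 1) hd
  refine ⟨_, h1, ?_⟩
  have hxy1 : (fun u v => (if u = y then φ x y else 1) * φ u v * (if v = y then φ x y else 1)⁻¹)
      x y = 1 := by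
    beta_reduce at hd ⊢
    rw [hd, if_pos rfl, one_mul, mul_inv_cancel]
  rintro u v (rfl | rfl) (rfl | rfl)
  · exact h1.cocycle.self hx
  · exact hxy1
  · have h2 := h1.cocycle.mul_swap hA hxy
    beta_reduce at hxy1 h2
    rwa [hxy1, one_mul] at h2
  · exact h1.cocycle.self hy

/-- A nonempty tree with at most one edge. -/
lemma exists_pair_of_chi_eq_one (hW : IsCx W) (h3 : ∀ σ ∈ W, σ.card ≠ 3) (hchi : chi W = 1)
    (hE : (W.filter (·.card = 2)).card ≤ 1) :
    ∃ x y, {x, y} ∈ W ∧ ∀ u, {u} ∈ W → u = x ∨ u = y := by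
  have hc := chi_eq_card_sub_card hW h3
  obtain h0 | h1 : (W.filter (·.card = 2)).card = 0 ∨ (W.filter (·.card = 2)).card = 1 := by omega
  · obtain ⟨σ, hσ⟩ := Finset.card_eq_one.1 (by omega : (W.filter (·.card = 1)).card = 1)
    have hm : σ ∈ W.filter (·.card = 1) := by simp [hσ]
    rw [Finset.mem_filter] at hm
    obtain ⟨x, rfl⟩ := Finset.card_eq_one.1 hm.2
    refine ⟨x, x, by simpa using hm.1, fun u hu => ?_⟩
    have : {u} ∈ W.filter (·.card = 1) := Finset.mem_filter.2 ⟨hu, by simp⟩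
    rw [hσ, Finset.mem_singleton, Finset.singleton_inj] at this
    exact Or.inl this
  · obtain ⟨e, he⟩ := Finset.card_eq_one.1 h1
    have hm : e ∈ W.filter (·.card = 2) := by simp [he]
    rw [Finset.mem_filter] at hm
    obtain ⟨x, y, hxy, rfl⟩ := Finset.card_eq_two.1 hm.2
    refine ⟨x, y, hm.1, fun u hu => ?_⟩
    have hs : {{x}, {y}} ⊆ W.filter (·.card = 1) := by
      intro σ hσ
      rw [Finset.mem_insert, Finset.mem_singleton] at hσ
      rcases hσ with rfl | rfl
      · exact Finset.mem_filter.2 ⟨hW.left_mem hm.1, by simp⟩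
      · exact Finset.mem_filter.2 ⟨hW.right_mem hm.1, by simp⟩
    have heq := Finset.eq_of_subset_of_card_le hs
      (by rw [Finset.card_pair (by simpa using hxy)]; omega)
    have : {u} ∈ W.filter (·.card = 1) := Finset.mem_filter.2 ⟨hu, by simp⟩
    rw [← heq] at this
    simpa using this

lemma HasUniv.union (hA : IsCx A) (hB : IsCx B) (hcA : IsConn A) (hcB : IsConn B) {x y : α}
    (hxy : {x, y} ∈ A ∩ B) (h : ∀ u, {u} ∈ A ∩ B → u = x ∨ u = y) (hGA : HasUniv A G)
    (hGB : HasUniv B G') : HasUniv (A ∪ B) (Monoid.Coprod G G') := by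
  have hm := Finset.mem_inter.1 hxy
  have hcx := isCx_inter hA hB
  obtain ⟨φ, hφ, h1⟩ := hGA.exists_trivial_at hA hcA hm.1
  obtain ⟨φ', hφ', h1'⟩ := hGB.exists_trivial_at hB hcB hm.2
  refine ⟨x, Finset.mem_union_left _ (hA.left_mem hm.1), _,
    IsUniv.union hA hB (fun v hvA hvB => ?_) hφ hφ' (fun u v hm => ?_) fun u v hm => ?_⟩
  · rcases h v (Finset.mem_inter.2 ⟨hvA, hvB⟩) with rfl | rfl
    · exact Relation.ReflTransGen.refl
    · exact Reach.edge hxy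
  · exact h1 u v (h u (hcx.left_mem hm)) (h v (hcx.right_mem hm))
  · exact h1' u v (h u (hcx.left_mem hm)) (h v (hcx.right_mem hm))

/-- The edge path group of `K` is a free product of a free group and groups of order two. -/
def HasGoodUniv (K : Finset (Finset α)) : Prop :=
  ∃ (G : Type) (_ : Group G), IsGood G ∧ HasUniv K G

lemma IsCore.hasGoodUniv [Fintype α] (hT : IsCore T) (hconn : IsConn (cl T))
    (hK : IsSparse (cl T)) (ih : ∀ L, L ⊂ cl T → IsCx L → IsConn L → HasGoodUniv L) :
    HasGoodUniv (cl T) := by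
  have hT3 := hT.card_eq
  have hcx := isCx_cl hT3
  by_cases hR : ∃ t ∈ T, Removable (cl T) t
  · obtain ⟨t, ht, hr⟩ := hR
    have hm := subset_cl hT3 ht
    obtain ⟨G, _, hG, x, hx, φ, hφ⟩ := ih _ (Finset.erase_ssubset hm)
      (hcx.erase_of_card (hT3 t ht)) (hconn.erase_triangle (hT3 t ht))
    exact ⟨G, _, hG, x, Finset.mem_of_mem_erase hx, φ, hφ.of_removable (hT3 t ht) hr⟩
  have hNR : ∀ t ∈ cl T, t.card = 3 → ¬ Removable (cl T) t := fun t ht hc hr =>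
    hR ⟨t, mem_of_mem_cl hT3 ht hc, hr⟩
  have hchi : ∀ S ⊆ T, IsCore S → IsConn (cl S) → chi (cl S) = 1 := fun S hS h1 h2 =>
    h1.chi_eq_one hK hNR h2 (cl_mono hS)
  have heven : ∀ S ⊆ T, IsCore S → IsConn (cl S) → ∀ e, e.card = 2 → Even (deg S e) :=
    fun S hS h1 h2 => h1.even_of_excess_le (h1.excess_le_two hK (cl_mono hS) (hchi S hS h1 h2))
  have hevT := heven T subset_rfl hT hconn
  obtain ⟨Z, hZT, hZ⟩ := hT.exists_isMinCore
  by_cases hne : Z = T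
  · subst hne
    exact ⟨_, _, isGood_multiplicative_zmod_two, hZ.hasUniv hK subset_rfl
      (hchi Z subset_rfl hT hconn) fun t ht => hNR t (subset_cl hT3 ht) (hT3 t ht)⟩
  have hevZ := heven Z hZT hZ.isCore hZ.isConn
  obtain ⟨A, hA⟩ := exists_isSplit hT3 hconn hZT hne hZ.isConn
  have hAT := hA.subset_left
  have hevA : ∀ e, e.card = 2 → Even (deg A e) := by
    intro e hc
    by_cases he : e ∈ edges A
    · have h1 : deg A e = deg (T \ Z) e := by
        refine (deg_mono hA.subset).antisymm (Finset.card_le_card fun t ht => ?_)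
        rw [Finset.mem_filter] at ht ⊢
        exact ⟨hA.mem_of_subset e he t ht.1 ht.2, ht.2⟩
      have h2 := deg_sdiff (e := e) hZT
      have h3 := hevT e hc
      rw [← h2, Nat.even_add] at h3
      rw [h1]
      exact h3.2 (hevZ e hc)
    · have : deg A e = 0 := by
        by_contra h
        exact he (mem_edges_of_pos hc (by omega))
      rw [this]
      exact Even.zero
  obtain ⟨z, hz⟩ := hZ.isCore.nonempty
  have hAne : A ≠ T := by
    rintro rfl
    exact (Finset.mem_sdiff.1 (hA.subset (hZT hz))).2 hz
  have hAc : IsCore A := isCore_of_even hA.nonempty (fun t ht => hT3 t (hAT ht)) hevA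
  have hBc : IsCore (T \ A) := isCore_sdiff hAT hAne hT3 hevA hevT
  have hlt : ∀ S ⊆ T, S ≠ T → cl S ⊂ cl T := by
    refine fun S hS hne => (cl_mono hS).ssubset_of_ne fun h => hne (hS.antisymm fun t ht => ?_)
    exact mem_of_mem_cl (fun t ht => hT3 t (hS ht)) (by rw [h]; exact subset_cl hT3 ht) (hT3 t ht)
  have hBne : T \ A ≠ T := by
    obtain ⟨a, ha⟩ := hA.nonempty
    intro h
    rw [← h] at hAT
    exact (Finset.mem_sdiff.1 (hAT ha)).2 ha
  have hcxA := isCx_cl hAc.card_eq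
  have hcxB := isCx_cl hBc.card_eq
  obtain ⟨G, _, hG, hGA⟩ := ih _ (hlt A hAT hAne) hcxA hA.conn_left
  obtain ⟨G', _, hG', hGB⟩ := ih _ (hlt _ Finset.sdiff_subset hBne) hcxB hA.conn_right
  have hchi1 : chi (cl A ∩ cl (T \ A)) = 1 := by
    have h1 := hA.chi_inter
    rw [hchi T subset_rfl hT hconn, hchi A hAT hAc hA.conn_left,
      hchi _ Finset.sdiff_subset hBc hA.conn_right] at h1
    omega
  have hcard : ((cl A ∩ cl (T \ A)).filter (·.card = 2)).card ≤ 1 := by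
    have hex := hT.excess_le_two hK subset_rfl (hchi T subset_rfl hT hconn)
    rw [excess_cl hT3] at hex
    have hsub : (cl A ∩ cl (T \ A)).filter (·.card = 2) ⊆ edges T := by
      refine Finset.filter_subset_filter _ (Finset.inter_subset_left.trans (cl_mono hAT))
    have h1 := Finset.sum_le_sum_of_subset_of_nonneg (f := fun e => (deg T e : ℤ) - 2) hsub
      fun e he _ => hT.sub_two_nonneg he
    have h2 := Finset.card_nsmul_le_sum ((cl A ∩ cl (T \ A)).filter (·.card = 2))
      (fun e => (deg T e : ℤ) - 2) 2 fun e he => by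
        rw [Finset.mem_filter, Finset.mem_inter] at he
        have h3 := hAc.two_le_deg e (Finset.mem_filter.2 ⟨he.1.1, he.2⟩)
        have h4 := hBc.two_le_deg e (Finset.mem_filter.2 ⟨he.1.2, he.2⟩)
        have h5 := deg_sdiff (e := e) hAT
        omega
    rw [nsmul_eq_mul] at h2
    omega
  obtain ⟨x, y, hxy, h⟩ := exists_pair_of_chi_eq_one (isCx_inter hcxA hcxB)
    (hA.card_ne_three hT3) hchi1 hcard
  have := HasUniv.union hcxA hcxB hA.conn_left hA.conn_right hxy h hGA hGB
  rw [hA.cl_union] at this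
  exact ⟨_, _, hG.coprod hG', this⟩

/-- The edge path group of a connected sparse complex is a free product of a free group and
groups of order two. -/
theorem IsSparse.hasGoodUniv [Fintype α] (hK : IsSparse K) (hcx : IsCx K) (hconn : IsConn K) :
    HasGoodUniv K := by
  refine collapse_induction (P := fun L => IsSparse L → HasGoodUniv L) ?_ ?_ ?_ ?_ ?_ K hcx hconn hK
  · intro K a b c hcx hconn hf ih hK
    obtain ⟨G, _, hG, h⟩ := ih (hK.mono IsFreeEdge.erase_subset)
    exact ⟨G, _, hG, h.of_isFreeEdge hcx hf⟩
  · intro K a b hcx hconn hab he hmax hc ih hK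
    obtain ⟨G, _, hG, h⟩ := ih (hK.mono (Finset.erase_subset _ _))
    exact ⟨_, _, hG.coprod isGood_multiplicative_int, h.of_erase_edge hcx hab he hmax hc⟩
  · intro K A B a b hcx hconn hb ihA ihB hK
    obtain ⟨G, _, hG, hA⟩ := ihA (hK.mono hb.left_subset)
    obtain ⟨G', _, hG', hB⟩ := ihB (hK.mono hb.right_subset)
    exact ⟨_, _, hG.coprod hG', hA.of_isBridged hb hB⟩
  · exact fun x _ => ⟨Unit, _, IsGood.of_subsingleton, hasUniv_singleton x⟩
  · exact fun T hT hconn ih hK => hT.hasGoodUniv hconn hK fun L hL h1 h2 =>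
      ih L hL h1 h2 (hK.mono hL.subset)

end Assembly

section Nerve

open Set Path

set_option linter.unusedSectionVars false

variable {α : Type} [DecidableEq α] {B : Type} [TopologicalSpace B]

/-- `S` is an open cover of `B` whose nerve has 2-skeleton `K`, with path connected double
intersections, and whose members have no fundamental group. -/
structure IsGoodCover (K : Finset (Finset α)) (S : α → Set B) : Prop where
  isOpen : ∀ v, IsOpen (S v)
  cover : ∀ b, ∃ v, b ∈ S v
  mem_iff : ∀ u v w, {u, v, w} ∈ K ↔ (S u ∩ S v ∩ S w).Nonempty
  joined : ∀ u v, ∀ p ∈ S u ∩ S v, ∀ q ∈ S u ∩ S v, JoinedIn (S u ∩ S v) p q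
  homotopic : ∀ v p q (γ γ' : Path p q), range γ ⊆ S v → range γ' ⊆ S v → γ.Homotopic γ'

/-- A coherent choice of homotopy classes of paths from `b₀` to the points of the members of the
cover `S`. -/
structure IsTether (S : α → Set B) (b₀ : B) (T : ∀ v p, p ∈ S v → Homotopic.Quotient b₀ p) : Prop where
  trans : ∀ v p q (hp : p ∈ S v) (hq : q ∈ S v) (γ : Path p q), range γ ⊆ S v →
    (T v p hp).trans (.mk γ) = T v q hq

variable {K : Finset (Finset α)} {S : α → Set B} {b₀ : B}
  {T : ∀ v p, p ∈ S v → Homotopic.Quotient b₀ p}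

lemma IsGoodCover.inter_nonempty (hS : IsGoodCover K S) {u v : α} (h : {u, v} ∈ K) :
    (S u ∩ S v).Nonempty := by
  have := (hS.mem_iff u v v).1 (by simpa using h)
  exact this.mono inter_subset_left

lemma IsGoodCover.edge_mem (hS : IsGoodCover K S) {u v : α} (h : (S u ∩ S v).Nonempty) :
    {u, v} ∈ K := by
  have := (hS.mem_iff u v v).2 (by rwa [inter_assoc, inter_self])
  simpa using this

lemma IsGoodCover.vertex_mem (hS : IsGoodCover K S) {v : α} (h : (S v).Nonempty) :
    {v} ∈ K := by
  have := hS.edge_mem (u := v) (v := v) (by rwa [inter_self])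
  simpa using this

lemma IsGoodCover.exists_path (hS : IsGoodCover K S) {v : α} {p q : B} (hp : p ∈ S v)
    (hq : q ∈ S v) : ∃ γ : Path p q, range γ ⊆ S v := by
  have h := hS.joined v v p ⟨hp, hp⟩ q ⟨hq, hq⟩
  rw [inter_self] at h
  exact ⟨h.somePath, by rintro _ ⟨t, rfl⟩; exact h.somePath_mem t⟩

lemma IsGoodCover.exists_quotient (hS : IsGoodCover K S) {x v : α} (hx : b₀ ∈ S x)
    (h : Reach K x v) : ∃ b ∈ S v, Nonempty (Homotopic.Quotient b₀ b) := by
  induction h with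
  | refl => exact ⟨b₀, hx, ⟨.refl b₀⟩⟩
  | tail _ hm ih =>
    obtain ⟨b, hb, ⟨c⟩⟩ := ih
    obtain ⟨m, hm, hm'⟩ := hS.inter_nonempty hm
    obtain ⟨γ, -⟩ := hS.exists_path hb hm
    exact ⟨m, hm', ⟨c.trans (.mk γ)⟩⟩

lemma IsGoodCover.exists_isTether (hS : IsGoodCover K S) (hK : IsConn K) {x : α}
    (hx : b₀ ∈ S x) : ∃ T : ∀ v p, p ∈ S v → Homotopic.Quotient b₀ p,
      IsTether S b₀ T ∧ T x b₀ hx = .refl b₀ := by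
  have h1 : ∀ v, ∃ b, (S v).Nonempty → b ∈ S v ∧ Nonempty (Homotopic.Quotient b₀ b) := by
    intro v
    by_cases hv : (S v).Nonempty
    · obtain ⟨b, hb⟩ := hS.exists_quotient hx
        (hK.2 x v (hS.vertex_mem ⟨_, hx⟩) (hS.vertex_mem hv))
      exact ⟨b, fun _ => hb⟩
    · exact ⟨b₀, fun h => absurd h hv⟩
  choose b hb using h1
  let T₀ : ∀ v p, p ∈ S v → Homotopic.Quotient b₀ p := fun v p hp =>
    (hb v ⟨p, hp⟩).2.some.trans (.mk (hS.exists_path (hb v ⟨p, hp⟩).1 hp).choose)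
  have h₀ : IsTether S b₀ T₀ := by
    refine ⟨fun v p q hp hq γ hγ => ?_⟩
    simp only [T₀]
    rw [Homotopic.Quotient.trans_assoc, ← Homotopic.Quotient.mk_trans]
    congr 1
    rw [Homotopic.Quotient.eq]
    refine hS.homotopic v _ _ _ _ ?_ (hS.exists_path (hb v ⟨p, hp⟩).1 hq).choose_spec
    rw [Path.trans_range]
    exact union_subset (hS.exists_path (hb v ⟨p, hp⟩).1 hp).choose_spec hγ
  refine ⟨fun v p hp => (T₀ x b₀ hx).symm.trans (T₀ v p hp), ⟨fun v p q hp hq γ hγ => ?_⟩,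
    Homotopic.Quotient.symm_trans _⟩
  rw [Homotopic.Quotient.trans_assoc, h₀.trans v p q hp hq γ hγ]

lemma IsGoodCover.exists_cocycle (hS : IsGoodCover K S) (hT : IsTether S b₀ T) :
    ∃ ψ : α → α → FundamentalGroup B b₀,
      ∀ u v m (hu : m ∈ S u) (hv : m ∈ S v), ψ u v = (T v m hv).trans (T u m hu).symm := by
  classical
  refine ⟨fun u v => if h : (S u ∩ S v).Nonempty then
    (T v h.some h.some_mem.2).trans (T u h.some h.some_mem.1).symm else 1, ?_⟩
  intro u v m hu hv
  have h : (S u ∩ S v).Nonempty := ⟨m, hu, hv⟩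
  refine (dif_pos h).trans ?_
  obtain ⟨γ, hγ⟩ := hS.joined u v h.some h.some_mem m ⟨hu, hv⟩
  have hr : range γ ⊆ S u ∩ S v := by rintro _ ⟨t, rfl⟩; exact hγ t
  rw [← hT.trans v _ _ h.some_mem.2 hv γ (hr.trans inter_subset_right),
    ← hT.trans u _ _ h.some_mem.1 hu γ (hr.trans inter_subset_left)]
  generalize T v h.some h.some_mem.2 = a
  generalize T u h.some h.some_mem.1 = b
  generalize Homotopic.Quotient.mk γ = g
  induction a using Homotopic.Quotient.ind
  induction b using Homotopic.Quotient.ind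
  induction g using Homotopic.Quotient.ind
  rename_i a b g
  rw [← Homotopic.Quotient.mk_symm, ← Homotopic.Quotient.mk_trans, ← Homotopic.Quotient.mk_trans, ← Homotopic.Quotient.mk_trans,
    ← Homotopic.Quotient.mk_symm, ← Homotopic.Quotient.mk_trans, Path.trans_symm]
  simp only [Homotopic.Quotient.mk_trans, Homotopic.Quotient.mk_symm]
  rw [Homotopic.Quotient.trans_assoc, ← Homotopic.Quotient.trans_assoc (Homotopic.Quotient.mk g),
    Homotopic.Quotient.trans_symm, Homotopic.Quotient.refl_trans]

lemma IsGoodCover.isCocycle (hS : IsGoodCover K S) {ψ : α → α → FundamentalGroup B b₀}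
    (hψ : ∀ u v m (hu : m ∈ S u) (hv : m ∈ S v), ψ u v = (T v m hv).trans (T u m hu).symm) :
    IsCocycle K ψ := by
  intro u v w h
  obtain ⟨m, ⟨hu, hv⟩, hw⟩ := (hS.mem_iff u v w).1 h
  rw [hψ u v m hu hv, hψ v w m hv hw, hψ u w m hu hw, FundamentalGroup.mul_def,
    Homotopic.Quotient.trans_assoc, ← Homotopic.Quotient.trans_assoc (T v m hv).symm, Homotopic.Quotient.symm_trans,
    Homotopic.Quotient.refl_trans]

/-- The loop obtained by tethering both ends of a path. -/
noncomputable def tetherLoop (T : ∀ v p, p ∈ S v → Homotopic.Quotient b₀ p) {u v : α} {p q : B} (hp : p ∈ S u)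
    (hq : q ∈ S v) (a : Homotopic.Quotient p q) : FundamentalGroup B b₀ :=
  ((T u p hp).trans a).trans (T v q hq).symm

lemma tetherLoop_trans {u v w : α} {p q r : B} (hp : p ∈ S u) (hq : q ∈ S v) (hr : r ∈ S w)
    (a : Homotopic.Quotient p q) (b : Homotopic.Quotient q r) :
    tetherLoop T hp hr (a.trans b) = tetherLoop T hq hr b * tetherLoop T hp hq a := by
  rw [FundamentalGroup.mul_def, tetherLoop, tetherLoop, tetherLoop]
  simp only [Homotopic.Quotient.trans_assoc]
  rw [← Homotopic.Quotient.trans_assoc (T v q hq).symm, Homotopic.Quotient.symm_trans, Homotopic.Quotient.refl_trans]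

/-- Loops obtained by tethering `a` lie in the range of `f`, up to the gauge `c`. -/
def InGaugeRange {G : Type} [Group G] (T : ∀ v p, p ∈ S v → Homotopic.Quotient b₀ p)
    (f : G →* FundamentalGroup B b₀) (c : α → FundamentalGroup B b₀) {p q : B}
    (a : Homotopic.Quotient p q) : Prop :=
  ∀ u v (hp : p ∈ S u) (hq : q ∈ S v), c v * tetherLoop T hp hq a * (c u)⁻¹ ∈ f.range

section Surjective

variable {G : Type} [Group G] {f : G →* FundamentalGroup B b₀} {c : α → FundamentalGroup B b₀}
  {φ : α → α → G} {ψ : α → α → FundamentalGroup B b₀} {x : α}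

lemma InGaugeRange.trans (hS : IsGoodCover K S) {p q r : B} {a : Homotopic.Quotient p q}
    {b : Homotopic.Quotient q r} (ha : InGaugeRange T f c a) (hb : InGaugeRange T f c b) :
    InGaugeRange T f c (a.trans b) := by
  intro u w hp hr
  obtain ⟨v, hq⟩ := hS.cover q
  have := mul_mem (hb v w hq hr) (ha u v hp hq)
  rw [tetherLoop_trans hp hq hr]
  convert this using 1
  group

lemma IsGoodCover.inGaugeRange_refl (hS : IsGoodCover K S)
    (hψ : ∀ u v m (hu : m ∈ S u) (hv : m ∈ S v), ψ u v = (T v m hv).trans (T u m hu).symm)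
    (hsol : IsSol K x φ ψ f c) (p : B) : InGaugeRange T f c (Homotopic.Quotient.refl p) := by
  intro u v hu hv
  have h := hsol.2 v u (hS.edge_mem ⟨p, hv, hu⟩)
  rw [hψ v u p hv hu] at h
  rw [tetherLoop, Homotopic.Quotient.trans_refl, h, mul_inv_cancel_right]
  exact ⟨_, rfl⟩

lemma IsGoodCover.inGaugeRange_mk (hS : IsGoodCover K S) (hT : IsTether S b₀ T)
    (hψ : ∀ u v m (hu : m ∈ S u) (hv : m ∈ S v), ψ u v = (T v m hv).trans (T u m hu).symm)
    (hsol : IsSol K x φ ψ f c) {w : α} {p q : B} (γ : Path p q) (hγ : range γ ⊆ S w) :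
    InGaugeRange T f c (Homotopic.Quotient.mk γ) := by
  intro u v hu hv
  have hp : p ∈ S w := hγ ⟨0, γ.source⟩
  have hq : q ∈ S w := hγ ⟨1, γ.target⟩
  have h1 := hS.inGaugeRange_refl hψ hsol p u w hu hp
  have h2 := hS.inGaugeRange_refl hψ hsol q w v hq hv
  have h3 : tetherLoop T hp hq (Homotopic.Quotient.mk γ) = 1 := by
    rw [tetherLoop, hT.trans w p q hp hq γ hγ, Homotopic.Quotient.trans_symm]; rfl
  have h4 : Homotopic.Quotient.mk γ = ((Homotopic.Quotient.refl p).trans (Homotopic.Quotient.mk γ)).trans (Homotopic.Quotient.refl q) := by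
    rw [Homotopic.Quotient.refl_trans, Homotopic.Quotient.trans_refl]
  rw [h4, tetherLoop_trans hu hq hv, tetherLoop_trans hu hp hq, h3]
  convert mul_mem h2 h1 using 1
  group

lemma IsGoodCover.inGaugeRange (hS : IsGoodCover K S) (hT : IsTether S b₀ T)
    (hψ : ∀ u v m (hu : m ∈ S u) (hv : m ∈ S v), ψ u v = (T v m hv).trans (T u m hu).symm)
    (hsol : IsSol K x φ ψ f c) {p q : B} (γ : Path p q) :
    InGaugeRange T f c (Homotopic.Quotient.mk γ) := by
  obtain ⟨t, h0, hmono, ⟨n, hn⟩, ht⟩ := exists_monotone_Icc_subset_open_cover_unitInterval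
    (c := fun v => γ ⁻¹' S v) (fun v => (hS.isOpen v).preimage γ.continuous)
    (fun s _ => by obtain ⟨v, hv⟩ := hS.cover (γ s); exact mem_iUnion.2 ⟨v, hv⟩)
  have key : ∀ k, InGaugeRange T f c (Homotopic.Quotient.mk (γ.subpath (t 0) (t k))) := by
    intro k
    induction k with
    | zero =>
      rw [Path.subpath_self, Homotopic.Quotient.mk_refl]
      exact hS.inGaugeRange_refl hψ hsol _
    | succ k ih =>
      obtain ⟨w, hw⟩ := ht k
      have h1 : InGaugeRange T f c (Homotopic.Quotient.mk (γ.subpath (t k) (t (k + 1)))) := by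
        refine hS.inGaugeRange_mk hT hψ hsol (w := w) _ ?_
        rw [Path.range_subpath_of_le _ _ _ (hmono k.le_succ)]
        exact image_subset_iff.2 hw
      have h2 := ih.trans hS h1
      rwa [← Homotopic.Quotient.mk_trans, Homotopic.Quotient.eq.2 ⟨Path.Homotopy.subpathTransSubpath γ _ _ _⟩] at h2
  have h := key n
  rw [hn n le_rfl, h0, Path.subpath_zero_one] at h
  intro u v hp hq
  have := h u v (by rwa [γ.source]) (by rwa [γ.target])
  convert this using 3
  obtain ⟨γ, rfl, rfl⟩ := γ
  rfl

lemma IsGoodCover.surjective (hS : IsGoodCover K S) (hT : IsTether S b₀ T)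
    (hψ : ∀ u v m (hu : m ∈ S u) (hv : m ∈ S v), ψ u v = (T v m hv).trans (T u m hu).symm)
    (hsol : IsSol K x φ ψ f c) (hx : b₀ ∈ S x) (hTx : T x b₀ hx = .refl b₀) :
    Function.Surjective f := by
  intro g
  obtain ⟨γ, rfl⟩ := Homotopic.Quotient.mk_surjective g
  have h := hS.inGaugeRange hT hψ hsol γ x x hx hx
  rw [hsol.1, inv_one, mul_one, one_mul, tetherLoop, hTx, Homotopic.Quotient.refl_trans] at h
  obtain ⟨y, hy⟩ := h
  refine ⟨y, hy.trans ?_⟩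
  rw [← Homotopic.Quotient.mk_refl, ← Homotopic.Quotient.mk_symm, Path.refl_symm, Homotopic.Quotient.mk_refl]
  exact Homotopic.Quotient.trans_refl _

end Surjective

end Nerve

section Covering

open Set Path

set_option linter.unusedSectionVars false

variable {α : Type} [DecidableEq α] {B : Type} [TopologicalSpace B]
  {K : Finset (Finset α)} {S : α → Set B} {b₀ : B}
  {T : ∀ v p, p ∈ S v → Homotopic.Quotient b₀ p} {G : Type} [Group G]
  {φ : α → α → G}

/-- The total space of the covering with transition functions `φ`, with its charts. -/
lemma IsGoodCover.exists_covering (hS : IsGoodCover K S) (hφ : IsCocycle K φ) :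
    ∃ (E : Type) (_ : TopologicalSpace E) (p : E → B) (chart : α → E → G),
      IsCoveringMap p ∧
      (∀ v b, b ∈ S v → Function.Bijective fun e : p ⁻¹' {b} => chart v e) ∧
      (∀ u v e, p e ∈ S u → p e ∈ S v → chart u e = φ u v * chart v e) ∧
      ∀ v g, IsOpen {e | p e ∈ S v ∧ chart v e = g} := by
  let _ : TopologicalSpace G := ⊥
  have : DiscreteTopology G := ⟨rfl⟩
  choose ind hind using hS.cover
  let Z : FiberBundleCore α B G :=
    { baseSet := S
      isOpen_baseSet := hS.isOpen
      indexAt := ind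
      mem_baseSet_at := hind
      coordChange := fun i j _ g => φ j i * g
      coordChange_self := by
        intro i b hb g
        have h := hφ i i i ((hS.mem_iff i i i).2 ⟨b, ⟨hb, hb⟩, hb⟩)
        rw [mul_eq_left.1 h, one_mul]
      continuousOn_coordChange := by
        intro i j
        exact ((continuous_of_discreteTopology (f := fun g : G => φ j i * g)).comp
          continuous_snd).continuousOn
      coordChange_comp := by
        rintro i j k b ⟨⟨hi, hj⟩, hk⟩ g
        rw [← mul_assoc, hφ k j i ((hS.mem_iff k j i).2 ⟨b, ⟨hk, hj⟩, hi⟩)] }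
  refine ⟨Bundle.TotalSpace G Z.Fiber, inferInstance, Bundle.TotalSpace.proj,
    fun v e => Z.coordChange (ind e.1) v e.1 e.2, FiberBundle.isCoveringMap (F := G) (E := Z.Fiber),
    ?_, ?_, ?_⟩
  · intro v b hb
    constructor
    · rintro ⟨⟨b₁, g⟩, hg⟩ ⟨⟨b', g'⟩, hb'⟩ h
      obtain rfl : b₁ = b := hg
      obtain rfl : b' = b₁ := hb'
      have : g = g' := mul_left_cancel (G := G) (a := φ v (ind b')) h
      subst this
      rfl
    · intro g
      refine ⟨⟨⟨b, ((φ v (ind b))⁻¹ * g : G)⟩, rfl⟩, ?_⟩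
      exact mul_inv_cancel_left (φ v (ind b)) g
  · intro u v e hu hv
    exact (Z.coordChange_comp (ind e.1) v u e.1 ⟨⟨hind _, hv⟩, hu⟩ e.2).symm
  · intro v g
    have h := (Z.localTriv v).continuousOn.isOpen_inter_preimage (Z.localTriv v).open_source
      (isOpen_univ.prod (isOpen_discrete ({g} : Set G)))
    convert h using 1
    ext e
    simp only [mem_ofPred_eq, mem_inter_iff, mem_preimage, mem_prod, mem_univ, true_and,
      mem_singleton_iff]
    refine and_congr ?_ Iff.rfl
    rw [FiberBundleCore.mem_localTriv_source]
    rfl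

variable {E : Type} [TopologicalSpace E] {p : E → B} {chart : α → E → G}

lemma chart_monodromy (hp : IsCoveringMap p)
    (hopen : ∀ v g, IsOpen {e | p e ∈ S v ∧ chart v e = g}) {v : α} {b b' : B}
    (γ : Path b b') (hγ : range γ ⊆ S v) (e : p ⁻¹' {b}) :
    chart v (hp.monodromy (.mk γ) e : E) = chart v (e : E) := by
  have h0 : (γ : C(unitInterval, B)) 0 = p e := γ.source.trans e.2.symm
  set Γ := hp.liftPath γ (e : E) h0 with hΓ
  have hlift : ∀ t, p (Γ t) = γ t := fun t => congrFun (hp.liftPath_lifts γ (e : E) h0) t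
  have hmem : ∀ t, p (Γ t) ∈ S v := fun t => by rw [hlift]; exact hγ ⟨t, rfl⟩
  have hc : IsLocallyConstant fun t => chart v (Γ t) := by
    rw [IsLocallyConstant.iff_exists_open]
    intro t
    refine ⟨_, (hopen v (chart v (Γ t))).preimage Γ.continuous, ⟨hmem t, rfl⟩, ?_⟩
    intro s hs
    exact hs.2
  have h1 := hc.apply_eq_of_preconnectedSpace 1 0
  have h2 : Γ 0 = e := hp.liftPath_zero γ (e : E) h0
  simp only [h2] at h1
  exact h1

/-- Identifications of the fiber over `b₀` with `G`, obtained by transport along tethers. -/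
lemma IsTether.exists_fiberEquiv (hT : IsTether S b₀ T) (hS : IsGoodCover K S)
    (hp : IsCoveringMap p)
    (hbij : ∀ v b, b ∈ S v → Function.Bijective fun e : p ⁻¹' {b} => chart v e)
    (hopen : ∀ v g, IsOpen {e | p e ∈ S v ∧ chart v e = g}) {x : α} (hx : b₀ ∈ S x) :
    ∃ D : α → (p ⁻¹' {b₀} ≃ G), ∀ v m (hm : m ∈ S v) (e : p ⁻¹' {b₀}),
      D v e = chart v (hp.monodromy (T v m hm) e : E) := by
  have key : ∀ v, ∃ D : p ⁻¹' {b₀} ≃ G, ∀ m (hm : m ∈ S v) (e : p ⁻¹' {b₀}),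
      D e = chart v (hp.monodromy (T v m hm) e : E) := by
    intro v
    by_cases hv : (S v).Nonempty
    · obtain ⟨b, hb⟩ := hv
      refine ⟨Equiv.ofBijective _
        ((hbij v b hb).comp (hp.monodromy_bijective (T v b hb))), fun m hm e => ?_⟩
      obtain ⟨γ, hγ⟩ := hS.exists_path hb hm
      rw [← hT.trans v b m hb hm γ hγ, hp.monodromy_trans_apply,
        chart_monodromy hp hopen γ hγ]
      rfl
    · exact ⟨Equiv.ofBijective _ (hbij x b₀ hx), fun m hm => absurd ⟨m, hm⟩ hv⟩
  choose D hD using key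
  exact ⟨D, hD⟩

/-- The fundamental group of a space with a good cover is the edge path group of the nerve. -/
theorem IsUniv.nonempty_fundamentalGroup_mulEquiv {x : α} (hφ : IsUniv K x G φ)
    (hS : IsGoodCover K S) (hK : IsConn K) (hx : b₀ ∈ S x) :
    Nonempty (FundamentalGroup B b₀ ≃* G) := by
  obtain ⟨T, hT, hTx⟩ := hS.exists_isTether hK hx
  obtain ⟨ψ, hψ⟩ := hS.exists_cocycle hT
  obtain ⟨f, c, hsol⟩ := hφ.exists_sol _ ψ (hS.isCocycle hψ)
  have hsurj := hS.surjective hT hψ hsol hx hTx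
  obtain ⟨E, _, p, chart, hp, hbij, htrans, hopen⟩ := hS.exists_covering hφ.cocycle
  obtain ⟨D, hD⟩ := hT.exists_fiberEquiv hS hp hbij hopen hx
  let F : G →* Equiv.Perm (p ⁻¹' {b₀}) :=
    ((D x).symm.permCongrHom : Equiv.Perm G ≃* Equiv.Perm (p ⁻¹' {b₀})).toMonoidHom.comp
      (MulAction.toPermHom G G)
  have hF : ∀ g e, F g e = (D x).symm (g * D x e) := fun g e => rfl
  have hsol₁ : IsSol K x φ (fun u v => hp.monodromyPerm b₀ (ψ u v))
      ((hp.monodromyPerm b₀).comp f) (fun u => hp.monodromyPerm b₀ (c u)) := by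
    refine ⟨(congrArg _ hsol.1).trans (map_one _), fun u v h => ?_⟩
    rw [MonoidHom.comp_apply, ← map_mul, ← map_mul, hsol.2 u v h]
  have hsol₂ : IsSol K x φ (fun u v => hp.monodromyPerm b₀ (ψ u v)) F
      (fun u => (D u).trans (D x).symm) := by
    refine ⟨by ext; simp, fun u v h => ?_⟩
    obtain ⟨m, hu, hv⟩ := hS.inter_nonempty h
    ext1 e
    have h1 : hp.monodromy (T u m hu) (hp.monodromyPerm b₀ (ψ u v) e) =
        hp.monodromy (T v m hv) e := by
      rw [IsCoveringMap.coe_monodromyPerm, ← hp.monodromy_trans_apply, hψ u v m hu hv,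
        Homotopic.Quotient.trans_assoc, Homotopic.Quotient.symm_trans,
        Homotopic.Quotient.trans_refl]
    have h2 : D u (hp.monodromyPerm b₀ (ψ u v) e) = φ u v * D v e := by
      have hm := (hp.monodromy (T v m hv) e).2
      rw [mem_preimage, mem_singleton_iff] at hm
      rw [hD u m hu, h1, hD v m hv]
      exact htrans u v _ (by rwa [hm]) (by rwa [hm])
    rw [Equiv.Perm.mul_apply, Equiv.Perm.mul_apply, hF]
    simp only [Equiv.trans_apply, Equiv.apply_symm_apply]
    rw [h2]
  have hfF := hφ.unique _ _ _ _ _ _ hsol₁ hsol₂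
  have hinj : Function.Injective f := by
    intro g g' h
    have h1 : F g = F g' := by rw [← hfF, MonoidHom.comp_apply, MonoidHom.comp_apply, h]
    have h2 := congrArg (D x) (DFunLike.congr_fun h1 ((D x).symm 1))
    simpa [hF] using h2
  exact ⟨(MulEquiv.ofBijective f ⟨hinj, hsurj⟩).symm⟩

end Covering

section Realization

open Set

variable {α : Type} [DecidableEq α] {B : Type} [TopologicalSpace B]
  {K : Finset (Finset α)} {S : α → Set B}

lemma IsGoodCover.isConn [ConnectedSpace B] (hS : IsGoodCover K S) : IsConn K := by
  constructor
  · obtain ⟨b⟩ := (inferInstance : Nonempty B)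
    obtain ⟨v, hv⟩ := hS.cover b
    exact ⟨v, hS.vertex_mem ⟨b, hv⟩⟩
  · intro x y hx hy
    have hne : ∀ v, {v} ∈ K → (S v).Nonempty := fun v hv => by
      have := hS.inter_nonempty (u := v) (v := v) (by simpa using hv)
      rwa [inter_self] at this
    let U : Set B := ⋃ v ∈ {v | Reach K x v}, S v
    have hU : IsOpen U := isOpen_biUnion fun v _ => hS.isOpen v
    have hUc : Uᶜ = ⋃ v ∈ {v | ¬ Reach K x v}, S v := by
      ext b
      simp only [U, mem_compl_iff, mem_iUnion, mem_ofPred_eq, exists_prop, not_exists, not_and]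
      constructor
      · intro h
        obtain ⟨v, hv⟩ := hS.cover b
        exact ⟨v, fun h' => h v h' hv, hv⟩
      · rintro ⟨v, hv, hb⟩ w hw hbw
        exact hv (hw.trans (Reach.edge (hS.edge_mem ⟨b, hbw, hb⟩)))
    have hclopen : IsClopen U := by
      refine ⟨⟨?_⟩, hU⟩
      rw [hUc]
      exact isOpen_biUnion fun v _ => hS.isOpen v
    have huniv : U = univ := by
      refine hclopen.eq_univ ?_
      obtain ⟨b, hb⟩ := hne x hx
      exact ⟨b, mem_biUnion (show x ∈ {v | Reach K x v} from Relation.ReflTransGen.refl) hb⟩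
    obtain ⟨b, hb⟩ := hne y hy
    have hbU : b ∈ U := huniv ▸ mem_univ b
    obtain ⟨v, hv, hbv⟩ := mem_iUnion₂.1 hbU
    exact Reach.trans hv (Reach.edge (hS.edge_mem ⟨b, hbv, hb⟩))

namespace SimplicialComplex2

variable {N : ℕ} (X : SimplicialComplex2 N)

lemma isCx : IsCx X.faces := ⟨X.nonempty_of_mem, X.card_le_three, X.down_closed⟩

lemma isSparse (h : ∀ Y : SimplicialComplex2 N, Y.IsSubcomplex X → 1 ≤ f 1 Y →
    (1 : ℝ) / 3 < (f 0 Y : ℝ) / (f 1 Y : ℝ)) : IsSparse X.faces := by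
  intro L hL hcx ⟨e, he, he2⟩
  let Y : SimplicialComplex2 N := ⟨L, hcx.nonempty, hcx.card_le, hcx.down⟩
  have h1 : 1 ≤ f 1 Y := Finset.card_pos.2 ⟨e, Finset.mem_filter.2 ⟨he, he2⟩⟩
  have h2 := h Y hL h1
  have h3 : (0 : ℝ) < f 1 Y := by exact_mod_cast h1
  rw [div_lt_div_iff₀ (by norm_num) h3] at h2
  have h4 : f 1 Y < f 0 Y * 3 := by
    have : (f 1 Y : ℝ) < f 0 Y * 3 := by linarith
    exact_mod_cast this
  have h5 : slack L = 3 * f 0 Y - f 1 Y := by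
    have hs : ∀ σ ∈ L, (if σ.card = 1 then (3 : ℤ) else if σ.card = 2 then -1 else 0) =
        3 * (if σ.card = 0 + 1 then 1 else 0) - (if σ.card = 1 + 1 then 1 else 0) := by
      intro σ _
      split_ifs <;> simp_all
    rw [slack, Finset.sum_congr rfl hs, Finset.sum_sub_distrib, ← Finset.mul_sum, f, f,
      Finset.card_filter, Finset.card_filter]
    push_cast
    rfl
  rw [h5]
  omega

variable {X}

lemma mem_convexHull_iff {σ : Finset (Fin N)} {p : Fin N → ℝ} :
    p ∈ convexHull ℝ (basisVec '' (σ : Set (Fin N))) ↔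
      (∀ v, 0 ≤ p v) ∧ ∑ v, p v = 1 ∧ ∀ v ∉ σ, p v = 0 := by
  constructor
  · intro hp
    refine convexHull_min (t := {p : Fin N → ℝ | (∀ v, 0 ≤ p v) ∧ ∑ v, p v = 1 ∧
      ∀ v ∉ σ, p v = 0}) ?_ ?_ hp
    · rintro _ ⟨w, hw, rfl⟩
      refine ⟨fun v => ?_, by simp [basisVec], fun v hv => ?_⟩
      · rw [basisVec, Pi.single_apply]
        split_ifs <;> simp
      · rw [basisVec, Pi.single_apply, if_neg]
        rintro rfl
        exact hv hw
    · rintro p ⟨h1, h2, h3⟩ q ⟨h1', h2', h3'⟩ a b ha hb hab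
      refine ⟨fun v => ?_, ?_, fun v hv => ?_⟩
      · have := h1 v
        have := h1' v
        simp only [Pi.add_apply, Pi.smul_apply, smul_eq_mul]
        positivity
      · simp only [Pi.add_apply, Pi.smul_apply, smul_eq_mul]
        rw [Finset.sum_add_distrib, ← Finset.mul_sum, ← Finset.mul_sum, h2, h2', mul_one,
          mul_one, hab]
      · simp [h3 v hv, h3' v hv]
  · rintro ⟨h1, h2, h3⟩
    have hs : ∑ v ∈ σ, p v = 1 := by
      rw [← h2]
      exact Finset.sum_subset (Finset.subset_univ σ) fun v _ hv => h3 v hv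
    have hp : p = ∑ v ∈ σ, p v • basisVec v := by
      ext w
      simp only [Finset.sum_apply, Pi.smul_apply, smul_eq_mul, basisVec, Pi.single_apply,
        mul_ite, mul_one, mul_zero, Finset.sum_ite_eq]
      split_ifs with hw
      · rfl
      · exact h3 w hw
    rw [hp]
    exact (convex_convexHull ℝ _).sum_mem (fun v _ => h1 v) hs
      fun v hv => subset_convexHull ℝ _ ⟨v, hv, rfl⟩

lemma mem_realization_iff {p : Fin N → ℝ} :
    p ∈ realization X ↔ (∀ v, 0 ≤ p v) ∧ ∑ v, p v = 1 ∧ ∃ σ ∈ X.faces, ∀ v ∉ σ, p v = 0 := by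
  simp only [realization, mem_iUnion₂, mem_convexHull_iff]
  constructor
  · rintro ⟨σ, hσ, h1, h2, h3⟩
    exact ⟨h1, h2, σ, hσ, h3⟩
  · rintro ⟨h1, h2, σ, hσ, h3⟩
    exact ⟨σ, hσ, h1, h2, h3⟩

variable (X) in
/-- The open star of a vertex in the geometric realization. -/
def openStar (v : Fin N) : Set (realization X) := {p | 0 < p.1 v}

variable (X) in
/-- The intersection of the open stars of two vertices, as a subset of the ambient space. -/
def doubleStar (u v : Fin N) : Set (Fin N → ℝ) :=
  {p | p ∈ realization X ∧ 0 < p u ∧ 0 < p v}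

lemma exists_pos_of_mem {σ : Finset (Fin N)} (hσ : σ ∈ X.faces) :
    ∃ p ∈ realization X, ∀ v ∈ σ, 0 < p v := by
  have hc : (0 : ℝ) < σ.card := by exact_mod_cast (X.nonempty_of_mem σ hσ).card_pos
  refine ⟨fun v => if v ∈ σ then (σ.card : ℝ)⁻¹ else 0, ?_, fun v hv => ?_⟩
  · refine mem_realization_iff.2 ⟨fun v => ?_, ?_, σ, hσ, fun v hv => if_neg hv⟩
    · split_ifs <;> positivity
    · rw [Finset.sum_ite_mem, Finset.univ_inter, Finset.sum_const, nsmul_eq_mul]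
      field_simp
  · beta_reduce
    rw [if_pos hv]
    positivity

lemma starConvex_doubleStar (u v : Fin N) :
    StarConvex ℝ ((1 / 2 : ℝ) • (basisVec u + basisVec v)) (doubleStar X u v) := by
  rintro p ⟨hp, hu, hv⟩ a b ha hb hab
  obtain ⟨h1, h2, σ, hσ, h3⟩ := mem_realization_iff.1 hp
  have hb0 : ∀ i w : Fin N, 0 ≤ basisVec i w := fun i w => by
    rw [basisVec, Pi.single_apply]
    split_ifs <;> simp
  have hself : ∀ i : Fin N, basisVec i i = 1 := fun i => by simp [basisVec]
  have hpos : ∀ w, 0 < p w → 1 ≤ basisVec u w + basisVec v w →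
      0 < (a • ((1 / 2 : ℝ) • (basisVec u + basisVec v)) + b • p) w := by
    intro w hw h
    simp only [Pi.add_apply, Pi.smul_apply, smul_eq_mul]
    rcases ha.eq_or_lt with rfl | ha
    · have : b = 1 := by linarith
      subst this
      simpa using hw
    · have := mul_nonneg hb hw.le
      have : 0 < a * (1 / 2 * (basisVec u w + basisVec v w)) := by positivity
      linarith
  refine ⟨mem_realization_iff.2 ⟨fun w => ?_, ?_, σ, hσ, fun w hw => ?_⟩, ?_, ?_⟩
  · have := hb0 u w
    have := hb0 v w
    have := h1 w
    simp only [Pi.add_apply, Pi.smul_apply, smul_eq_mul]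
    positivity
  · have hsum : ∀ i : Fin N, ∑ w, basisVec i w = 1 := fun i => by simp [basisVec]
    simp only [Pi.add_apply, Pi.smul_apply, smul_eq_mul]
    rw [Finset.sum_add_distrib, ← Finset.mul_sum, ← Finset.mul_sum, ← Finset.mul_sum, h2,
      Finset.sum_add_distrib, hsum, hsum]
    linarith
  · have hne : ∀ i, 0 < p i → basisVec i w = 0 := by
      intro i hi
      rw [basisVec, Pi.single_apply, if_neg]
      rintro rfl
      exact hi.ne' (h3 w hw)
    simp [hne u hu, hne v hv, h3 w hw]
  · exact hpos u hu (by rw [hself]; linarith [hb0 v u])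
  · exact hpos v hv (by rw [hself]; linarith [hb0 u v])

lemma contractibleSpace_doubleStar {u v : Fin N} (h : (doubleStar X u v).Nonempty) :
    ContractibleSpace (doubleStar X u v) :=
  (starConvex_doubleStar u v).contractibleSpace h

variable (X) in
lemma isGoodCover : IsGoodCover X.faces (openStar X) where
  isOpen v := isOpen_lt continuous_const ((continuous_apply v).comp continuous_subtype_val)
  cover := by
    rintro ⟨p, hp⟩
    obtain ⟨h1, h2, -⟩ := mem_realization_iff.1 hp
    by_contra! h
    have : ∑ v, p v = 0 := Finset.sum_eq_zero fun v _ =>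
      le_antisymm (not_lt.1 (h v)) (h1 v)
    linarith
  mem_iff u v w := by
    constructor
    · intro h
      obtain ⟨p, hp, hpos⟩ := exists_pos_of_mem h
      exact ⟨⟨p, hp⟩, ⟨hpos u (by simp), hpos v (by simp)⟩, hpos w (by simp)⟩
    · rintro ⟨⟨p, hp⟩, ⟨hu, hv⟩, hw⟩
      obtain ⟨-, -, σ, hσ, h3⟩ := mem_realization_iff.1 hp
      have hmem : ∀ i, 0 < p i → i ∈ σ := fun i hi => by
        by_contra hi'
        exact hi.ne' (h3 i hi')
      refine X.down_closed σ hσ _ ?_ (by simp)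
      intro i hi
      simp only [Finset.mem_insert, Finset.mem_singleton] at hi
      rcases hi with rfl | rfl | rfl
      · exact hmem _ hu
      · exact hmem _ hv
      · exact hmem _ hw
  joined := by
    rintro u v ⟨p, hp⟩ ⟨hpu, hpv⟩ ⟨q, hq⟩ ⟨hqu, hqv⟩
    have hp' : p ∈ doubleStar X u v := ⟨hp, hpu, hpv⟩
    have hq' : q ∈ doubleStar X u v := ⟨hq, hqu, hqv⟩
    have := contractibleSpace_doubleStar ⟨p, hp'⟩
    let γ := PathConnectedSpace.somePath (⟨p, hp'⟩ : doubleStar X u v) ⟨q, hq'⟩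
    refine ⟨γ.map (f := fun a : doubleStar X u v => (⟨a.1, a.2.1⟩ : realization X))
      (by fun_prop), fun t => ⟨(γ t).2.2.1, (γ t).2.2.2⟩⟩
  homotopic := by
    intro v p q γ γ' hγ hγ'
    have lift : ∀ δ : Path p q, range δ ⊆ openStar X v → ∀ t,
        (δ t).1 ∈ doubleStar X v v := fun δ hδ t =>
      ⟨(δ t).2, hδ ⟨t, rfl⟩, hδ ⟨t, rfl⟩⟩
    have hp : p.1 ∈ doubleStar X v v := by simpa using lift γ hγ 0
    have hq : q.1 ∈ doubleStar X v v := by simpa using lift γ hγ 1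
    have := contractibleSpace_doubleStar ⟨_, hp⟩
    let up : ∀ δ : Path p q, range δ ⊆ openStar X v →
        Path (⟨p.1, hp⟩ : doubleStar X v v) ⟨q.1, hq⟩ := fun δ hδ =>
      { toFun := fun t => ⟨(δ t).1, lift δ hδ t⟩
        continuous_toFun := by fun_prop
        source' := by simp
        target' := by simp }
    have h := SimplyConnectedSpace.paths_homotopic (up γ hγ) (up γ' hγ')
    exact h.map ⟨fun a : doubleStar X v v => (⟨a.1, a.2.1⟩ : realization X), by fun_prop⟩

end SimplicialComplex2

end Realization

open SimplicialComplex2 in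
theorem pi1_iso_free_product {N : ℕ} (X : SimplicialComplex2 N)
    (hconn : IsConnected (realization X))
    (hsparse : ∀ Y : SimplicialComplex2 N, Y.IsSubcomplex X → 1 ≤ f 1 Y →
      (1 : ℝ) / 3 < (f 0 Y : ℝ) / (f 1 Y))
    (x : Fin N) (hx : {x} ∈ X.faces) :
    ∃ k m : ℕ,
      Nonempty (FundamentalGroup (↥(realization X)) (vertexPt X hx) ≃*
        Monoid.CoprodI (FPfamily k m)) := by
  have hcover := isGoodCover X
  have : ConnectedSpace (realization X) := isConnected_iff_connectedSpace.1 hconn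
  have hK : IsConn X.faces := hcover.isConn
  obtain ⟨G, _, hG, huniv⟩ := (isSparse X hsparse).hasGoodUniv (isCx X) hK
  obtain ⟨φ, hφ⟩ := huniv.exists_at hK hx
  obtain ⟨k, m, ⟨e⟩⟩ := hG.exists_mulEquiv
  have hmem : vertexPt X hx ∈ openStar X x := by
    change (0 : ℝ) < basisVec x x
    simp [basisVec]
  obtain ⟨e'⟩ := hφ.nonempty_fundamentalGroup_mulEquiv hcover hK hmem
  exact ⟨k, m, ⟨e'.trans e⟩⟩
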